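/- Let $X$ be a projective K3 surface over an algebraically closed field $k$, that is, a smooth projective integral surface over $k$ with $\omega_X\cong\mathcal O_X$ and $H^1(X,\mathcal O_X)=0$. A rational curve in $X$ is an integral curve in $X$ that is birational to $\mathbb P^1_k$; the Beauville–Voisin class $c_X\in \mathrm{CH}^2(X)$ is the class that is represented by every closed point of $X$ lying on a rational curve (it is part of the standing conventions that rational curves exist in $X$ and that all closed points on them have the same class). For an integral curve $D\subset X$ with generic point $\eta_D$ let $\kappa_D=[\eta_D]-[\{x_0\}\times\eta_D]\in \mathrm{CH}^2(X\times_k k(\eta_D))$ be the restriction to the generic fibre of the second projection $X\times D\to D$ of the cycle $\Delta_D-\{x_0\}\times D$ on $X\times D$, where $\Delta_D$ is the graph of the inclusion $D\subset X$ and $x_0\in X$ is a closed point with $[x_0]=c_X$. A curve $C\subset X$ (a non-empty closed subscheme of pure dimension one) is a constant cycle curve of order $n$ if, for every integral component $D$ of $C$, the class $\kappa_D$ is torsion and if $n$ is the maximum of the orders of the classes $\kappa_D$. Let $C\subset X$ be a curve, and let $K/k$ be a field extension with $K$ algebraically closed. Put $X_K=X\times_kK$ and $C_K=C\times_kK$.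 Then, for every $n$, $C$ is a constant cycle curve of order $n$ in $X$ if and only if $C_K$ is a constant cycle curve of order $n$ in $X_K$ (with respect to the Beauville–Voisin classes $c_X$ and $c_{X_K}$). -/

import Mathlib

open CategoryTheory CategoryTheory.Limits AlgebraicGeometry Order

universe u

noncomputable section

namespace K3Curves

/-! ### Cycles and rational equivalence -/

/-- The cycles `i_* div(f)`, for `i : W ⟶ Y` the inclusion of an integral closed subscheme and `f`
a nonzero rational function on `W`. A cycle is a function on the points of `Y`, a point standing for
its closure; the coefficient of `i_* div(f)` at a point `w` of `W` is the order of vanishing of `f`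
along the closure of `w` (which is zero unless `w` has codimension one in `W`), and the coefficient
at a point outside `W` is zero. -/
def IsPrincipalCycle (Y : Scheme.{u}) (z : AlgebraicCycle Y ℤ) : Prop :=
  ∃ (W : Scheme.{u}) (_ : AlgebraicGeometry.IsIntegral W) (_ : IsLocallyNoetherian W) (i : W ⟶ Y)
    (_ : IsClosedImmersion i) (f : W.functionField),
    f ≠ 0 ∧ (∀ w : W, z (i w) = Scheme.ord f w) ∧ ∀ y : Y, y ∉ Set.range i → z y = 0

/-- The group of cycles rationally equivalent to zero. -/
def rationalEquivalence (Y : Scheme.{u}) : AddSubgroup (AlgebraicCycle Y ℤ) :=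
  AddSubgroup.closure {z | IsPrincipalCycle Y z}

/-- The Chow group `CH(Y) = ⨁ₚ CHᵖ(Y)` of cycles modulo rational equivalence. The classes of
closed points of a smooth surface lie in the direct summand `CH²(Y)`, so the order of a difference
of two such classes is the same in `CH²(Y)` and in `CH(Y)`. -/
abbrev ChowGroup (Y : Scheme.{u}) : Type u :=
  AlgebraicCycle Y ℤ ⧸ rationalEquivalence Y

/-- The class of (the closure of) a point. -/
def pointClass {Y : Scheme.{u}} (y : Y) : ChowGroup Y :=
  letI := Classical.decEq Y
  QuotientAddGroup.mk (Function.locallyFinsuppWithin.single y (1 : ℤ) : AlgebraicCycle Y ℤ)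

/-! ### K3 surfaces -/

/-- The module `⋀² Ω_{A/k}` of algebraic 2-forms. -/
abbrev TwoForms (k A : Type u) [CommRing k] [CommRing A] [Algebra k A] : Type u :=
  ⋀[A]^2 (Ω[A⁄k])

/-- The pullback of 2-forms `⋀² Ω_{A/k} → ⋀² Ω_{B/k}`, `a₀ da₁ ∧ da₂ ↦ b₀ db₁ ∧ db₂` with `bᵢ` the
image of `aᵢ`, for a homomorphism `A → B` of `k`-algebras. -/
def TwoForms.map (k A B : Type u) [CommRing k] [CommRing A] [CommRing B] [Algebra k A]
    [Algebra k B] [Algebra A B] [IsScalarTower k A B] : TwoForms k A →ₗ[A] TwoForms k B :=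
  exteriorPower.alternatingMapLinearEquiv
    (({ (exteriorPower.ιMulti B 2 (M := Ω[B⁄k])).toMultilinearMap.restrictScalars A with
        map_eq_zero_of_eq' := fun v _ _ h hij =>
          (exteriorPower.ιMulti B 2 (M := Ω[B⁄k])).map_eq_zero_of_eq v h hij } :
      (Ω[B⁄k]) [⋀^Fin 2]→ₗ[A] (TwoForms k B)).compLinearMap (KaehlerDifferential.map k k A B))

section K3

variable {k : Type u} [Field k] {X : Scheme.{u}}

/-- The homomorphism `k → Γ(X, U)` given by the structure morphism of a `k`-scheme `X`. -/
def scalars (f : X ⟶ Spec (.of k)) (U : X.Opens) : k →+* Γ(X, U) :=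
  ((Scheme.ΓSpecIso (.of k)).inv ≫ f.appTop ≫ X.presheaf.map (homOfLE le_top).op).hom

theorem map_comp_scalars (f : X ⟶ Spec (.of k)) {U V : X.Opens} (h : U ≤ V) :
    (X.presheaf.map (homOfLE h).op).hom.comp (scalars f V) = scalars f U := by
  rw [scalars, scalars, ← CommRingCat.hom_comp, Category.assoc, Category.assoc, ← Functor.map_comp]
  rfl

/-- The 2-forms over `k` on an affine open subset `U` of `X`. -/
abbrev twoFormsOn (f : X ⟶ Spec (.of k)) (U : X.affineOpens) : Type u :=
  letI := (scalars f U).toAlgebra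
  TwoForms k Γ(X, U)

/-- Restriction of 2-forms between affine open subsets. -/
def restrictTwoForm (f : X ⟶ Spec (.of k)) {U V : X.affineOpens} (h : U ≤ V)
    (ω : twoFormsOn f V) : twoFormsOn f U :=
  letI := (scalars f U).toAlgebra
  letI := (scalars f V).toAlgebra
  letI : Algebra Γ(X, V) Γ(X, U) :=
    (X.presheaf.map (homOfLE (show U.1 ≤ V.1 from h)).op).hom.toAlgebra
  haveI : IsScalarTower k Γ(X, V) Γ(X, U) :=
    IsScalarTower.of_algebraMap_eq' (by
      simp only [RingHom.algebraMap_toAlgebra]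
      exact (map_comp_scalars f h).symm)
  TwoForms.map k Γ(X, V) Γ(X, U) ω

/-- The canonical sheaf `ω_X = ⋀² Ω_{X/k}` of a smooth surface is trivial: it has a global section
(a compatible family of sections over the affine open subsets) that freely generates it. -/
def HasTrivialCanonicalSheaf (f : X ⟶ Spec (.of k)) : Prop :=
  ∃ ω : ∀ U : X.affineOpens, twoFormsOn f U,
    (∀ (U V : X.affineOpens) (h : U ≤ V), restrictTwoForm f h (ω V) = ω U) ∧
    ∀ U : X.affineOpens, Function.Bijective fun a : Γ(X, U) => (a • ω U : twoFormsOn f U)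

/-- The cohomology group `Hⁿ(X, 𝒪_X)`. -/
abbrev structureSheafCohomology (X : Scheme.{u}) (n : ℕ) : Type u :=
  Sheaf.H ((SheafOfModules.toSheaf _).obj (SheafOfModules.unit X.ringCatSheaf)) n

attribute [local instance] MvPolynomial.gradedAlgebra in
/-- `X` is projective over `k`: it has a closed immersion over `k` into some `ℙⁿ_k`. -/
def IsProjectiveOver (f : X ⟶ Spec (.of k)) : Prop :=
  ∃ (n : ℕ) (j : X ⟶ Proj (MvPolynomial.homogeneousSubmodule (Fin (n + 1)) k)),
    IsClosedImmersion j ∧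
      j ≫ Proj.toSpecZero (MvPolynomial.homogeneousSubmodule (Fin (n + 1)) k) ≫
        Spec.map (CommRingCat.ofHom
          (algebraMap k (MvPolynomial.homogeneousSubmodule (Fin (n + 1)) k 0))) = f

/-- Projective K3 surfaces over a field `k`: smooth projective geometrically integral surfaces with
`ω_X ≅ 𝒪_X` and `H¹(X, 𝒪_X) = 0`. -/
structure IsProjectiveK3Surface (f : X ⟶ Spec (.of k)) : Prop where
  projective : IsProjectiveOver f
  smooth : SmoothOfRelativeDimension 2 f
  geometricallyIntegral : GeometricallyIntegral f
  trivialCanonicalSheaf : HasTrivialCanonicalSheaf f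
  vanishing : Subsingleton (structureSheafCohomology X 1)

/-! ### The Beauville–Voisin class -/

/-- `x` is a closed point of `X` that lies on a rational curve, i.e. on an integral closed
subscheme of `X` that is birational over `k` to the affine line. -/
def IsClosedPointOnRationalCurve (f : X ⟶ Spec (.of k)) (x : X) : Prop :=
  IsClosed {x} ∧ ∃ (R : Scheme.{u}) (_ : AlgebraicGeometry.IsIntegral R) (j : R ⟶ X)
    (_ : IsClosedImmersion j),
    Scheme.BirationalOver (j ≫ f) (𝔸(PUnit.{u + 1}; Spec (.of k)) ↘ Spec (.of k)) ∧
      x ∈ Set.range j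

/-- `c` is the Beauville–Voisin class of `X`: the class represented by any closed point lying on
a rational curve in `X`. -/
def IsBeauvilleVoisinClass (f : X ⟶ Spec (.of k)) (c : ChowGroup X) : Prop :=
  (∃ x : X, IsClosedPointOnRationalCurve f x) ∧
    ∀ x : X, IsClosedPointOnRationalCurve f x → pointClass x = c

theorem IsBeauvilleVoisinClass.unique {f : X ⟶ Spec (.of k)} {c c' : ChowGroup X}
    (h : IsBeauvilleVoisinClass f c) (h' : IsBeauvilleVoisinClass f c') : c = c' := by
  obtain ⟨x, hx⟩ := h.1
  rw [← h.2 x hx, h'.2 x hx]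

/-! ### Constant cycle curves -/

/-- `i : C ⟶ X` is the inclusion of a curve: a nonempty closed subscheme, all of whose irreducible
components have dimension one. -/
structure IsCurve {C : Scheme.{u}} (i : C ⟶ X) : Prop where
  isClosedImmersion : IsClosedImmersion i
  nonempty : Nonempty C
  dimension : ∀ Z ∈ irreducibleComponents C, topologicalKrullDim Z = 1

/-- A point `p : Spec F ⟶ X` with values in a field `F` over `k`, viewed as a (closed, `F`-rational)
point of the base change `X ×ₖ F`. -/
def rationalPoint (f : X ⟶ Spec (.of k)) {T : Scheme.{u}} [Unique T] (q : T ⟶ Spec (.of k))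
    (p : T ⟶ X) (h : p ≫ f = q) : (pullback f q : Scheme.{u}) :=
  pullback.lift (f := f) (g := q) p (𝟙 T) (by rw [h, Category.id_comp]) default

/-- The class `κ = [η] - [x₀ ×ₖ k(η)]` in the Chow group of `X ×ₖ k(η)`, where `i : C ⟶ X` is the
inclusion of a curve, `η` is a point of `C` and `x₀` is a `k`-rational point of `X`.
If `C` is integral with generic point `η`, then `X ×ₖ k(η)` is the generic fibre of the second
projection `X × C → C`, the point `η` is the restriction to it of the graph `Δ_C ⊂ X × C` and
`x₀ ×ₖ k(η)` is the restriction to it of `{x₀} × C`, so that this is the class `κ_C`.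
If `η` is the generic point of an irreducible component `D` of an arbitrary `C`, then `k(η)` is the
function field of `D` with its reduced structure, and this is the class `κ_D`. -/
def kappa (f : X ⟶ Spec (.of k)) {C : Scheme.{u}} (i : C ⟶ X) (x₀ : Spec (.of k) ⟶ X)
    (hx₀ : x₀ ≫ f = 𝟙 _) (η : C) :
    ChowGroup (pullback f (C.fromSpecResidueField η ≫ i ≫ f)) :=
  pointClass (rationalPoint f (C.fromSpecResidueField η ≫ i ≫ f)
      (C.fromSpecResidueField η ≫ i) (by rw [Category.assoc])) -
    pointClass (rationalPoint f (C.fromSpecResidueField η ≫ i ≫ f)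
      ((C.fromSpecResidueField η ≫ i ≫ f) ≫ x₀) (by rw [Category.assoc, hx₀, Category.comp_id]))

/-- The generic points of the irreducible components of `C`, i.e. of its integral components. -/
def componentGenericPoints (C : Scheme.{u}) : Set C :=
  {η | closure {η} ∈ irreducibleComponents C}

/-- The curve `C ⊂ X` is a constant cycle curve of order `n`, where `x₀` is a closed point of `X`
that represents the Beauville–Voisin class: the class `κ_D` of every integral component `D` of `C`
is torsion, and `n` is the maximal order of these classes. -/
def IsConstantCycleCurveOfOrder (f : X ⟶ Spec (.of k)) {C : Scheme.{u}} (i : C ⟶ X)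
    (x₀ : Spec (.of k) ⟶ X) (hx₀ : x₀ ≫ f = 𝟙 _) (n : ℕ) : Prop :=
  (∀ η ∈ componentGenericPoints C, IsOfFinAddOrder (kappa f i x₀ hx₀ η)) ∧
    IsGreatest ((fun η => addOrderOf (kappa f i x₀ hx₀ η)) '' componentGenericPoints C) n

/-- The class in the Chow group of `X` of a `k`-rational point. -/
def rationalPointClass (x₀ : Spec (.of k) ⟶ X) : ChowGroup X :=
  pointClass (x₀ (IsLocalRing.closedPoint k))

/-! ### Base change -/

/-- The morphism `Spec K ⟶ Spec k` of a field extension. -/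
def specExtension (k K : Type u) [Field k] [Field K] [Algebra k K] :
    Spec (.of K) ⟶ Spec (.of k) :=
  Spec.map (CommRingCat.ofHom (algebraMap k K))

/-- The base change `C_K ⟶ X_K` of a morphism `C ⟶ X` of `k`-schemes, with `X_K = X ×ₖ K` and
`C_K = C ×ₖ K`. -/
def baseChange (f : X ⟶ Spec (.of k)) {C : Scheme.{u}} (i : C ⟶ X) (K : Type u) [Field K]
    [Algebra k K] : pullback (i ≫ f) (specExtension k K) ⟶ pullback f (specExtension k K) :=
  pullback.map (i ≫ f) (specExtension k K) f (specExtension k K) i (𝟙 _) (𝟙 _)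
    (by rw [Category.comp_id]) (by rw [Category.comp_id, Category.id_comp])

end K3

end K3Curves

end

noncomputable section

namespace K3Curves

open scoped TensorProduct

/-! ### Lengths of modules at primes -/

section LengthAt

variable {R : Type*} [CommRing R] (p : Ideal R) [p.IsPrime]

/-- The length of the localization `Mₚ` as a module over `Rₚ`. -/
def lengthAt (M : Type*) [AddCommGroup M] [Module R M] : ℕ∞ :=
  Module.length (Localization.AtPrime p) (LocalizedModule p.primeCompl M)

variable {M N P : Type*} [AddCommGroup M] [Module R M] [AddCommGroup N] [Module R N]
  [AddCommGroup P] [Module R P]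

theorem lengthAt_eq_add_of_exact (f : N →ₗ[R] M) (g : M →ₗ[R] P) (hf : Function.Injective f)
    (hg : Function.Surjective g) (H : Function.Exact f g) :
    lengthAt p M = lengthAt p N + lengthAt p P :=
  Module.length_eq_add_of_exact (LocalizedModule.map p.primeCompl f)
    (LocalizedModule.map p.primeCompl g) (LocalizedModule.map_injective _ f hf)
    (LocalizedModule.map_surjective _ g hg) (LocalizedModule.map_exact _ f g H)

theorem lengthAt_of_subsingleton [Subsingleton M] : lengthAt p M = 0 := by
  have := lengthAt_eq_add_of_exact p (0 : M →ₗ[R] M) (0 : M →ₗ[R] M)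
    (Function.injective_of_subsingleton _) (fun x => ⟨0, Subsingleton.elim _ _⟩)
    (fun x => ⟨fun _ => ⟨0, Subsingleton.elim _ _⟩, fun _ => rfl⟩)
  have h : Subsingleton (LocalizedModule p.primeCompl M) := by
    refine ⟨fun x y => ?_⟩
    induction x using LocalizedModule.induction_on with | _ m s
    induction y using LocalizedModule.induction_on with | _ n t
    rw [Subsingleton.elim m 0, Subsingleton.elim n 0]; simp
  exact Module.length_eq_zero

theorem lengthAt_congr (e : M ≃ₗ[R] N) : lengthAt p M = lengthAt p N := by
  have := lengthAt_eq_add_of_exact p e.toLinearMap (0 : N →ₗ[R] PUnit) e.injective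
    (fun x => ⟨0, Subsingleton.elim _ _⟩) (fun x => ⟨fun _ => e.surjective x, fun _ => rfl⟩)
  rw [this, lengthAt_of_subsingleton p (M := PUnit), add_zero]

theorem lengthAt_le_of_injective (f : N →ₗ[R] M) (hf : Function.Injective f) :
    lengthAt p N ≤ lengthAt p M := by
  rw [lengthAt_eq_add_of_exact p f (LinearMap.range f).mkQ hf
    (Submodule.mkQ_surjective _) (LinearMap.exact_map_mkQ_range f)]
  exact le_self_add

theorem lengthAt_le_of_surjective (f : M →ₗ[R] N) (hf : Function.Surjective f) :
    lengthAt p N ≤ lengthAt p M := by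
  rw [lengthAt_eq_add_of_exact p (LinearMap.ker f).subtype f Subtype.val_injective hf
    (LinearMap.exact_subtype_ker_map f)]
  exact le_add_self

theorem lengthAt_eq_zero_of_smul_eq_zero {s : R} (hs : s ∉ p) (h : ∀ m : M, s • m = 0) :
    lengthAt p M = 0 := by
  have : Subsingleton (LocalizedModule p.primeCompl M) :=
    LocalizedModule.subsingleton_iff.mpr fun m => ⟨s, hs, h m⟩
  exact Module.length_eq_zero

/-- The length at a prime can be computed on any localization. -/
theorem length_eq_lengthAt (O : Type*) [CommRing O] [Algebra R O] [IsLocalization.AtPrime O p]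
    [Module O N] [IsScalarTower R O N] (f : M →ₗ[R] N) [IsLocalizedModule p.primeCompl f] :
    Module.length O N = lengthAt p M := by
  let e : Localization.AtPrime p ≃ₐ[R] O := IsLocalization.algEquiv p.primeCompl _ _
  let : Algebra (Localization.AtPrime p) O := e.toRingHom.toAlgebra
  let : Module (Localization.AtPrime p) N := Module.compHom N e.toRingHom
  have : IsScalarTower (Localization.AtPrime p) O N :=
    ⟨fun a b c => by rw [Algebra.smul_def, mul_smul]; rfl⟩
  have : IsScalarTower R (Localization.AtPrime p) N := ⟨fun a b c => by
    change e (a • b) • c = a • e b • c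
    rw [map_smul, smul_assoc]⟩
  rw [← Module.length_eq_of_surjective (S := Localization.AtPrime p) (R := O) e.surjective]
  exact ((IsLocalizedModule.linearEquiv p.primeCompl f
    (LocalizedModule.mkLinearMap p.primeCompl M)).extendScalarsOfIsLocalization
      p.primeCompl (Localization.AtPrime p)).length_eq

/-- The length of `R ⧸ J` at `p`, computed on a localization. -/
theorem length_quotient_map_eq_lengthAt (O : Type*) [CommRing O] [Algebra R O]
    [IsLocalization.AtPrime O p] (J : Ideal R) :
    Module.length O (O ⧸ J.map (algebraMap R O)) = lengthAt p (R ⧸ J) := by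
  rw [← length_eq_lengthAt p O
    (Submodule.toLocalizedQuotient' O p.primeCompl (Algebra.linearMap R O) J)]
  refine (Submodule.quotEquivOfEq _ _ ?_).length_eq
  rw [Submodule.localized'_eq_span]
  rfl

theorem lengthAt_quotient_self : lengthAt p (R ⧸ p) = 1 := by
  rw [← length_quotient_map_eq_lengthAt p (Localization.AtPrime p),
    Localization.AtPrime.map_eq_maximalIdeal, Module.length_eq_one_iff,
    isSimpleModule_iff_isSimpleModule_of_algebraMap_surjective
      (S := _ ⧸ IsLocalRing.maximalIdeal (Localization.AtPrime p)) Ideal.Quotient.mk_surjective]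
  let := Ideal.Quotient.field (IsLocalRing.maximalIdeal (Localization.AtPrime p))
  exact instIsSimpleModule _

theorem lengthAt_quotient_eq_zero {J : Ideal R} (h : ¬ J ≤ p) : lengthAt p (R ⧸ J) = 0 := by
  obtain ⟨s, hs, hsp⟩ := SetLike.not_le_iff_exists.mp h
  refine lengthAt_eq_zero_of_smul_eq_zero p hsp fun m => ?_
  obtain ⟨m, rfl⟩ := Ideal.Quotient.mk_surjective m
  rw [Algebra.smul_def, Ideal.Quotient.algebraMap_eq, ← map_mul, Ideal.Quotient.eq_zero_iff_mem]
  exact J.mul_mem_right _ hs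

theorem lengthAt_quotient_anti {I J : Ideal R} (h : I ≤ J) :
    lengthAt p (R ⧸ J) ≤ lengthAt p (R ⧸ I) :=
  lengthAt_le_of_surjective p (Submodule.factor h) (Submodule.factor_surjective h)

theorem lengthAt_eq_range_add_range {f : N →ₗ[R] M} {g : M →ₗ[R] P} (H : Function.Exact f g) :
    lengthAt p M = lengthAt p (LinearMap.range f) + lengthAt p (LinearMap.range g) := by
  refine lengthAt_eq_add_of_exact p (LinearMap.range f).subtype g.rangeRestrict
    Subtype.val_injective g.surjective_rangeRestrict fun y => ?_
  rw [← Subtype.coe_inj]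
  simpa using H y

/-- Alternating sum of lengths in an exact sequence `0 → A → B → C → D → E → G → 0`. -/
theorem lengthAt_add_of_exact_six {A B C D E G : Type*} [AddCommGroup A] [Module R A]
    [AddCommGroup B] [Module R B] [AddCommGroup C] [Module R C] [AddCommGroup D] [Module R D]
    [AddCommGroup E] [Module R E] [AddCommGroup G] [Module R G]
    (f₁ : A →ₗ[R] B) (f₂ : B →ₗ[R] C) (f₃ : C →ₗ[R] D) (f₄ : D →ₗ[R] E) (f₅ : E →ₗ[R] G)
    (h₀ : Function.Injective f₁) (h₁ : Function.Exact f₁ f₂) (h₂ : Function.Exact f₂ f₃)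
    (h₃ : Function.Exact f₃ f₄) (h₄ : Function.Exact f₄ f₅) (h₅ : Function.Surjective f₅) :
    lengthAt p A + lengthAt p C + lengthAt p E = lengthAt p B + lengthAt p D + lengthAt p G := by
  have hA : lengthAt p A = lengthAt p (LinearMap.range f₁) :=
    lengthAt_congr p (LinearEquiv.ofInjective f₁ h₀)
  have hG : lengthAt p G = lengthAt p (LinearMap.range f₅) :=
    lengthAt_congr p ((LinearEquiv.ofTop _ (LinearMap.range_eq_top.mpr h₅)).symm)
  rw [hA, hG, lengthAt_eq_range_add_range p h₁, lengthAt_eq_range_add_range p h₂,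
    lengthAt_eq_range_add_range p h₃, lengthAt_eq_range_add_range p h₄]
  ring

end LengthAt

/-! ### Multiplicities of one-dimensional modules -/

section Multiplicity

open scoped Pointwise

variable {R : Type u} [CommRing R] (y : Ideal R) [y.IsPrime] (a : R)

/-- The length at `y` of the cokernel of multiplication by `a`. -/
def cokerLengthAt (M : Type*) [AddCommGroup M] [Module R M] : ℕ∞ :=
  lengthAt y (M ⧸ LinearMap.range (LinearMap.lsmul R M a))

/-- The length at `y` of the kernel of multiplication by `a`. -/
def kerLengthAt (M : Type*) [AddCommGroup M] [Module R M] : ℕ∞ :=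
  lengthAt y (LinearMap.ker (LinearMap.lsmul R M a))

variable {M N P : Type*} [AddCommGroup M] [Module R M] [AddCommGroup N] [Module R N]
  [AddCommGroup P] [Module R P]

theorem kerLengthAt_add_cokerLengthAt (f : N →ₗ[R] M) (g : M →ₗ[R] P) (hf : Function.Injective f)
    (hg : Function.Surjective g) (H : Function.Exact f g) :
    kerLengthAt y a M ≤ kerLengthAt y a N + kerLengthAt y a P ∧
      kerLengthAt y a N + kerLengthAt y a P + cokerLengthAt y a M =
        kerLengthAt y a M + cokerLengthAt y a N + cokerLengthAt y a P := by
  let i₁ := LinearMap.lsmul R N a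
  let i₂ := LinearMap.lsmul R M a
  let i₃ := LinearMap.lsmul R P a
  have h₁ : f.comp i₁ = i₂.comp f := by ext x; simp [i₁, i₂]
  have h₂ : g.comp i₂ = i₃.comp g := by ext x; simp [i₃, i₂]
  let K₁ : LinearMap.ker i₁ →ₗ[R] LinearMap.ker i₂ := f.restrict fun x hx => by
    have := LinearMap.congr_fun h₁ x
    simp only [LinearMap.comp_apply, LinearMap.mem_ker.mp hx, map_zero] at this
    exact this.symm
  let K₂ : LinearMap.ker i₂ →ₗ[R] LinearMap.ker i₃ := g.restrict fun x hx => by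
    have := LinearMap.congr_fun h₂ x
    simp only [LinearMap.comp_apply, LinearMap.mem_ker.mp hx, map_zero] at this
    exact this.symm
  let C₁ : (N ⧸ LinearMap.range i₁) →ₗ[R] (M ⧸ LinearMap.range i₂) :=
    Submodule.mapQ _ _ f (by
      rintro _ ⟨x, rfl⟩; exact ⟨f x, (LinearMap.congr_fun h₁ x).symm⟩)
  let C₂ : (M ⧸ LinearMap.range i₂) →ₗ[R] (P ⧸ LinearMap.range i₃) :=
    Submodule.mapQ _ _ g (by
      rintro _ ⟨x, rfl⟩; exact ⟨g x, (LinearMap.congr_fun h₂ x).symm⟩)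
  have e₂ : Function.Exact (LinearMap.ker i₂).subtype i₂ := LinearMap.exact_subtype_ker_map i₂
  have e₃ : Function.Exact (LinearMap.ker i₃).subtype i₃ := LinearMap.exact_subtype_ker_map i₃
  have q₁ : Function.Exact i₁ (LinearMap.range i₁).mkQ := LinearMap.exact_map_mkQ_range i₁
  have q₂ : Function.Exact i₂ (LinearMap.range i₂).mkQ := LinearMap.exact_map_mkQ_range i₂
  have eK : Function.Exact K₁ K₂ := by
    intro x
    constructor
    · intro hx
      obtain ⟨n, hn⟩ := (H x.1).mp (congrArg Subtype.val hx)
      refine ⟨⟨n, ?_⟩, Subtype.ext hn⟩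
      apply hf
      have := LinearMap.congr_fun h₁ n
      rw [LinearMap.comp_apply, LinearMap.comp_apply, hn] at this
      rw [this, map_zero]
      exact x.2
    · rintro ⟨n, rfl⟩
      exact Subtype.ext ((H _).mpr ⟨n.1, rfl⟩)
  refine ⟨?_, lengthAt_add_of_exact_six y K₁ K₂
    (SnakeLemma.δ' i₁ i₂ i₃ f g H f g H h₁ h₂ (LinearMap.ker i₃).subtype e₃
      (LinearMap.range i₁).mkQ q₁ hg hf) C₁ C₂ ?_ eK ?_ ?_ ?_ ?_⟩
  · rw [kerLengthAt, lengthAt_eq_range_add_range y eK]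
    exact add_le_add (lengthAt_le_of_surjective y K₁.rangeRestrict K₁.surjective_rangeRestrict)
      (lengthAt_le_of_injective y (Submodule.subtype _) Subtype.val_injective)
  · intro x z hxz
    exact Subtype.ext (hf (congrArg Subtype.val hxz))
  · exact SnakeLemma.exact_δ'_right i₁ i₂ i₃ f g H f g H h₁ h₂ (LinearMap.ker i₂).subtype e₂ _ e₃
      _ q₁ hg hf K₂ rfl Subtype.val_injective
  · exact SnakeLemma.exact_δ'_left i₁ i₂ i₃ f g H f g H h₁ h₂ _ e₃ _ q₁ (LinearMap.range i₂).mkQ q₂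
      hg hf C₁ rfl (Submodule.mkQ_surjective _)
  · intro x
    obtain ⟨m, rfl⟩ := Submodule.mkQ_surjective _ x
    constructor
    · intro hx
      obtain ⟨z, hz⟩ := (Submodule.Quotient.mk_eq_zero _).mp hx
      obtain ⟨m', rfl⟩ := hg z
      obtain ⟨n, hn⟩ := (H (m - i₂ m')).mp (by
        rw [map_sub, ← hz, sub_eq_zero]; exact (LinearMap.congr_fun h₂ m').symm)
      refine ⟨(LinearMap.range i₁).mkQ n, ?_⟩
      change (LinearMap.range i₂).mkQ (f n) = _
      rw [hn, map_sub, sub_eq_self]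
      exact (Submodule.Quotient.mk_eq_zero _).mpr ⟨m', rfl⟩
    · rintro ⟨n, hn⟩
      obtain ⟨n, rfl⟩ := Submodule.mkQ_surjective _ n
      rw [← hn]
      change (LinearMap.range i₃).mkQ (g (f n)) = 0
      rw [(H (f n)).mpr ⟨n, rfl⟩, map_zero]
  · intro x
    obtain ⟨m, rfl⟩ := Submodule.mkQ_surjective _ x
    obtain ⟨m, rfl⟩ := hg m
    exact ⟨(LinearMap.range i₂).mkQ m, rfl⟩

theorem kerLengthAt_congr (e : M ≃ₗ[R] N) : kerLengthAt y a M = kerLengthAt y a N := by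
  refine lengthAt_congr y (e.ofSubmodules _ _ ?_)
  ext x
  simp only [Submodule.mem_map, LinearMap.mem_ker, LinearMap.lsmul_apply]
  constructor
  · rintro ⟨z, hz, rfl⟩
    change a • e z = 0
    rw [← map_smul, hz, map_zero]
  · intro h
    exact ⟨e.symm x, by rw [← map_smul, h, map_zero], e.apply_symm_apply x⟩

theorem cokerLengthAt_congr (e : M ≃ₗ[R] N) : cokerLengthAt y a M = cokerLengthAt y a N := by
  refine lengthAt_congr y (Submodule.Quotient.equiv _ _ e ?_)
  ext x
  simp only [Submodule.mem_map, LinearMap.mem_range, LinearMap.lsmul_apply]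
  constructor
  · rintro ⟨_, ⟨z, rfl⟩, rfl⟩
    exact ⟨e z, (map_smul e a z).symm⟩
  · rintro ⟨z, rfl⟩
    exact ⟨a • e.symm z, ⟨e.symm z, rfl⟩, by
      change e (a • e.symm z) = _; rw [map_smul, e.apply_symm_apply]⟩

theorem cokerLengthAt_quotient (J : Ideal R) :
    cokerLengthAt y a (R ⧸ J) = lengthAt y (R ⧸ (J ⊔ Ideal.span {a})) := by
  refine lengthAt_congr y ((Submodule.quotEquivOfEq _ _ ?_).trans
    (Submodule.quotientQuotientEquivQuotientSup J (Ideal.span {a})))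
  ext x
  constructor
  · rintro ⟨z, rfl⟩
    obtain ⟨z, rfl⟩ := Ideal.Quotient.mk_surjective z
    exact ⟨a * z, Ideal.mul_mem_right _ _ (Ideal.mem_span_singleton_self a), rfl⟩
  · rintro ⟨z, hz, rfl⟩
    obtain ⟨c, rfl⟩ := Ideal.mem_span_singleton'.mp hz
    exact ⟨Ideal.Quotient.mk J c, by
      change a • Ideal.Quotient.mk J c = Ideal.Quotient.mk J (c * a)
      rw [Algebra.smul_def, mul_comm, map_mul]; rfl⟩

theorem kerLengthAt_quotient_prime {p : Ideal R} [p.IsPrime] (h : a ∉ p) :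
    kerLengthAt y a (R ⧸ p) = 0 := by
  have : Subsingleton (LinearMap.ker (LinearMap.lsmul R (R ⧸ p) a)) := by
    refine ⟨fun x z => ?_⟩
    have key : ∀ x : LinearMap.ker (LinearMap.lsmul R (R ⧸ p) a), x = 0 := by
      rintro ⟨x, hx⟩
      obtain ⟨x, rfl⟩ := Ideal.Quotient.mk_surjective x
      refine Subtype.ext (Ideal.Quotient.eq_zero_iff_mem.mpr ?_)
      have : Ideal.Quotient.mk p (a * x) = 0 := hx
      exact (‹p.IsPrime›.mem_or_mem (Ideal.Quotient.eq_zero_iff_mem.mp this)).resolve_left h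
    rw [key x, key z]
  exact lengthAt_of_subsingleton y

/-- The multiplicity formula `length(M/aM) - length(M[a]) = ∑ᵥ length(Mᵥ) length(R/(v + a))` at a
prime `y` all of whose proper generalizations are minimal. -/
theorem cokerLengthAt_eq_sum [IsNoetherianRing R]
    (hy : ∀ p : PrimeSpectrum R, p.asIdeal ≤ y → p.asIdeal ≠ y → p.asIdeal ∈ minimalPrimes R)
    (V : Finset (PrimeSpectrum R)) (hV : ∀ v ∈ V, v.asIdeal ∈ minimalPrimes R)
    (hV' : ∀ v : PrimeSpectrum R, v.asIdeal ∈ minimalPrimes R → v.asIdeal ≤ y → v ∈ V)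
    (ha : ∀ v : PrimeSpectrum R, v.asIdeal ∈ minimalPrimes R → v.asIdeal ≤ y → a ∉ v.asIdeal)
    (M : Type u) [AddCommGroup M] [Module R M] [hM : Module.Finite R M] :
    kerLengthAt y a M ≠ ⊤ ∧ cokerLengthAt y a M = kerLengthAt y a M +
      ∑ v ∈ V, lengthAt v.asIdeal M * lengthAt y (R ⧸ (v.asIdeal ⊔ Ideal.span {a})) := by
  induction hM using IsNoetherianRing.induction_on_isQuotientEquivQuotientPrime with
  | subsingleton N =>
    have h1 : kerLengthAt y a N = 0 := lengthAt_of_subsingleton y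
    have h2 : cokerLengthAt y a N = 0 := by
      have : Subsingleton (N ⧸ LinearMap.range (LinearMap.lsmul R N a)) :=
        (Submodule.mkQ_surjective _).subsingleton
      exact lengthAt_of_subsingleton y
    rw [h1, h2]
    refine ⟨ENat.zero_ne_top, ?_⟩
    simp [lengthAt_of_subsingleton]
  | quotient N p e =>
    rw [kerLengthAt_congr y a e, cokerLengthAt_congr y a e, cokerLengthAt_quotient]
    simp_rw [fun v : PrimeSpectrum R => lengthAt_congr v.asIdeal e]
    by_cases hpy : p.asIdeal ≤ y
    · by_cases hmin : p.asIdeal ∈ minimalPrimes R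
      · rw [kerLengthAt_quotient_prime y a (ha p hmin hpy), zero_add,
          Finset.sum_eq_single_of_mem p (hV' p hmin hpy), lengthAt_quotient_self, one_mul]
        · exact ⟨ENat.zero_ne_top, rfl⟩
        · intro v hv hvp
          rw [lengthAt_quotient_eq_zero, zero_mul]
          intro hle
          exact hvp (PrimeSpectrum.ext (le_antisymm ((hV v hv).2 ⟨p.2, bot_le⟩ hle) hle))
      · have hp : p.asIdeal = y := by
          by_contra h
          exact hmin (hy p hpy h)
        have hsum : ∑ v ∈ V, lengthAt v.asIdeal (R ⧸ p.asIdeal) *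
            lengthAt y (R ⧸ (v.asIdeal ⊔ Ideal.span {a})) = 0 := by
          refine Finset.sum_eq_zero fun v hv => ?_
          rw [lengthAt_quotient_eq_zero, zero_mul]
          intro hle
          exact hmin (le_antisymm ((hV v hv).2 ⟨p.2, bot_le⟩ hle) hle ▸ hV v hv)
        rw [hsum, add_zero]
        by_cases hay : a ∈ p.asIdeal
        · have hker : kerLengthAt y a (R ⧸ p.asIdeal) = 1 := by
            have : LinearMap.ker (LinearMap.lsmul R (R ⧸ p.asIdeal) a) = ⊤ := by
              refine eq_top_iff.mpr fun x _ => ?_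
              obtain ⟨x, rfl⟩ := Ideal.Quotient.mk_surjective x
              exact Ideal.Quotient.eq_zero_iff_mem.mpr (p.asIdeal.mul_mem_right x hay)
            rw [kerLengthAt, lengthAt_congr y (LinearEquiv.ofTop _ this)]
            subst hp
            exact lengthAt_quotient_self _
          rw [hker, sup_eq_left.mpr ((Ideal.span_singleton_le_iff_mem _).mpr hay)]
          subst hp
          exact ⟨ENat.one_ne_top, lengthAt_quotient_self _⟩
        · rw [kerLengthAt_quotient_prime y a hay]
          refine ⟨ENat.zero_ne_top, lengthAt_quotient_eq_zero y fun h => hay ?_⟩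
          rw [hp]
          exact h (Ideal.mem_sup_right (Ideal.mem_span_singleton_self a))
    · have hker : kerLengthAt y a (R ⧸ p.asIdeal) = 0 := by
        refine le_antisymm ?_ zero_le
        rw [← lengthAt_quotient_eq_zero y hpy]
        exact lengthAt_le_of_injective y (Submodule.subtype _) Subtype.val_injective
      rw [hker, zero_add, lengthAt_quotient_eq_zero y fun h => hpy (le_sup_left.trans h)]
      refine ⟨ENat.zero_ne_top, (Finset.sum_eq_zero fun v hv => ?_).symm⟩
      by_cases hle : p.asIdeal ≤ v.asIdeal
      · have : p.asIdeal = v.asIdeal := le_antisymm hle ((hV v hv).2 ⟨p.2, bot_le⟩ hle)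
        rw [lengthAt_quotient_eq_zero y fun h => hpy ?_, mul_zero]
        rw [this]
        exact le_sup_left.trans h
      · rw [lengthAt_quotient_eq_zero _ hle, zero_mul]
  | exact N M P f g hf hg H hN hP =>
    obtain ⟨hle, key⟩ := kerLengthAt_add_cokerLengthAt y a f g hf hg H
    have hsum : ∑ v ∈ V, lengthAt v.asIdeal M * lengthAt y (R ⧸ (v.asIdeal ⊔ Ideal.span {a})) =
        ∑ v ∈ V, lengthAt v.asIdeal N * lengthAt y (R ⧸ (v.asIdeal ⊔ Ideal.span {a})) +
        ∑ v ∈ V, lengthAt v.asIdeal P * lengthAt y (R ⧸ (v.asIdeal ⊔ Ideal.span {a})) := by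
      rw [← Finset.sum_add_distrib]
      refine Finset.sum_congr rfl fun v _ => ?_
      rw [lengthAt_eq_add_of_exact v.asIdeal f g hf hg H, add_mul]
    have hfin : kerLengthAt y a N + kerLengthAt y a P ≠ ⊤ := WithTop.add_ne_top.mpr ⟨hN.1, hP.1⟩
    refine ⟨ne_top_of_le_ne_top hfin hle, ?_⟩
    rw [hsum]
    rw [hN.2, hP.2] at key
    refine ENat.add_right_injective_of_ne_top hfin (key.trans ?_)
    ring

end Multiplicity

/-! ### Characteristic polynomials and cycles of finite-dimensional modules -/

section Charpoly

open Module.Basis in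
theorem charpoly_eq_charpoly_mul_charpoly {R V : Type*} [CommRing R] [AddCommGroup V] [Module R V]
    [Module.Finite R V] [Module.Free R V] (W : Submodule R V) [Module.Free R W]
    [Module.Finite R W] [Module.Free R (V ⧸ W)] (e : V →ₗ[R] V) (he : W ≤ W.comap e) :
    e.charpoly = (e.restrict he).charpoly * (W.mapQ W e he).charpoly := by
  let m := Module.Free.ChooseBasisIndex R W
  let bW : Module.Basis m R W := Module.Free.chooseBasis R W
  let n := Module.Free.ChooseBasisIndex R (V ⧸ W)
  let bQ : Module.Basis n R (V ⧸ W) := Module.Free.chooseBasis R (V ⧸ W)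
  let b := sumQuot bW bQ
  let A : Matrix m m R := LinearMap.toMatrix bW bW (e.restrict he)
  let B : Matrix m n R := Matrix.of fun i l ↦
    ((sumQuot bW bQ).repr (e ((sumQuot bW bQ) (Sum.inr l)))) (Sum.inl i)
  let D : Matrix n n R := LinearMap.toMatrix bQ bQ (W.mapQ W e he)
  suffices LinearMap.toMatrix b b e = Matrix.fromBlocks A B 0 D by
    rw [← LinearMap.charpoly_toMatrix e b, this, ← LinearMap.charpoly_toMatrix _ bW,
      ← LinearMap.charpoly_toMatrix _ bQ, Matrix.charpoly_fromBlocks_zero₂₁]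
  ext u v
  cases u with
  | inl i =>
    cases v with
    | inl k =>
      simp only [b, sumQuot_inl, Matrix.fromBlocks_apply₁₁, A, LinearMap.toMatrix_apply]
      apply sumQuot_repr_inl_of_mem
    | inr l => simp [b, LinearMap.toMatrix_apply, Matrix.fromBlocks_apply₁₂, B]
  | inr j =>
    cases v with
    | inl k =>
      suffices W.mkQ (e (bW k)) = 0 by simp [LinearMap.toMatrix_apply, b, this]
      rw [← LinearMap.mem_ker, Submodule.ker_mkQ]
      exact he (Submodule.coe_mem (bW k))
    | inr l =>
      simp only [LinearMap.toMatrix_apply, sumQuot_repr_inr,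
        Matrix.fromBlocks_apply₂₂, b, D]
      rw [← sumQuot_inr bW bQ l, W.mapQ_apply]
      simp

variable (F : Type*) [Field F] {T : Type*} [CommRing T] [Algebra F T]

open Classical in
/-- The characteristic polynomial of multiplication by `s` on a `T`-module of finite dimension
over `F`. -/
def actionCharpoly (s : T) (M : Type*) [AddCommGroup M] [Module T M] [Module F M]
    [IsScalarTower F T M] : Polynomial F :=
  if _ : Module.Finite F M then (Algebra.lsmul F F M s).charpoly else 1

variable {M N : Type*} [AddCommGroup M] [Module T M] [Module F M] [IsScalarTower F T M]
  [AddCommGroup N] [Module T N] [Module F N] [IsScalarTower F T N]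

theorem actionCharpoly_eq (s : T) [h : Module.Finite F M] :
    actionCharpoly F s M = (Algebra.lsmul F F M s).charpoly :=
  dif_pos h

variable {F} in
theorem finite_of_linearEquiv (e : M ≃ₗ[T] N) (h : Module.Finite F M) : Module.Finite F N :=
  Module.Finite.equiv (e.restrictScalars F)

theorem actionCharpoly_congr (s : T) (e : M ≃ₗ[T] N) :
    actionCharpoly F s M = actionCharpoly F s N := by
  by_cases h : Module.Finite F M
  · have h' := finite_of_linearEquiv e h
    rw [actionCharpoly_eq, actionCharpoly_eq, ← LinearEquiv.charpoly_conj (e.restrictScalars F)]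
    congr 1
    ext x
    simp [LinearEquiv.conj_apply]
  · have h' : ¬ Module.Finite F N := fun h' => h (finite_of_linearEquiv e.symm h')
    rw [actionCharpoly, actionCharpoly, dif_neg h, dif_neg h']

theorem actionCharpoly_eq_mul [Module.Finite F M] (s : T) (N : Submodule T M) :
    actionCharpoly F s M = actionCharpoly F s N * actionCharpoly F s (M ⧸ N) := by
  have h1 : Module.Finite F (N.restrictScalars F) := inferInstance
  have h2 : Module.Finite F N := h1
  have h3 : Module.Finite F (M ⧸ N) :=
    Module.Finite.of_surjective (N.mkQ.restrictScalars F) N.mkQ_surjective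
  rw [actionCharpoly_eq, actionCharpoly_eq, actionCharpoly_eq]
  have he : N.restrictScalars F ≤ (N.restrictScalars F).comap (Algebra.lsmul F F M s) :=
    fun x hx => N.smul_mem s hx
  rw [charpoly_eq_charpoly_mul_charpoly (N.restrictScalars F) (Algebra.lsmul F F M s) he]
  congr 1

theorem actionCharpoly_of_subsingleton [Subsingleton M] (s : T) : actionCharpoly F s M = 1 := by
  have : Module.Finite F M := inferInstance
  rw [actionCharpoly_eq]
  exact Polynomial.eq_one_of_monic_natDegree_zero (LinearMap.charpoly_monic _) (by
    rw [LinearMap.charpoly_natDegree, Module.finrank_zero_of_subsingleton])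

variable {F} in
theorem lengthAt_quotient_of_isMaximal {n m : PrimeSpectrum T} (hm : m.asIdeal.IsMaximal) :
    (n = m → lengthAt n.asIdeal (T ⧸ m.asIdeal) = 1) ∧
      (n ≠ m → lengthAt n.asIdeal (T ⧸ m.asIdeal) = 0) := by
  refine ⟨?_, fun h => lengthAt_quotient_eq_zero _ fun hle => h ?_⟩
  · rintro rfl; exact lengthAt_quotient_self _
  · exact (PrimeSpectrum.ext (hm.eq_of_le n.2.ne_top hle)).symm

/-- The characteristic polynomial of `s` on a finite-dimensional module is the product of the
characteristic polynomials of `s` on the residue fields, with multiplicities. -/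
theorem exists_actionCharpoly_eq_prod (d : ℕ) :
    ∀ (M : Type u) [AddCommGroup M] [Module T M] [Module F M] [IsScalarTower F T M]
      [Module.Finite F M], Module.finrank F M = d →
    ∃ A : Finset (PrimeSpectrum T), (∀ n ∈ A, n.asIdeal.IsMaximal ∧
        Module.Finite F (T ⧸ n.asIdeal)) ∧
      (∀ n ∉ A, n.asIdeal.IsMaximal → lengthAt n.asIdeal M = 0) ∧
      (∀ n : PrimeSpectrum T, n.asIdeal.IsMaximal → lengthAt n.asIdeal M ≠ ⊤) ∧
      ∀ A', A ⊆ A' → (∀ n ∈ A', n.asIdeal.IsMaximal) → ∀ s : T,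
        actionCharpoly F s M = ∏ n ∈ A', actionCharpoly F s (T ⧸ n.asIdeal) ^
          (lengthAt n.asIdeal M).toNat := by
  classical
  induction d using Nat.strong_induction_on with
  | _ d ih =>
  intro M _ _ _ _ _ hd
  rcases subsingleton_or_nontrivial M with hM | hM
  · refine ⟨∅, by simp, fun n _ _ => lengthAt_of_subsingleton _, fun n _ => ?_, fun A' _ _ s => ?_⟩
    · rw [lengthAt_of_subsingleton]; exact ENat.zero_ne_top
    · rw [actionCharpoly_of_subsingleton, Finset.prod_eq_one]
      intro n _
      rw [lengthAt_of_subsingleton]; simp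
  · have : IsNoetherian T M := isNoetherian_of_tower F inferInstance
    obtain ⟨N, hN, -⟩ := (eq_top_or_exists_le_coatom (⊥ : Submodule T M)).resolve_left bot_ne_top
    have : IsSimpleModule T (M ⧸ N) := isSimpleModule_iff_isCoatom.mpr hN
    obtain ⟨m, hm, ⟨e⟩⟩ := isSimpleModule_iff_quot_maximal.mp this
    have hfN : Module.Finite F N := (inferInstance : Module.Finite F (N.restrictScalars F))
    have hfQ : Module.Finite F (M ⧸ N) :=
      Module.Finite.of_surjective (N.mkQ.restrictScalars F) N.mkQ_surjective
    obtain ⟨A, hA, hA₀, hAt, hAp⟩ := ih (Module.finrank F N) (by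
      rw [← hd]
      exact Submodule.finrank_lt (s := N.restrictScalars F) (fun h => hN.1 (by
        rwa [Submodule.restrictScalars_eq_top_iff] at h))) N rfl
    let m' : PrimeSpectrum T := ⟨m, hm.isPrime⟩
    have hlen : ∀ n : PrimeSpectrum T, lengthAt n.asIdeal M =
        lengthAt n.asIdeal N + lengthAt n.asIdeal (T ⧸ m'.asIdeal) := fun n => by
      rw [← lengthAt_congr n.asIdeal e]
      exact lengthAt_eq_add_of_exact n.asIdeal N.subtype N.mkQ Subtype.val_injective
        N.mkQ_surjective (LinearMap.exact_subtype_mkQ N)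
    have hlm := fun n => lengthAt_quotient_of_isMaximal (n := n) (m := m') hm
    refine ⟨insert m' A, ?_, ?_, ?_, ?_⟩
    · intro n hn
      rcases Finset.mem_insert.mp hn with rfl | hn
      · exact ⟨hm, finite_of_linearEquiv e hfQ⟩
      · exact hA n hn
    · intro n hn hn'
      rw [Finset.mem_insert, not_or] at hn
      rw [hlen, hA₀ n hn.2 hn', (hlm n).2 hn.1, add_zero]
    · intro n hn
      rw [hlen]
      refine WithTop.add_ne_top.mpr ⟨hAt n hn, ?_⟩
      by_cases h : n = m'
      · rw [(hlm n).1 h]; exact ENat.one_ne_top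
      · rw [(hlm n).2 h]; exact ENat.zero_ne_top
    · intro A' hAA' hA' s
      have hmA' : m' ∈ A' := hAA' (Finset.mem_insert_self _ _)
      rw [actionCharpoly_eq_mul F s N, hAp A' ((Finset.subset_insert _ _).trans hAA') hA' s,
        actionCharpoly_congr F s e, ← Finset.mul_prod_erase A' _ hmA',
        ← Finset.mul_prod_erase A' (fun n => actionCharpoly F s (T ⧸ n.asIdeal) ^
          (lengthAt n.asIdeal M).toNat) hmA']
      have h1 : (lengthAt m'.asIdeal M).toNat = (lengthAt m'.asIdeal N).toNat + 1 := by
        rw [hlen, (hlm m').1 rfl, ENat.toNat_add (hAt m' hm) ENat.one_ne_top]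
        rfl
      have h2 : ∀ n ∈ A'.erase m', (lengthAt n.asIdeal M).toNat = (lengthAt n.asIdeal N).toNat := by
        intro n hn
        rw [hlen, (hlm n).2 (Finset.ne_of_mem_erase hn), add_zero]
      rw [Finset.prod_congr rfl fun n hn => by rw [← h2 n hn], h1, pow_succ]
      ring

variable {ι : Type*} [Fintype ι] (A B : ι → Ideal T)
  [hA : ∀ i, Module.Finite F (T ⧸ A i)] [hB : ∀ i, Module.Finite F (T ⧸ B i)]

theorem exists_common_support :
    ∃ Q : Finset (PrimeSpectrum T), (∀ n ∈ Q, n.asIdeal.IsMaximal) ∧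
      (∀ n : PrimeSpectrum T, n.asIdeal.IsMaximal → ∀ i, lengthAt n.asIdeal (T ⧸ A i) ≠ ⊤) ∧
      ∀ Q', Q ⊆ Q' → (∀ n ∈ Q', n.asIdeal.IsMaximal) → ∀ s : T,
        ∏ i, actionCharpoly F s (T ⧸ A i) = ∏ n ∈ Q', actionCharpoly F s (T ⧸ n.asIdeal) ^
          (∑ i, lengthAt n.asIdeal (T ⧸ A i)).toNat := by
  classical
  choose Q hQ hQ₀ hQt hQp using fun i => exists_actionCharpoly_eq_prod F (T := T) _ (T ⧸ A i) rfl
  refine ⟨Finset.univ.biUnion Q, ?_, fun n hn i => hQt i n hn, fun Q' hQQ' hQ' s => ?_⟩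
  · intro n hn
    obtain ⟨i, -, hi⟩ := Finset.mem_biUnion.mp hn
    exact (hQ i n hi).1
  · rw [Finset.prod_congr rfl fun i _ => hQp i Q'
      ((Finset.subset_biUnion_of_mem Q (Finset.mem_univ i)).trans hQQ') hQ' s, Finset.prod_comm]
    refine Finset.prod_congr rfl fun n hn => ?_
    rw [Finset.prod_pow_eq_pow_sum, ENat.toNat_sum]
    exact fun i _ => hQt i n (hQ' n hn)

/-- Families of finite-dimensional cyclic modules with the same cycle have the same characteristic
polynomials. -/
theorem prod_actionCharpoly_eq
    (h : ∀ n : PrimeSpectrum T, n.asIdeal.IsMaximal →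
      ∑ i, lengthAt n.asIdeal (T ⧸ A i) = ∑ i, lengthAt n.asIdeal (T ⧸ B i)) (s : T) :
    ∏ i, actionCharpoly F s (T ⧸ A i) = ∏ i, actionCharpoly F s (T ⧸ B i) := by
  classical
  obtain ⟨Q, hQ, -, hQp⟩ := exists_common_support F A
  obtain ⟨Q', hQ', -, hQp'⟩ := exists_common_support F B
  have hQQ : ∀ n ∈ Q ∪ Q', n.asIdeal.IsMaximal := fun n hn =>
    (Finset.mem_union.mp hn).elim (hQ n) (hQ' n)
  rw [hQp _ Finset.subset_union_left hQQ, hQp' _ Finset.subset_union_right hQQ]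
  exact Finset.prod_congr rfl fun n hn => by rw [h n (hQQ n hn)]

theorem actionCharpoly_quotient_ne_zero_eval {n : Ideal T} [n.IsMaximal] {s : T} (hs : s ∉ n) :
    (actionCharpoly F s (T ⧸ n)).eval 0 ≠ 0 := by
  by_cases h : Module.Finite F (T ⧸ n)
  · rw [actionCharpoly_eq, LinearMap.eval_charpoly]
    let := Ideal.Quotient.field n
    have hs' : Ideal.Quotient.mk n s ≠ 0 := fun h => hs (Ideal.Quotient.eq_zero_iff_mem.mp h)
    have hu : IsUnit (Algebra.lsmul F F (T ⧸ n) s) := by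
      rw [Module.End.isUnit_iff]
      constructor
      · intro x y hxy
        have : Ideal.Quotient.mk n s * x = Ideal.Quotient.mk n s * y := by
          simpa [Algebra.smul_def] using hxy
        exact mul_left_cancel₀ hs' this
      · intro x
        exact ⟨(Ideal.Quotient.mk n s)⁻¹ * x, by
          simp [Algebra.smul_def, mul_inv_cancel_left₀ hs']⟩
    have := (LinearMap.isUnit_det _ (hu.neg)).ne_zero
    simpa using this
  · rw [actionCharpoly, dif_neg h]; simp

theorem actionCharpoly_quotient_of_mem {n : Ideal T} {s : T} (hs : s ∈ n)
    [Module.Finite F (T ⧸ n)] :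
    actionCharpoly F s (T ⧸ n) = Polynomial.X ^ Module.finrank F (T ⧸ n) := by
  rw [actionCharpoly_eq]
  have : Algebra.lsmul F F (T ⧸ n) s = 0 := by
    refine LinearMap.ext fun x => ?_
    obtain ⟨x, rfl⟩ := Ideal.Quotient.mk_surjective x
    change Ideal.Quotient.mk n (s * x) = 0
    exact Ideal.Quotient.eq_zero_iff_mem.mpr (n.mul_mem_right x hs)
  rw [this, LinearMap.charpoly_zero]

theorem exists_mem_of_isMaximal (y : Ideal T) [hy : y.IsMaximal] (Q : Finset (PrimeSpectrum T))
    (hyQ : ∀ n ∈ Q, n.asIdeal ≠ y) :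
    ∃ s ∈ y, ∀ n ∈ Q, s ∉ n.asIdeal := by
  by_contra! h
  have : (y : Set T) ⊆ ⋃ n ∈ (Q : Set (PrimeSpectrum T)), n.asIdeal := by
    intro s hs
    obtain ⟨n, hn, hsn⟩ := h s hs
    simp only [Set.mem_iUnion]
    exact ⟨n, hn, hsn⟩
  obtain ⟨n, hn, hle⟩ := (Ideal.subset_union_prime (s := Q) (f := fun n => n.asIdeal)
    ⟨y, hy.isPrime⟩ ⟨y, hy.isPrime⟩ (fun n _ _ _ => n.2)).mp (by simpa using this)
  exact hyQ n hn (hy.eq_of_le n.2.ne_top hle).symm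

/-- The cycle of a family of finite-dimensional cyclic modules is determined by characteristic
polynomials. -/
theorem sum_lengthAt_eq_of_actionCharpoly
    (h : ∀ s : T, ∏ i, actionCharpoly F s (T ⧸ A i) = ∏ i, actionCharpoly F s (T ⧸ B i))
    (y : PrimeSpectrum T) (hy : y.asIdeal.IsMaximal) [Module.Finite F (T ⧸ y.asIdeal)] :
    ∑ i, lengthAt y.asIdeal (T ⧸ A i) = ∑ i, lengthAt y.asIdeal (T ⧸ B i) := by
  classical
  have key : ∀ (C : ι → Ideal T) [∀ i, Module.Finite F (T ⧸ C i)], ∃ Q : Finset (PrimeSpectrum T),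
      y ∉ Q ∧ ∀ s ∈ y.asIdeal, (∀ n ∈ Q, s ∉ n.asIdeal) →
      (∑ i, lengthAt y.asIdeal (T ⧸ C i) ≠ ⊤) ∧
      (∏ i, actionCharpoly F s (T ⧸ C i)).natTrailingDegree =
        Module.finrank F (T ⧸ y.asIdeal) * (∑ i, lengthAt y.asIdeal (T ⧸ C i)).toNat := by
    intro C hC
    obtain ⟨Q, hQ, hQt, hQp⟩ := exists_common_support F C
    refine ⟨Q.erase y, Finset.notMem_erase y Q, fun s hs hsQ => ⟨?_, ?_⟩⟩
    · exact WithTop.sum_ne_top.mpr fun i _ => hQt y hy i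
    rw [hQp (insert y Q) (Finset.subset_insert _ _) (fun n hn => by
        rcases Finset.mem_insert.mp hn with rfl | hn
        exacts [hy, hQ n hn]) s, ← Finset.mul_prod_erase _ _ (Finset.mem_insert_self y Q),
      Finset.erase_insert_eq_erase, actionCharpoly_quotient_of_mem F hs, ← pow_mul]
    set G := ∏ n ∈ Q.erase y, actionCharpoly F s (T ⧸ n.asIdeal) ^
      (∑ i, lengthAt n.asIdeal (T ⧸ C i)).toNat with hG
    have hG0 : G.coeff 0 ≠ 0 := by
      rw [Polynomial.coeff_zero_eq_eval_zero, hG, Polynomial.eval_prod, Finset.prod_ne_zero_iff]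
      intro n hn
      rw [Polynomial.eval_pow]
      have := hQ n (Finset.mem_of_mem_erase hn)
      exact pow_ne_zero _ (actionCharpoly_quotient_ne_zero_eval F (hsQ n hn))
    have hGne : G ≠ 0 := by
      rintro h
      rw [h] at hG0
      simp at hG0
    rw [mul_comm, Polynomial.natTrailingDegree_mul_X_pow hGne,
      Polynomial.natTrailingDegree_eq_zero.mpr (Or.inr hG0), zero_add]
  obtain ⟨Q, hyQ, hQ⟩ := key A
  obtain ⟨Q', hyQ', hQ'⟩ := key B
  obtain ⟨s, hs, hsQ⟩ := exists_mem_of_isMaximal y.asIdeal (Q ∪ Q') (fun n hn h => by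
    rw [PrimeSpectrum.ext h, Finset.mem_union] at hn
    exact hn.elim hyQ hyQ')
  obtain ⟨htA, hA⟩ := hQ s hs fun n hn => hsQ n (Finset.mem_union_left _ hn)
  obtain ⟨htB, hB⟩ := hQ' s hs fun n hn => hsQ n (Finset.mem_union_right _ hn)
  rw [h s, hB] at hA
  have hpos : 0 < Module.finrank F (T ⧸ y.asIdeal) := Module.finrank_pos
  rw [← ENat.natCast_toNat htA, ← ENat.natCast_toNat htB, Nat.eq_of_mul_eq_mul_left hpos hA]

end Charpoly

/-! ### Specialization of subrings of a function field -/

section Specialization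

variable {F F' : Type*} (L : Type*) [Field F] [Field F'] [Field L] [Algebra F F'] [Algebra F' L]
  {B : Subalgebra F F'} (β : B →ₐ[F] F) (O : Type*) [CommRing O] [Algebra O L]

variable (B) in
/-- The subring `B[O]` of `L` generated by `B` and the image of `O`. -/
def famSpan : Submodule O L :=
  Submodule.span O (Set.range fun b : B => algebraMap F' L b)

/-- The ideal of `B[O]` generated by the kernel of `β : B → F`. -/
def specSpan : Submodule O L :=
  Submodule.span O ((fun b : B => algebraMap F' L b) '' {b | β b = 0})

/-- The ideal of the special fibre, in `O`, of the family `B[O]` over `B`, at the point `β`. -/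
def specIdeal : Ideal O :=
  (specSpan L β O).comap (Algebra.linearMap O L)

/-- `x ∈ O` has the same image as `a ∈ B[O]` in the special fibre. -/
def IsLift (a : L) (x : O) : Prop :=
  a - algebraMap O L x ∈ specSpan L β O

variable {L O}

theorem mem_specIdeal {x : O} : x ∈ specIdeal L β O ↔ algebraMap O L x ∈ specSpan L β O :=
  Iff.rfl

variable (O) in
theorem algebraMap_mem_famSpan (b : B) : algebraMap F' L b ∈ famSpan L B O :=
  Submodule.subset_span ⟨b, rfl⟩

theorem algebraMap_mem_specSpan {b : B} (hb : β b = 0) :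
    algebraMap F' L b ∈ specSpan L β O :=
  Submodule.subset_span ⟨b, hb, rfl⟩

variable (O) in
theorem one_mem_famSpan : (1 : L) ∈ famSpan L B O := by
  simpa using algebraMap_mem_famSpan (L := L) O (1 : B)

variable (B L) in
theorem coe_mem_famSpan (x : O) : algebraMap O L x ∈ famSpan L B O := by
  rw [Algebra.algebraMap_eq_smul_one]
  exact Submodule.smul_mem _ _ (one_mem_famSpan O)

theorem specSpan_le_famSpan : specSpan L β O ≤ famSpan L B O :=
  Submodule.span_mono (by rintro _ ⟨b, -, rfl⟩; exact ⟨b, rfl⟩)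

theorem mul_mem_famSpan {x y : L} (hx : x ∈ famSpan L B O) (hy : y ∈ famSpan L B O) :
    x * y ∈ famSpan L B O := by
  induction hx using Submodule.span_induction with
  | mem x hx =>
    obtain ⟨b, rfl⟩ := hx
    induction hy using Submodule.span_induction with
    | mem y hy =>
      obtain ⟨c, rfl⟩ := hy
      exact Submodule.subset_span ⟨b * c, by simp⟩
    | zero => simp
    | add y z _ _ h1 h2 => rw [mul_add]; exact add_mem h1 h2
    | smul r y _ h => rw [mul_smul_comm]; exact Submodule.smul_mem _ _ h
  | zero => simp
  | add y z _ _ h1 h2 => rw [add_mul]; exact add_mem h1 h2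
  | smul r y _ h => rw [smul_mul_assoc]; exact Submodule.smul_mem _ _ h

theorem mul_mem_specSpan {x y : L} (hx : x ∈ famSpan L B O) (hy : y ∈ specSpan L β O) :
    x * y ∈ specSpan L β O := by
  induction hx using Submodule.span_induction with
  | mem x hx =>
    obtain ⟨b, rfl⟩ := hx
    induction hy using Submodule.span_induction with
    | mem y hy =>
      obtain ⟨c, hc, rfl⟩ := hy
      exact Submodule.subset_span ⟨b * c, by
        change β (b * c) = 0
        rw [map_mul, show β c = 0 from hc, mul_zero], by simp⟩
    | zero => simp
    | add y z _ _ h1 h2 => rw [mul_add]; exact add_mem h1 h2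
    | smul r y _ h => rw [mul_smul_comm]; exact Submodule.smul_mem _ _ h
  | zero => simp
  | add y z _ _ h1 h2 => rw [add_mul]; exact add_mem h1 h2
  | smul r y _ h => rw [smul_mul_assoc]; exact Submodule.smul_mem _ _ h

theorem exists_isLift [Algebra F L] [IsScalarTower F F' L] [Algebra F O] [IsScalarTower F O L]
    {a : L} (ha : a ∈ famSpan L B O) : ∃ x : O, IsLift L β O a x := by
  induction ha using Submodule.span_induction with
  | mem x hx =>
    obtain ⟨b, rfl⟩ := hx
    refine ⟨algebraMap F O (β b), ?_⟩
    have h : algebraMap F' L (b : F') - algebraMap O L (algebraMap F O (β b)) =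
        algebraMap F' L ((b - algebraMap F B (β b) : B) : F') := by
      rw [← IsScalarTower.algebraMap_apply F O L, IsScalarTower.algebraMap_apply F F' L]
      simp
    rw [IsLift, h]
    refine algebraMap_mem_specSpan β ?_
    rw [map_sub, AlgHom.commutes]
    simp
  | zero => exact ⟨0, by simp [IsLift]⟩
  | add y z _ _ h1 h2 =>
    obtain ⟨u, hu⟩ := h1
    obtain ⟨v, hv⟩ := h2
    refine ⟨u + v, ?_⟩
    rw [IsLift, map_add, add_sub_add_comm]
    exact add_mem hu hv
  | smul r y _ h =>
    obtain ⟨u, hu⟩ := h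
    refine ⟨r * u, ?_⟩
    rw [IsLift, map_mul, Algebra.smul_def, ← mul_sub, ← Algebra.smul_def]
    exact Submodule.smul_mem _ _ hu

variable {β}

theorem IsLift.sub_mem_specIdeal {a : L} {x y : O} (hx : IsLift L β O a x) (hy : IsLift L β O a y) :
    x - y ∈ specIdeal L β O := by
  rw [mem_specIdeal, map_sub]
  have := sub_mem hy hx
  rwa [sub_sub_sub_cancel_left] at this

theorem IsLift.mem_famSpan {a : L} {x : O} (hx : IsLift L β O a x) : a ∈ famSpan L B O := by
  have := add_mem (specSpan_le_famSpan β hx) (coe_mem_famSpan L B x)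
  rwa [sub_add_cancel] at this

theorem IsLift.mul {a b : L} {x y : O} (hx : IsLift L β O a x) (hy : IsLift L β O b y) :
    IsLift L β O (a * b) (x * y) := by
  have h : a * b - algebraMap O L (x * y) =
      a * (b - algebraMap O L y) + algebraMap O L y * (a - algebraMap O L x) := by
    rw [map_mul]; ring
  rw [IsLift, h]
  exact add_mem (mul_mem_specSpan β hx.mem_famSpan hy)
    (mul_mem_specSpan β (coe_mem_famSpan L B y) hx)

variable (β)

/-! #### Localization -/

section Localization

variable (L) (S : Type*) [CommRing S] [Algebra S L] [Algebra S O] [IsScalarTower S O L]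

theorem specSpan_mono {a : L} (h : a ∈ specSpan L β S) : a ∈ specSpan L β O :=
  Submodule.span_le_restrictScalars S O _ h

variable {L β S} in
theorem IsLift.map {a : L} {x : S} (h : IsLift L β S a x) :
    IsLift L β O a (algebraMap S O x) := by
  rw [IsLift, ← IsScalarTower.algebraMap_apply]
  exact specSpan_mono L β S h

theorem exists_smul_mem_specSpan (W : Submonoid S) [IsLocalization W O] {a : L}
    (h : a ∈ specSpan L β O) : ∃ s ∈ W, s • a ∈ specSpan L β S := by
  induction h using Submodule.span_induction with
  | mem x hx =>
    exact ⟨1, W.one_mem, by rw [one_smul]; exact Submodule.subset_span hx⟩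
  | zero => exact ⟨1, W.one_mem, by simp⟩
  | add y z _ _ h1 h2 =>
    obtain ⟨s, hs, h1⟩ := h1
    obtain ⟨t, ht, h2⟩ := h2
    refine ⟨s * t, W.mul_mem hs ht, ?_⟩
    rw [smul_add]
    refine add_mem ?_ ?_
    · rw [mul_comm, mul_smul]; exact Submodule.smul_mem _ _ h1
    · rw [mul_smul]; exact Submodule.smul_mem _ _ h2
  | smul r y _ h =>
    obtain ⟨s, hs, h⟩ := h
    obtain ⟨⟨u, t⟩, hut⟩ := IsLocalization.surj W r
    refine ⟨t * s, W.mul_mem t.2 hs, ?_⟩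
    have : (t * s : S) • r • y = u • s • y := by
      rw [mul_comm, mul_smul, ← algebraMap_smul O (t : S), ← mul_smul, mul_comm _ r, hut,
        algebraMap_smul, smul_comm]
    rw [this]
    exact Submodule.smul_mem _ _ h

theorem specIdeal_eq_map (W : Submonoid S) [IsLocalization W O] :
    specIdeal L β O = (specIdeal L β S).map (algebraMap S O) := by
  refine le_antisymm (fun x hx => ?_) (Ideal.map_le_iff_le_comap.mpr fun x hx => ?_)
  · obtain ⟨⟨u, t⟩, hut⟩ := IsLocalization.surj W x
    have h1 : algebraMap S O u ∈ specIdeal L β O := by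
      rw [← hut]; exact Ideal.mul_mem_right _ _ hx
    rw [mem_specIdeal, ← IsScalarTower.algebraMap_apply] at h1
    obtain ⟨s, hs, h2⟩ := exists_smul_mem_specSpan L β S W h1
    rw [Algebra.smul_def, ← map_mul] at h2
    have h3 : algebraMap S O (s * u) ∈ (specIdeal L β S).map (algebraMap S O) :=
      Ideal.mem_map_of_mem _ h2
    rw [map_mul, ← hut, mul_comm x, ← mul_assoc, ← map_mul] at h3
    have hu : IsUnit (algebraMap S O (s * t)) :=
      IsLocalization.map_units O (⟨s * t, W.mul_mem hs t.2⟩ : W)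
    exact (Ideal.unit_mul_mem_iff_mem _ hu).mp h3
  · rw [Ideal.mem_comap, mem_specIdeal, ← IsScalarTower.algebraMap_apply]
    exact specSpan_mono L β S hx

end Localization

/-! #### Bases of the fibres -/

section Basis

set_option linter.unusedSectionVars false

variable (L B) [Algebra F L] [IsScalarTower F F' L] (S : Type*) [CommRing S] [Algebra F S]
  [Algebra S L] [IsScalarTower F S L]
  (R : Type*) [CommRing R] [Algebra F' R] [Algebra S R] [Algebra R L] [IsScalarTower F' R L]
  [IsScalarTower S R L] {κ : Type*} [Fintype κ]

/-- The elements `n` of `S` form a basis of `R/aR` over `F'`, and generate `B[S]/aB[S]` over `B`. -/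
structure IsSpecializationBasis (a : R) (n : κ → S) : Prop where
  mem : algebraMap R L a ∈ famSpan L B S
  ne_zero : algebraMap R L a ≠ 0
  linearIndependent : LinearIndependent F'
    fun l => Ideal.Quotient.mk (Ideal.span {a}) (algebraMap S R (n l))
  span_eq_top : Submodule.span F' (Set.range
    fun l => Ideal.Quotient.mk (Ideal.span {a}) (algebraMap S R (n l))) = ⊤
  exists_eq : ∀ x : S, ∃ (b : κ → B) (d : L), d ∈ famSpan L B S ∧
    algebraMap S L x = ∑ l, algebraMap F' L (b l) * algebraMap S L (n l) + algebraMap R L a * d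

variable {L B S R} {a : R} {n : κ → S}

namespace IsSpecializationBasis

variable (h : IsSpecializationBasis L B S R a n)
include h

theorem exists_eq_of_mem {d : L} (hd : d ∈ famSpan L B S) : ∃ (b : κ → B) (d' : L),
    d' ∈ famSpan L B S ∧
    d = ∑ l, algebraMap F' L (b l) * algebraMap S L (n l) + algebraMap R L a * d' := by
  have hsp : famSpan L B S ≤ (Submodule.span S (Set.range fun b : B => algebraMap F' L b)) := le_rfl
  obtain ⟨c, rfl⟩ := (Finsupp.mem_span_range_iff_exists_finsupp).mp (hsp hd)
  choose b d hd hbd using h.exists_eq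
  refine ⟨fun l => c.sum fun b' s => b' * b s l, c.sum fun b' s => algebraMap F' L b' * d s,
    sum_mem fun b' _ => mul_mem_famSpan (algebraMap_mem_famSpan S b') (hd _), ?_⟩
  simp only [Finsupp.sum]
  have : ∀ b' ∈ c.support, c b' • algebraMap F' L (b' : F') =
      ∑ l, algebraMap F' L (b' * b (c b') l : B) * algebraMap S L (n l) +
        algebraMap R L a * (algebraMap F' L b' * d (c b')) := by
    intro b' _
    rw [Algebra.smul_def, hbd (c b'), add_mul, Finset.sum_mul]
    congr 1
    · refine Finset.sum_congr rfl fun l _ => ?_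
      rw [Subalgebra.coe_mul, map_mul]; ring
    · ring
  rw [Finset.sum_congr rfl this, Finset.sum_add_distrib, Finset.sum_comm, Finset.mul_sum]
  congr 1
  refine Finset.sum_congr rfl fun l _ => ?_
  rw [← Finset.sum_mul]
  congr 1
  push_cast
  rfl

theorem exists_eq_of_mem_specSpan {d : L} (hd : d ∈ specSpan L β S) : ∃ (b : κ → B) (d' : L),
    (∀ l, β (b l) = 0) ∧ d' ∈ specSpan L β S ∧
    d = ∑ l, algebraMap F' L (b l) * algebraMap S L (n l) + algebraMap R L a * d' := by
  induction hd using Submodule.span_induction with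
  | mem x hx =>
    obtain ⟨e, he, rfl⟩ := hx
    obtain ⟨b, d, hd, hbd⟩ := h.exists_eq_of_mem (one_mem_famSpan S)
    refine ⟨fun l => e * b l, algebraMap F' L e * d, fun l => ?_, ?_, ?_⟩
    · rw [map_mul, show β e = 0 from he, zero_mul]
    · rw [mul_comm]; exact mul_mem_specSpan β hd (algebraMap_mem_specSpan β he)
    · dsimp only
      conv_lhs => rw [← mul_one (algebraMap F' L (e : F')), hbd, mul_add, Finset.mul_sum]
      congr 1
      · exact Finset.sum_congr rfl fun l _ => by rw [Subalgebra.coe_mul, map_mul]; ring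
      · ring
  | zero => exact ⟨0, 0, by simp, zero_mem _, by simp⟩
  | add x y _ _ h1 h2 =>
    obtain ⟨b, d, hb, hd, rfl⟩ := h1
    obtain ⟨b', d', hb', hd', rfl⟩ := h2
    refine ⟨b + b', d + d', fun l => by simp [hb, hb'], add_mem hd hd', ?_⟩
    simp only [Pi.add_apply, Subalgebra.coe_add, map_add, add_mul, Finset.sum_add_distrib]
    ring
  | smul r x _ hx =>
    obtain ⟨b, d, hb, hd, rfl⟩ := hx
    choose c e he hce using fun l => h.exists_eq (r * n l)
    refine ⟨fun q => ∑ l, b l * c l q, ∑ l, algebraMap F' L (b l) * e l + r • d, fun q => ?_, ?_, ?_⟩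
    · rw [map_sum]
      exact Finset.sum_eq_zero fun l _ => by rw [map_mul, hb, zero_mul]
    · refine add_mem (sum_mem fun l _ => ?_) (Submodule.smul_mem _ _ hd)
      rw [mul_comm]; exact mul_mem_specSpan β (he l) (algebraMap_mem_specSpan β (hb l))
    · rw [smul_add, Finset.smul_sum]
      have h1 : ∀ l ∈ Finset.univ, r • (algebraMap F' L (b l) * algebraMap S L (n l)) =
          ∑ q, algebraMap F' L ((b l * c l q : B) : F') * algebraMap S L (n q) +
            algebraMap R L a * (algebraMap F' L (b l) * e l) := by
        intro l _
        rw [Algebra.smul_def, mul_left_comm, ← map_mul, hce l, mul_add, Finset.mul_sum]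
        congr 1
        · exact Finset.sum_congr rfl fun q _ => by rw [Subalgebra.coe_mul, map_mul]; ring
        · ring
      rw [Finset.sum_congr rfl h1, Finset.sum_add_distrib, Finset.sum_comm, mul_add, add_assoc]
      congr 1
      · refine Finset.sum_congr rfl fun q _ => ?_
        rw [← Finset.sum_mul]
        congr 1
        push_cast
        rfl
      · rw [Finset.mul_sum, Algebra.smul_def, Algebra.smul_def]
        ring

omit h in
theorem exists_algebraMap_eq {d : L} (hd : d ∈ famSpan L B S) : ∃ r : R, algebraMap R L r = d := by
  induction hd using Submodule.span_induction with
  | mem x hx =>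
    obtain ⟨b, rfl⟩ := hx
    exact ⟨algebraMap F' R b, (IsScalarTower.algebraMap_apply F' R L _).symm⟩
  | zero => exact ⟨0, map_zero _⟩
  | add x y _ _ h1 h2 =>
    obtain ⟨r, rfl⟩ := h1
    obtain ⟨s, rfl⟩ := h2
    exact ⟨r + s, map_add _ _ _⟩
  | smul s x _ h1 =>
    obtain ⟨r, rfl⟩ := h1
    exact ⟨algebraMap S R s * r, by
      rw [map_mul, ← IsScalarTower.algebraMap_apply, Algebra.smul_def]⟩

omit h in
theorem mk_eq_sum {t : S} (ht : IsLift L β S (algebraMap R L a) t) {x : S} {b : κ → B} {d : L}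
    (hd : d ∈ famSpan L B S) (hbd : algebraMap S L x =
      ∑ l, algebraMap F' L (b l) * algebraMap S L (n l) + algebraMap R L a * d) :
    Ideal.Quotient.mk (specIdeal L β S ⊔ Ideal.span {t}) x =
      ∑ l, β (b l) • Ideal.Quotient.mk _ (n l) := by
  obtain ⟨s, hs⟩ := exists_isLift β hd
  have hx : x - ∑ l, algebraMap F S (β (b l)) * n l - t * s ∈ specIdeal L β S := by
    have h1 : ∀ l, algebraMap F' L (b l) - algebraMap F L (β (b l)) ∈ specSpan L β S := fun l => by
      have := algebraMap_mem_specSpan (L := L) (O := S) β (b := b l - algebraMap F B (β (b l)))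
        (by rw [map_sub, AlgHom.commutes]; simp)
      rw [IsScalarTower.algebraMap_apply F F' L]
      rw [Subalgebra.coe_sub, map_sub] at this
      exact this
    have h2 := add_mem (sum_mem fun l (_ : l ∈ Finset.univ) =>
      mul_mem_specSpan β (coe_mem_famSpan L B (n l)) (h1 l)) (ht.mul hs)
    rw [mem_specIdeal, map_sub, map_sub, hbd, map_sum]
    convert h2 using 1
    simp only [mul_sub, map_mul, Finset.sum_sub_distrib, ← IsScalarTower.algebraMap_apply]
    simp only [mul_comm (algebraMap S L (n _))]
    ring
  have h4 : x - ∑ l, algebraMap F S (β (b l)) * n l ∈ specIdeal L β S ⊔ Ideal.span {t} := by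
    rw [← sub_add_cancel (x - _) (t * s)]
    exact add_mem (Ideal.mem_sup_left hx) (Ideal.mem_sup_right
      (Ideal.mul_mem_right _ _ (Ideal.mem_span_singleton_self t)))
  rw [Ideal.Quotient.eq.mpr h4, map_sum]
  refine Finset.sum_congr rfl fun l _ => ?_
  rw [Algebra.smul_def, map_mul]
  rfl

variable (hinj : Function.Injective (algebraMap R L))
include hinj

theorem eq_zero_of_sum_eq {c : κ → F'} {d : L} (hd : d ∈ famSpan L B S)
    (hc : ∑ l, algebraMap F' L (c l) * algebraMap S L (n l) = algebraMap R L a * d) (l : κ) :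
    c l = 0 := by
  obtain ⟨r, rfl⟩ := exists_algebraMap_eq (R := R) hd
  have h1 : ∑ l, algebraMap F' R (c l) * algebraMap S R (n l) = a * r := by
    apply hinj
    rw [map_mul, ← hc, map_sum]
    exact Finset.sum_congr rfl fun l _ => by
      rw [map_mul, ← IsScalarTower.algebraMap_apply, ← IsScalarTower.algebraMap_apply]
  refine Fintype.linearIndependent_iff.mp h.linearIndependent c ?_ l
  have h2 : Ideal.Quotient.mk (Ideal.span {a}) (a * r) = 0 :=
    Ideal.Quotient.eq_zero_iff_mem.mpr (Ideal.mul_mem_right _ _ (Ideal.mem_span_singleton_self a))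
  rw [← h2, ← h1, map_sum]
  refine Finset.sum_congr rfl fun l _ => ?_
  rw [Algebra.smul_def, map_mul]
  rfl

/-- A lift of `a` is a nonzerodivisor on the special fibre. -/
theorem mem_specIdeal_of_mul_mem {x t : S} (ht : IsLift L β S (algebraMap R L a) t)
    (hx : t * x ∈ specIdeal L β S) : x ∈ specIdeal L β S := by
  rw [mem_specIdeal] at hx ⊢
  have h1 : algebraMap R L a * algebraMap S L x ∈ specSpan L β S := by
    have := add_mem (mul_mem_specSpan β (coe_mem_famSpan L B x) ht) hx
    rw [map_mul] at this
    convert this using 1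
    ring
  obtain ⟨b, d, -, hd, hbd⟩ := h.exists_eq_of_mem_specSpan β h1
  have h2 := h.eq_zero_of_sum_eq hinj (c := fun l => b l)
    (sub_mem (coe_mem_famSpan L B x) (specSpan_le_famSpan β hd))
    (by rw [mul_sub, hbd]; ring)
  simp only [h2, map_zero, zero_mul, Finset.sum_const_zero, zero_add] at hbd
  rwa [mul_left_cancel₀ h.ne_zero hbd]

/-- The elements `n` form a basis of the special fibre of `B[S]/aB[S]`. -/
def basis {t : S} (ht : IsLift L β S (algebraMap R L a) t) :
    Module.Basis κ F (S ⧸ (specIdeal L β S ⊔ Ideal.span {t})) :=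
  Module.Basis.mk (v := fun l => Ideal.Quotient.mk _ (n l)) (by
    rw [Fintype.linearIndependent_iff]
    intro c hc
    have h1 : ∑ l, algebraMap F S (c l) * n l ∈ specIdeal L β S ⊔ Ideal.span {t} := by
      rw [← Ideal.Quotient.eq_zero_iff_mem, ← hc, map_sum]
      refine Finset.sum_congr rfl fun l _ => ?_
      rw [Algebra.smul_def, map_mul]
      rfl
    obtain ⟨i, hi, j, hj, hij⟩ := Submodule.mem_sup.mp h1
    obtain ⟨s, rfl⟩ := Ideal.mem_span_singleton'.mp hj
    rw [mem_specIdeal] at hi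
    have hm := sub_mem hi (mul_mem_specSpan β (coe_mem_famSpan L B s) ht)
    obtain ⟨b, d, hb, hd, hbd⟩ := h.exists_eq_of_mem_specSpan β hm
    have h2 := h.eq_zero_of_sum_eq hinj (c := fun l => algebraMap F F' (c l) - b l)
      (add_mem (coe_mem_famSpan L B s) (specSpan_le_famSpan β hd)) (by
        have h3 : ∑ l, algebraMap F' L (algebraMap F F' (c l)) * algebraMap S L (n l) =
            algebraMap S L i + algebraMap S L s * algebraMap S L t := by
          rw [← map_mul, ← map_add, hij, map_sum]
          exact Finset.sum_congr rfl fun l _ => by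
            rw [map_mul, ← IsScalarTower.algebraMap_apply, ← IsScalarTower.algebraMap_apply]
        simp only [map_sub, sub_mul, Finset.sum_sub_distrib]
        rw [h3]
        linear_combination hbd)
    intro l
    have h4 : algebraMap F B (c l) = b l := Subtype.ext (sub_eq_zero.mp (h2 l))
    have h5 := hb l
    rw [← h4, AlgHom.commutes] at h5
    exact h5) (by
    rintro x -
    obtain ⟨x, rfl⟩ := Ideal.Quotient.mk_surjective x
    obtain ⟨b, d, hd, hbd⟩ := h.exists_eq x
    rw [mk_eq_sum β ht hd hbd]
    exact sum_mem fun l _ => Submodule.smul_mem _ _ (Submodule.subset_span ⟨l, rfl⟩))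

theorem basis_apply {t : S} (ht : IsLift L β S (algebraMap R L a) t) (l : κ) :
    h.basis β hinj ht l = Ideal.Quotient.mk _ (n l) :=
  Module.Basis.mk_apply _ _ _

theorem finite {t : S} (ht : IsLift L β S (algebraMap R L a) t) :
    Module.Finite F (S ⧸ (specIdeal L β S ⊔ Ideal.span {t})) :=
  .of_basis (h.basis β hinj ht)

/-- The characteristic polynomials of `s ∈ S` on the generic and on the special fibre of
`B[S]/aB[S]` come from a common polynomial over `B`. -/
theorem exists_actionCharpoly_eq (s : S) :
    ∃ χ : Polynomial B, actionCharpoly F' (algebraMap S R s) (R ⧸ Ideal.span {a}) =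
        χ.map (algebraMap B F') ∧
      ∀ t : S, IsLift L β S (algebraMap R L a) t →
        actionCharpoly F s (S ⧸ (specIdeal L β S ⊔ Ideal.span {t})) = χ.map (β : B →+* F) := by
  classical
  choose c d hd hcd using fun l => h.exists_eq (s * n l)
  let M : Matrix κ κ B := Matrix.of fun q l => c l q
  have hb : ⊤ ≤ Submodule.span F' (Set.range
    fun l => Ideal.Quotient.mk (Ideal.span {a}) (algebraMap S R (n l))) := h.span_eq_top.ge
  let e : Module.Basis κ F' (R ⧸ Ideal.span {a}) := Module.Basis.mk h.linearIndependent hb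
  have he : Module.Finite F' (R ⧸ Ideal.span {a}) := .of_basis e
  refine ⟨M.charpoly, ?_, fun t ht => ?_⟩
  · rw [actionCharpoly_eq, ← LinearMap.charpoly_toMatrix _ e, ← Matrix.charpoly_map]
    congr 1
    ext q l
    rw [LinearMap.toMatrix_apply, Matrix.map_apply]
    have h1 : Algebra.lsmul F' F' (R ⧸ Ideal.span {a}) (algebraMap S R s) (e l) =
        ∑ q, (c l q : F') • e q := by
      simp only [e, Module.Basis.mk_apply]
      obtain ⟨r, hr⟩ := exists_algebraMap_eq (R := R) (hd l)
      have h2 : algebraMap S R s * algebraMap S R (n l) =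
          ∑ q, algebraMap F' R (c l q) * algebraMap S R (n q) + a * r := by
        apply hinj
        rw [map_add, map_sum, ← map_mul, ← IsScalarTower.algebraMap_apply, hcd, map_mul, hr]
        congr 1
        exact Finset.sum_congr rfl fun l _ => by
          rw [map_mul, ← IsScalarTower.algebraMap_apply, ← IsScalarTower.algebraMap_apply]
      change Ideal.Quotient.mk _ (algebraMap S R s * algebraMap S R (n l)) = _
      rw [h2, map_add, map_sum, Ideal.Quotient.eq_zero_iff_mem.mpr
        (Ideal.mul_mem_right _ _ (Ideal.mem_span_singleton_self a)), add_zero]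
      refine Finset.sum_congr rfl fun q _ => ?_
      rw [Algebra.smul_def, map_mul]
      rfl
    rw [h1, map_sum, Finsupp.finsetSum_apply]
    simp [Finsupp.single_apply, M]
  · have hf := h.finite β hinj ht
    rw [actionCharpoly_eq, ← LinearMap.charpoly_toMatrix _ (h.basis β hinj ht),
      ← Matrix.charpoly_map]
    congr 1
    ext q l
    rw [LinearMap.toMatrix_apply, Matrix.map_apply]
    have h1 : Algebra.lsmul F F (S ⧸ (specIdeal L β S ⊔ Ideal.span {t})) s
        (h.basis β hinj ht l) = ∑ q, β (c l q) • h.basis β hinj ht q := by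
      simp only [basis_apply]
      change Ideal.Quotient.mk _ (s * n l) = _
      exact mk_eq_sum β ht (hd l) (hcd l)
    rw [h1, map_sum, Finsupp.finsetSum_apply]
    simp [Finsupp.single_apply, M]

end IsSpecializationBasis

/-! #### Existence of bases -/

variable (L S) in
theorem exists_finset_mem_famSpan
    (hR : Submodule.span F' (Set.range (algebraMap S R)) = ⊤) (r : R) :
    ∃ T : Finset F', ∀ B : Subalgebra F F', (T : Set F') ⊆ B → algebraMap R L r ∈ famSpan L B S := by
  classical
  have hr : r ∈ Submodule.span F' (Set.range (algebraMap S R)) := hR ▸ Submodule.mem_top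
  induction hr using Submodule.span_induction with
  | mem x hx =>
    obtain ⟨s, rfl⟩ := hx
    exact ⟨∅, fun B _ => by
      rw [← IsScalarTower.algebraMap_apply]; exact coe_mem_famSpan L B s⟩
  | zero => exact ⟨∅, fun B _ => by simp⟩
  | add x y _ _ h1 h2 =>
    obtain ⟨T1, h1⟩ := h1
    obtain ⟨T2, h2⟩ := h2
    refine ⟨T1 ∪ T2, fun B hB => ?_⟩
    rw [Finset.coe_union, Set.union_subset_iff] at hB
    rw [map_add]
    exact add_mem (h1 B hB.1) (h2 B hB.2)
  | smul c x _ h1 =>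
    obtain ⟨T1, h1⟩ := h1
    refine ⟨insert c T1, fun B hB => ?_⟩
    rw [Finset.coe_insert, Set.insert_subset_iff] at hB
    rw [Algebra.smul_def, map_mul, ← IsScalarTower.algebraMap_apply]
    exact mul_mem_famSpan (algebraMap_mem_famSpan S ⟨c, hB.1⟩) (h1 B hB.2)

theorem exists_eq_sum_add (hn : Submodule.span F' (Set.range
    fun l => Ideal.Quotient.mk (Ideal.span {a}) (algebraMap S R (n l))) = ⊤) (r : R) :
    ∃ (c : κ → F') (d : R), r = ∑ l, algebraMap F' R (c l) * algebraMap S R (n l) + a * d := by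
  have hr : Ideal.Quotient.mk (Ideal.span {a}) r ∈ Submodule.span F' (Set.range
    fun l => Ideal.Quotient.mk (Ideal.span {a}) (algebraMap S R (n l))) := hn ▸ Submodule.mem_top
  obtain ⟨c, hc⟩ := (Submodule.mem_span_range_iff_exists_fun F').mp hr
  have h1 : Ideal.Quotient.mk (Ideal.span {a}) r = Ideal.Quotient.mk (Ideal.span {a})
      (∑ l, algebraMap F' R (c l) * algebraMap S R (n l)) := by
    rw [← hc, map_sum]
    refine Finset.sum_congr rfl fun l _ => ?_
    rw [Algebra.smul_def, map_mul]
    rfl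
  obtain ⟨d, hd⟩ := Ideal.mem_span_singleton'.mp (Ideal.Quotient.eq.mp h1)
  exact ⟨c, d, by rw [mul_comm a, hd]; ring⟩

variable (L S) in
theorem exists_isSpecializationBasis [Algebra.FiniteType F S]
    (hR : Submodule.span F' (Set.range (algebraMap S R)) = ⊤) (a : R) (ha : algebraMap R L a ≠ 0)
    [Module.Finite F' (R ⧸ Ideal.span {a})] :
    ∃ (m : ℕ) (n : Fin m → S) (T : Finset F'), ∀ B : Subalgebra F F', (T : Set F') ⊆ B →
      IsSpecializationBasis L B S R a n := by
  classical
  let q : S → R ⧸ Ideal.span {a} := fun s => Ideal.Quotient.mk _ (algebraMap S R s)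
  have hq : Submodule.span F' (Set.range q) = ⊤ := by
    have h1 : Set.range q = (Ideal.Quotient.mkₐ F' (Ideal.span {a})).toLinearMap ''
        Set.range (algebraMap S R) := by
      rw [← Set.range_comp]; rfl
    rw [h1, ← Submodule.map_span, hR, Submodule.map_top, LinearMap.range_eq_top]
    exact Ideal.Quotient.mk_surjective
  obtain ⟨b, hb, hbs, hbi⟩ := exists_linearIndependent F' (Set.range q)
  have hbf : Finite b := (hbi.setFinite : b.Finite)
  obtain ⟨m, ⟨e⟩⟩ := Finite.exists_equiv_fin b
  choose n hn using fun l => hb (e.symm l).2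
  have hqn : (fun l => q (n l)) = (fun x : b => (x : R ⧸ Ideal.span {a})) ∘ e.symm := funext hn
  have hli : LinearIndependent F' fun l => q (n l) := by
    rw [hqn]; exact hbi.comp _ e.symm.injective
  have hsp : Submodule.span F' (Set.range fun l => q (n l)) = ⊤ := by
    rw [hqn, Set.range_comp, e.symm.range_eq_univ, Set.image_univ, Subtype.range_coe, hbs, hq]
  obtain ⟨G, hG⟩ := ‹Algebra.FiniteType F S›.out
  choose c d hcd using exists_eq_sum_add hsp
  choose T hT using exists_finset_mem_famSpan (F := F) L S hR
  let T' : R → Finset F' := fun r => T (d r) ∪ Finset.univ.image (c r)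
  refine ⟨m, n, T a ∪ T' 1 ∪ (G ×ˢ Finset.univ).biUnion fun g => T' (algebraMap S R (g.1 * n g.2)),
    fun B hB => ?_⟩
  rw [Finset.coe_union, Finset.coe_union, Set.union_subset_iff, Set.union_subset_iff] at hB
  have hsm : ∀ (e : B) (x : L), e • x = algebraMap F' L e * x := fun e x =>
    Algebra.smul_def (e : F') x
  let N : Submodule B L :=
    { carrier := {x | ∃ (b : Fin m → B) (d : L), d ∈ famSpan L B S ∧
        x = ∑ l, algebraMap F' L (b l) * algebraMap S L (n l) + algebraMap R L a * d}
      zero_mem' := ⟨0, 0, zero_mem _, by simp⟩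
      add_mem' := by
        rintro _ _ ⟨b, d, hd, rfl⟩ ⟨b', d', hd', rfl⟩
        refine ⟨b + b', d + d', add_mem hd hd', ?_⟩
        simp only [Pi.add_apply, Subalgebra.coe_add, map_add, add_mul, Finset.sum_add_distrib]
        ring
      smul_mem' := by
        rintro e _ ⟨b, d, hd, rfl⟩
        refine ⟨fun l => e * b l, algebraMap F' L e * d,
          mul_mem_famSpan (algebraMap_mem_famSpan S e) hd, ?_⟩
        rw [hsm, mul_add, Finset.mul_sum]
        congr 1
        · exact Finset.sum_congr rfl fun l _ => by rw [Subalgebra.coe_mul, map_mul]; ring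
        · ring }
  have hN : ∀ r : R, (T' r : Set F') ⊆ B → algebraMap R L r ∈ N := by
    intro r hr
    simp only [T', Finset.coe_union, Set.union_subset_iff, Finset.coe_image, Finset.coe_univ,
      Set.image_univ, Set.range_subset_iff] at hr
    refine ⟨fun l => ⟨c r l, hr.2 l⟩, algebraMap R L (d r), hT _ B hr.1, ?_⟩
    conv_lhs => rw [hcd r, map_add, map_sum, map_mul]
    congr 1
    exact Finset.sum_congr rfl fun l _ => by
      rw [map_mul, ← IsScalarTower.algebraMap_apply, ← IsScalarTower.algebraMap_apply]
  have h1N : (1 : L) ∈ N := by simpa using hN 1 hB.1.2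
  have hgN : ∀ g ∈ G, ∀ x ∈ N, algebraMap S L g * x ∈ N := by
    rintro g hg _ ⟨b, d, hd, rfl⟩
    rw [mul_add, Finset.mul_sum]
    refine add_mem (sum_mem fun l _ => ?_) ?_
    · have h1 := N.smul_mem (b l) (hN (algebraMap S R (g * n l)) (fun x hx => hB.2 (by
        simp only [Finset.coe_biUnion, Set.mem_iUnion]
        exact ⟨(g, l), by simpa using hg, hx⟩)))
      rw [← IsScalarTower.algebraMap_apply, map_mul] at h1
      rw [mul_left_comm, ← hsm]
      exact h1
    · refine ⟨0, algebraMap S L g * d, mul_mem_famSpan (coe_mem_famSpan L B g) hd, ?_⟩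
      simp only [Pi.zero_apply, ZeroMemClass.coe_zero, map_zero, zero_mul, Finset.sum_const_zero]
      ring
  have hall : ∀ s : S, ∀ x ∈ N, algebraMap S L s * x ∈ N := by
    intro s
    have hs : s ∈ Algebra.adjoin F (G : Set S) := hG ▸ Algebra.mem_top
    induction hs using Algebra.adjoin_induction with
    | mem g hg => exact hgN g hg
    | algebraMap r =>
      intro x hx
      rw [← IsScalarTower.algebraMap_apply, IsScalarTower.algebraMap_apply F F' L]
      exact hsm (algebraMap F B r) x ▸ N.smul_mem (algebraMap F B r) hx
    | add s t _ _ h1 h2 =>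
      intro x hx
      rw [map_add, add_mul]
      exact add_mem (h1 x hx) (h2 x hx)
    | mul s t _ _ h1 h2 =>
      intro x hx
      rw [map_mul, mul_assoc]
      exact h1 _ (h2 x hx)
  exact ⟨hT a B hB.1.1, ha, hli, hsp, fun x => by
    have := hall x 1 h1N
    rwa [mul_one] at this⟩

end Basis

end Specialization

/-! ### Finitely generated domains of dimension one -/

section Dimension

variable (F : Type u) [Field F] {R : Type u} [CommRing R] [IsDomain R] [Algebra F R]

theorem finite_quotient_of_trdeg_le_one [Algebra.FiniteType F R] (h : Algebra.trdeg F R ≤ 1)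
    {a : R} (ha : a ≠ 0) : Module.Finite F (R ⧸ Ideal.span {a}) := by
  suffices Algebra.IsIntegral F (R ⧸ Ideal.span {a}) from Algebra.IsIntegral.finite
  refine ⟨fun x => ?_⟩
  obtain ⟨x, rfl⟩ := Ideal.Quotient.mk_surjective x
  by_cases hx : IsAlgebraic F x
  · exact hx.isIntegral.map (Ideal.Quotient.mkₐ F _)
  let v : Option PUnit.{u + 1} → R := fun o => o.elim a fun _ => x
  have hv : ¬ AlgebraicIndependent F v := fun hv => by
    have := hv.cardinalMk_le_trdeg.trans h
    simp at this
  have hx' : AlgebraicIndependent F fun _ : PUnit.{u + 1} => x :=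
    algebraicIndependent_unique_type_iff.mpr hx
  rw [AlgebraicIndependent.option_iff, not_and, Transcendental, not_not] at hv
  obtain ⟨p, hp, hpa⟩ := (hv hx').exists_nonzero_coeff_and_aeval_eq_zero
    (mem_nonZeroDivisors_of_ne_zero ha)
  have h1 : ((p.coeff 0 : Algebra.adjoin F (Set.range fun _ : PUnit.{u + 1} => x)) : R) ∈
      Ideal.span {a} := by
    rw [Polynomial.aeval_eq_sum_range, Finset.sum_range_succ'] at hpa
    rw [pow_zero, Algebra.smul_def, mul_one] at hpa
    rw [show ((p.coeff 0 : Algebra.adjoin F (Set.range fun _ : PUnit.{u + 1} => x)) : R) =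
      algebraMap _ R (p.coeff 0) from rfl, eq_neg_of_add_eq_zero_right hpa]
    refine neg_mem (sum_mem fun i _ => ?_)
    rw [pow_succ, ← smul_mul_assoc]
    exact Ideal.mul_mem_left _ _ (Ideal.mem_span_singleton_self a)
  have h2 : ∀ y ∈ Algebra.adjoin F (Set.range fun _ : PUnit.{u + 1} => x),
      y ∈ (Polynomial.aeval (R := F) x).range := fun y hy => by
    rwa [Set.range_const, Algebra.adjoin_singleton_eq_range_aeval] at hy
  obtain ⟨g, hg⟩ := h2 _ (p.coeff 0).2
  refine IsAlgebraic.isIntegral ⟨g, fun h0 => hp (Subtype.ext ?_), ?_⟩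
  · rw [← hg, h0]; simp
  · rw [← Ideal.Quotient.mkₐ_eq_mk F, Polynomial.aeval_algHom_apply, Ideal.Quotient.mkₐ_eq_mk,
      Ideal.Quotient.eq_zero_iff_mem]
    exact hg ▸ h1

end Dimension

section Norm

open IntermediateField

theorem coeff_zero_minpoly_ne_zero {A R : Type*} [CommRing A] [Nontrivial A] [CommRing R]
    [IsDomain R] [Algebra A R] {t : R} (hti : IsIntegral A t) (ht : t ≠ 0) :
    (minpoly A t).coeff 0 ≠ 0 := fun h0 => by
  have h1 := Polynomial.divX_mul_X_add (minpoly A t)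
  rw [h0, map_zero, add_zero] at h1
  have hm : (minpoly A t).divX.Monic :=
    Polynomial.monic_X.of_mul_monic_right (h1.symm ▸ minpoly.monic hti)
  have h2 : Polynomial.aeval t (minpoly A t).divX = 0 := by
    have := minpoly.aeval A t
    rw [← h1, map_mul, Polynomial.aeval_X, mul_eq_zero] at this
    exact this.resolve_right ht
  have h3 := minpoly.min A t hm h2
  have h4 := congrArg Polynomial.degree h1
  rw [Polynomial.degree_mul_X] at h4
  rw [← h4, Polynomial.degree_eq_natDegree hm.ne_zero] at h3
  exact absurd h3 (by norm_cast; omega)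

theorem coeff_zero_minpoly_dvd_pow {A R : Type*} [CommRing A] [IsDomain A] [IsIntegrallyClosed A]
    [CommRing R] [IsDomain R] [Algebra A R] [FaithfulSMul A R] [Algebra.IsIntegral A R] {t u : R}
    (ht : t ≠ 0) {b : A} (h : algebraMap A R b = t * u) :
    ∃ m : ℕ, (minpoly A t).coeff 0 ∣ b ^ m := by
  let K := FractionRing A
  let L := FractionRing R
  have : FaithfulSMul A L := FaithfulSMul.trans A R L
  let := FractionRing.liftAlgebra A L
  have : IsScalarTower A K L := FractionRing.isScalarTower_liftAlgebra A L
  let τ : L := algebraMap R L t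
  have hτ : IsIntegral A τ := (Algebra.IsIntegral.isIntegral (R := A) t).algebraMap
  have hτK : IsIntegral K τ := hτ.tower_top
  let pb := adjoin.powerBasis hτK
  have hτ0 : τ ≠ 0 := by simpa [τ] using ht
  have hg : pb.gen = AdjoinSimple.gen K τ := rfl
  have hN := Algebra.PowerBasis.norm_gen_eq_coeff_zero_minpoly pb
  rw [hg, minpoly_gen, minpoly.isIntegrallyClosed_eq_field_fractions K L
    (Algebra.IsIntegral.isIntegral (R := A) t), Polynomial.coeff_map] at hN
  have hg0 : AdjoinSimple.gen K τ ≠ 0 := fun h0 => hτ0 (by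
    rw [← AdjoinSimple.coe_gen K τ, h0]; rfl)
  let w : K⟮τ⟯ := algebraMap K K⟮τ⟯ (algebraMap A K b) / AdjoinSimple.gen K τ
  have hw : (w : L) = algebraMap R L u := by
    have : (w : L) = algebraMap K L (algebraMap A K b) / τ := rfl
    rw [this, ← IsScalarTower.algebraMap_apply A K L, IsScalarTower.algebraMap_apply A R L, h,
      map_mul, mul_div_cancel_left₀ _ hτ0]
  have hwi : IsIntegral A w := by
    have h1 : IsIntegral A (w : L) := by
      rw [hw]; exact (Algebra.IsIntegral.isIntegral (R := A) u).algebraMap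
    exact (isIntegral_algHom_iff (K⟮τ⟯.val.restrictScalars A) Subtype.val_injective).mp h1
  obtain ⟨c, hc⟩ := IsIntegrallyClosed.isIntegral_iff.mp (Algebra.isIntegral_norm K hwi)
  have hfree : Module.Free K K⟮τ⟯ := Module.Free.of_basis pb.basis
  have hmul : AdjoinSimple.gen K τ * w = algebraMap K K⟮τ⟯ (algebraMap A K b) :=
    mul_div_cancel₀ _ hg0
  have h2 := congrArg (Algebra.norm K) hmul
  rw [map_mul, Algebra.norm_algebraMap, hN, ← hc] at h2
  refine ⟨Module.finrank K K⟮τ⟯, (-1) ^ pb.dim * c, IsFractionRing.injective A K ?_⟩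
  rw [map_pow, ← h2]
  simp only [map_mul, map_pow, map_neg, map_one]
  ring

end Norm

section Dimension

variable (F : Type u) [Field F] {R : Type u} [CommRing R] [IsDomain R] [Algebra F R]

omit [IsDomain R] in
theorem exists_aeval_mem_of_finite_quotient {I : Ideal R} [Module.Finite F (R ⧸ I)] (x : R) :
    ∃ g : Polynomial F, g ≠ 0 ∧ Polynomial.aeval x g ∈ I := by
  have hx : IsIntegral F (Ideal.Quotient.mk I x) := Algebra.IsIntegral.isIntegral _
  refine ⟨minpoly F (Ideal.Quotient.mk I x), minpoly.ne_zero hx, ?_⟩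
  rw [← Ideal.Quotient.eq_zero_iff_mem, ← Ideal.Quotient.mkₐ_eq_mk F,
    ← Polynomial.aeval_algHom_apply]
  exact minpoly.aeval _ _

theorem degreeOf_aeval_X_eq_zero {σ : Type*} {i j : σ} (hij : i ≠ j) (g : Polynomial F) :
    MvPolynomial.degreeOf j (Polynomial.aeval (MvPolynomial.X i : MvPolynomial σ F) g) = 0 := by
  classical
  rw [Polynomial.aeval_eq_sum_range, ← Nat.le_zero]
  refine (MvPolynomial.degreeOf_sum_le _ _ _).trans (Finset.sup_le fun n _ => ?_)
  rw [MvPolynomial.smul_eq_C_mul]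
  refine (MvPolynomial.degreeOf_C_mul_le _ _ _).trans ((MvPolynomial.degreeOf_pow_le _ _ _).trans ?_)
  rw [MvPolynomial.degreeOf_X, if_neg hij.symm, mul_zero]

theorem degreeOf_eq_zero_of_dvd {σ : Type*} {j : σ} {p q : MvPolynomial σ F} (hq : q ≠ 0)
    (h : p ∣ q) (hj : q.degreeOf j = 0) : p.degreeOf j = 0 := by
  obtain ⟨r, rfl⟩ := h
  rw [MvPolynomial.degreeOf_mul_eq (left_ne_zero_of_mul hq) (right_ne_zero_of_mul hq)] at hj
  omega

theorem trdeg_le_one_of_finite_quotient [Algebra.FiniteType F R] {t : R} (ht : t ≠ 0)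
    (htu : ¬ IsUnit t) [Module.Finite F (R ⧸ Ideal.span {t})] : Algebra.trdeg F R ≤ 1 := by
  obtain ⟨d, g, hg, hfin⟩ := exists_finite_inj_algHom_of_fg F R
  let A := MvPolynomial (Fin d) F
  algebraize [g.toRingHom]
  have : IsScalarTower F A R := .of_algebraMap_eq' g.comp_algebraMap.symm
  have : Module.Finite A R := hfin
  have : FaithfulSMul A R := (faithfulSMul_iff_algebraMap_injective A R).mpr hg
  have htr : Algebra.trdeg F R = d := by
    rw [← trdeg_add_eq F A (A := R), trdeg_eq_zero (R := A), add_zero,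
      MvPolynomial.trdeg_of_isDomain]
    simp
  rw [htr]
  by_contra! hd
  have hd : 2 ≤ d := by exact_mod_cast hd
  have hti : IsIntegral A t := Algebra.IsIntegral.isIntegral t
  have hmin : (minpoly A t).coeff 0 ≠ 0 := coeff_zero_minpoly_ne_zero hti ht
  have hdeg : ∀ i j : Fin d, i ≠ j → ((minpoly A t).coeff 0).degreeOf j = 0 := by
    intro i j hij
    obtain ⟨p, hp, hpt⟩ := exists_aeval_mem_of_finite_quotient F (I := Ideal.span {t})
      (algebraMap A R (MvPolynomial.X i))
    obtain ⟨u, hu⟩ := Ideal.mem_span_singleton'.mp hpt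
    obtain ⟨m, hm⟩ := coeff_zero_minpoly_dvd_pow (A := A) ht (u := u)
      (b := Polynomial.aeval (MvPolynomial.X i : A) p)
      (by rw [mul_comm, hu, Polynomial.aeval_algebraMap_apply])
    have hp0 : Polynomial.aeval (MvPolynomial.X i : A) p ≠ 0 := fun h0 =>
      (MvPolynomial.transcendental_X F i) ⟨p, hp, h0⟩
    refine degreeOf_eq_zero_of_dvd F (pow_ne_zero m hp0) hm ?_
    have := MvPolynomial.degreeOf_pow_le j (Polynomial.aeval (MvPolynomial.X i : A) p) m
    rwa [degreeOf_aeval_X_eq_zero F hij, mul_zero, Nat.le_zero] at this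
  have hdeg' : ∀ j : Fin d, ((minpoly A t).coeff 0).degreeOf j = 0 := by
    intro j
    by_cases hj : j = ⟨0, by omega⟩
    · exact hdeg ⟨1, by omega⟩ j (by rw [hj]; simp)
    · exact hdeg ⟨0, by omega⟩ j (Ne.symm hj)
  have hC : (minpoly A t).coeff 0 = MvPolynomial.C ((minpoly A t).coeff 0 |>.coeff 0) := by
    refine MvPolynomial.totalDegree_eq_zero_iff_eq_C.mp ?_
    rw [MvPolynomial.totalDegree_eq_zero_iff]
    intro m hm x
    exact Nat.le_zero.mp (hdeg' x ▸ MvPolynomial.monomial_le_degreeOf x hm)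
  have hunit : IsUnit ((minpoly A t).coeff 0) := by
    rw [hC]
    refine IsUnit.map _ (isUnit_iff_ne_zero.mpr fun h0 => hmin ?_)
    rw [hC, h0, map_zero]
  refine htu (isUnit_of_dvd_unit ?_ (hunit.map (algebraMap A R)))
  have h1 := minpoly.aeval A t
  rw [Polynomial.aeval_eq_sum_range, Finset.sum_range_succ', pow_zero, Algebra.smul_def,
    mul_one] at h1
  rw [eq_neg_of_add_eq_zero_right h1, dvd_neg]
  refine Finset.dvd_sum fun i _ => ?_
  rw [pow_succ, ← smul_mul_assoc]
  exact dvd_mul_left _ _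

theorem trdeg_le_one_of_height_le_one [Algebra.FiniteType F R] (n : Ideal R) [hn : n.IsMaximal]
    (h : n.height ≤ 1) : Algebra.trdeg F R ≤ 1 := by
  have : IsNoetherianRing R := Algebra.FiniteType.isNoetherianRing F R
  by_cases h0 : n = ⊥
  · have : Ring.KrullDimLE 0 R := Ring.KrullDimLE.mk₀ fun I hI => by
      have hb : (⊥ : Ideal R).IsMaximal := h0 ▸ hn
      exact (hb.eq_of_le hI.ne_top bot_le) ▸ hb
    have : Module.Finite F R := (Module.finite_iff_krullDimLE_zero F _).mpr this
    rw [trdeg_eq_zero]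
    exact zero_le_one
  obtain ⟨t, htn, ht⟩ := Submodule.exists_mem_ne_zero_of_ne_bot h0
  have hmin : n ∈ (Ideal.span {t}).minimalPrimes := by
    obtain ⟨q, hq, hqn⟩ := Ideal.exists_minimalPrimes_le
      ((Ideal.span_singleton_le_iff_mem n).mpr htn)
    have hqp := hq.1.1
    rcases eq_or_lt_of_le hqn with rfl | hlt
    · exact hq
    have h1 := (Ideal.height_le_iff (n := 1)).mp h q hqp hlt
    have h2 : q.height ≤ (0 : ℕ) := Order.lt_one_iff.mp h1 |>.le
    refine absurd ((Ideal.height_le_iff).mp h2 ⊥ inferInstance (bot_lt_iff_ne_bot.mpr ?_)) (by simp)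
    rintro rfl
    exact ht (hq.1.2 (Ideal.mem_span_singleton_self t))
  obtain ⟨s, hs, hsn⟩ : ∃ s, (∀ q ∈ (Ideal.span {t}).minimalPrimes, q ≠ n → s ∈ q) ∧ s ∉ n := by
    classical
    have hf := Ideal.finite_minimalPrimes_of_isNoetherianRing R (Ideal.span {t})
    have h1 : ¬ (hf.toFinset.erase n).inf id ≤ n := by
      rw [Ideal.IsPrime.inf_le' hn.isPrime]
      rintro ⟨q, hq, hqn⟩
      rw [Finset.mem_erase, Set.Finite.mem_toFinset] at hq
      exact hq.1 (le_antisymm hqn (hmin.2 hq.2.1 hqn))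
    obtain ⟨s, hs, hsn⟩ := SetLike.not_le_iff_exists.mp h1
    refine ⟨s, fun q hq hqn => ?_, hsn⟩
    exact (Finset.inf_le (f := id) (Finset.mem_erase.mpr ⟨hqn, hf.mem_toFinset.mpr hq⟩) :) hs
  have hs0 : s ≠ 0 := fun h => hsn (h ▸ n.zero_mem)
  let R' := Localization.Away s
  have hle : Submonoid.powers s ≤ nonZeroDivisors R := powers_le_nonZeroDivisors_of_noZeroDivisors hs0
  have : IsDomain R' := IsLocalization.isDomain_localization hle
  have : Algebra.FiniteType R R' := IsLocalization.finiteType_of_monoid_fg (Submonoid.powers s) R'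
  have : Algebra.FiniteType F R' := Algebra.FiniteType.trans ‹Algebra.FiniteType F R› this
  have hinj : Function.Injective (algebraMap R R') := IsLocalization.injective R' hle
  refine (trdeg_le_of_injective (IsScalarTower.toAlgHom F R R') hinj).trans ?_
  have hdisj : Disjoint (Submonoid.powers s : Set R) n := by
    rw [Set.disjoint_left]
    rintro _ ⟨m, rfl⟩ hm
    exact hsn (hn.isPrime.mem_of_pow_mem m hm)
  have hnp := IsLocalization.isPrime_of_isPrime_disjoint (Submonoid.powers s) R' n hn.isPrime hdisj
  have htu : ¬ IsUnit (algebraMap R R' t) := fun h =>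
    hnp.ne_top (Ideal.eq_top_of_isUnit_mem _ (Ideal.mem_map_of_mem _ htn) h)
  have hcomap : ∀ J : Ideal R', J.IsPrime → algebraMap R R' t ∈ J → J.comap (algebraMap R R') = n := by
    intro J hJ htJ
    obtain ⟨q, hq, hqJ⟩ := Ideal.exists_minimalPrimes_le (I := Ideal.span {t})
      (J := J.comap (algebraMap R R')) ((Ideal.span_singleton_le_iff_mem _).mpr htJ)
    have hqn : q = n := by
      by_contra hqn
      refine hJ.ne_top (Ideal.eq_top_of_isUnit_mem _ (hqJ (hs q hq hqn)) ?_)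
      exact IsLocalization.Away.algebraMap_isUnit s
    subst hqn
    exact (hn.eq_of_le (Ideal.IsPrime.comap _).ne_top hqJ).symm
  have : Module.Finite F (R' ⧸ Ideal.span {algebraMap R R' t}) := by
    rw [Module.finite_iff_krullDimLE_zero F _]
    refine Ring.KrullDimLE.mk₀ fun I hI => ?_
    obtain ⟨M, hM, hIM⟩ := Ideal.exists_le_maximal I hI.ne_top
    have key : ∀ J : Ideal (R' ⧸ Ideal.span {algebraMap R R' t}), J.IsPrime →
        J.comap (Ideal.Quotient.mk _) = n.map (algebraMap R R') := fun J hJ => by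
      rw [← hcomap (J.comap (Ideal.Quotient.mk _)) (hJ.comap _) (by
        rw [Ideal.mem_comap, Ideal.Quotient.eq_zero_iff_mem.mpr (Ideal.mem_span_singleton_self _)]
        exact J.zero_mem)]
      exact (IsLocalization.map_under (Submonoid.powers s) R' _).symm
    have : I = M := Ideal.comap_injective_of_surjective _ Ideal.Quotient.mk_surjective
      ((key I hI).trans (key M hM.isPrime).symm)
    exact this ▸ hM
  exact trdeg_le_one_of_finite_quotient F ((map_ne_zero_iff _ hinj).mpr ht) htu

end Dimension

/-! ### Existentially closed field extensions -/

open scoped TensorProduct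

/-- The field `F` is existentially closed in `F'`: a finitely generated `F`-subalgebra of `F'` has
an `F`-rational point. -/
def IsExistentiallyClosed (F F' : Type*) [Field F] [Field F'] [Algebra F F'] : Prop :=
  ∀ T : Finset F', Nonempty (Algebra.adjoin F (T : Set F') →ₐ[F] F)

theorem isExistentiallyClosed_of_isAlgClosed (F F' : Type*) [Field F] [IsAlgClosed F] [Field F']
    [Algebra F F'] : IsExistentiallyClosed F F' := by
  intro T
  let B := Algebra.adjoin F (T : Set F')
  have : Algebra.FiniteType F B := (Subalgebra.fg_iff_finiteType _).mp ⟨T, rfl⟩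
  obtain ⟨m, hm⟩ := Ideal.exists_maximal B
  let := Ideal.Quotient.field m
  have : Module.Finite F (B ⧸ m) := finite_of_finite_type_of_isJacobsonRing F (B ⧸ m)
  have hb := IsAlgClosed.algebraMap_bijective_of_isIntegral (k := F) (K := B ⧸ m)
  exact ⟨(AlgEquiv.ofBijective (Algebra.ofId F (B ⧸ m)) hb).symm.toAlgHom.comp
    (Ideal.Quotient.mkₐ F m)⟩

section Specialize

variable {F F' : Type*} [Field F] [Field F'] [Algebra F F'] {M : Type*}

/-- The specialization `B ⊗ M → M` along `β : B → F`. -/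
def specialize [CommRing M] [Algebra F M] {B : Subalgebra F F'} (β : B →ₐ[F] F) : B ⊗[F] M →ₐ[F] M :=
  ((Algebra.TensorProduct.lid F M : F ⊗[F] M ≃ₐ[F] M) : F ⊗[F] M →ₐ[F] M).comp
    (Algebra.TensorProduct.map β (AlgHom.id F M))

theorem specialize_tmul [CommRing M] [Algebra F M] {B : Subalgebra F F'} (β : B →ₐ[F] F) (b : B)
    (m : M) : specialize β (b ⊗ₜ[F] m) = β b • m := by
  simp [specialize]

variable [CommRing M] [Algebra F M]

theorem exists_finset_mem_range (z : F' ⊗[F] M) : ∃ T : Finset F', ∀ B : Subalgebra F F',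
    (T : Set F') ⊆ B → z ∈ (Algebra.TensorProduct.map B.val (AlgHom.id F M)).range := by
  classical
  induction z using TensorProduct.induction_on with
  | zero => exact ⟨∅, fun B _ => zero_mem _⟩
  | tmul x m =>
    exact ⟨{x}, fun B hB => ⟨(⟨x, hB (by simp)⟩ : B) ⊗ₜ m, by simp⟩⟩
  | add x y h1 h2 =>
    obtain ⟨T1, h1⟩ := h1
    obtain ⟨T2, h2⟩ := h2
    refine ⟨T1 ∪ T2, fun B hB => ?_⟩
    rw [Finset.coe_union, Set.union_subset_iff] at hB
    exact add_mem (h1 B hB.1) (h2 B hB.2)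

theorem map_val_injective (B : Subalgebra F F') :
    Function.Injective (Algebra.TensorProduct.map B.val (AlgHom.id F M)) :=
  Module.Flat.rTensor_preserves_injective_linearMap (M := M) B.val.toLinearMap
    Subtype.val_injective

theorem exists_finset_specialize_ne_zero {z : F' ⊗[F] M} (hz : z ≠ 0) :
    ∃ T : Finset F', ∀ B : Subalgebra F F', (T : Set F') ⊆ B → ∀ (β : B →ₐ[F] F) (x : B ⊗[F] M),
      Algebra.TensorProduct.map B.val (AlgHom.id F M) x = z → specialize β x ≠ 0 := by
  classical
  let b := Module.Basis.ofVectorSpace F M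
  obtain ⟨i, hi⟩ : ∃ i, (b.baseChange F').repr z i ≠ 0 := by
    by_contra! h
    exact hz ((b.baseChange F').repr.map_eq_zero_iff.mp (Finsupp.ext h))
  refine ⟨{(b.baseChange F').repr z i, ((b.baseChange F').repr z i)⁻¹}, ?_⟩
  intro B hB β x hx h0
  let ev : B ⊗[F] M →ₗ[F] B := (TensorProduct.rid F B).toLinearMap ∘ₗ (b.coord i).lTensor B
  have h1 : ∀ x : B ⊗[F] M, ((ev x : B) : F') =
      (b.baseChange F').repr (Algebra.TensorProduct.map B.val (AlgHom.id F M) x) i := by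
    intro x
    induction x using TensorProduct.induction_on with
    | zero => simp
    | tmul c m => simp [ev, Algebra.smul_def, mul_comm]
    | add x y h1 h2 => rw [map_add, map_add, Subalgebra.coe_add, h1, h2, map_add, Finsupp.add_apply]
  have h2 : ∀ x : B ⊗[F] M, β (ev x) = b.coord i (specialize β x) := by
    intro x
    induction x using TensorProduct.induction_on with
    | zero => simp
    | tmul c m => simp [ev, specialize_tmul, mul_comm]
    | add x y h1 h2 => simp only [map_add, h1, h2]
  have h3 : IsUnit (ev x) := by
    refine IsUnit.of_mul_eq_one (⟨((b.baseChange F').repr z i)⁻¹, hB (by simp)⟩ : B) ?_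
    apply Subtype.ext
    rw [Subalgebra.coe_mul, h1, hx]
    exact mul_inv_cancel₀ hi
  refine (h3.map β).ne_zero ?_
  rw [h2, h0, map_zero]

theorem IsExistentiallyClosed.exists_algHom (h : IsExistentiallyClosed F F') (T : Finset F') :
    ∃ B : Subalgebra F F', (T : Set F') ⊆ B ∧ Nonempty (B →ₐ[F] F) :=
  ⟨_, Algebra.subset_adjoin, h T⟩

theorem IsExistentiallyClosed.isDomain_tensorProduct (h : IsExistentiallyClosed F F') (M : Type*)
    [CommRing M] [IsDomain M] [Algebra F M] : IsDomain (F' ⊗[F] M) := by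
  classical
  have : Nontrivial (F' ⊗[F] M) := inferInstance
  have : NoZeroDivisors (F' ⊗[F] M) := by
    refine ⟨fun {x y} hxy => ?_⟩
    by_contra! hne
    obtain ⟨T1, h1⟩ := exists_finset_mem_range x
    obtain ⟨T2, h2⟩ := exists_finset_mem_range y
    obtain ⟨T3, h3⟩ := exists_finset_specialize_ne_zero hne.1
    obtain ⟨T4, h4⟩ := exists_finset_specialize_ne_zero hne.2
    obtain ⟨B, hB, ⟨β⟩⟩ := h.exists_algHom (T1 ∪ T2 ∪ (T3 ∪ T4))
    simp only [Finset.coe_union, Set.union_subset_iff] at hB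
    obtain ⟨x', hx⟩ := h1 B hB.1.1
    obtain ⟨y', hy⟩ := h2 B hB.1.2
    have hxy' : x' * y' = 0 := map_val_injective B (by
      rw [map_mul, map_zero, ← hxy]
      exact congrArg₂ _ hx hy)
    have := congrArg (specialize β) hxy'
    rw [map_mul, map_zero, mul_eq_zero] at this
    exact this.elim (h3 B hB.2.1 β x' hx) (h4 B hB.2.2 β y' hy)
  exact NoZeroDivisors.to_isDomain _

end Specialize

/-- If `k` is existentially closed in `K`, then `F` is existentially closed in the fraction field
of `F ⊗ₖ K`. -/
theorem IsExistentiallyClosed.of_isFractionRing {k K F F' : Type*} [Field k] [Field K] [Field F]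
    [Field F'] [Algebra k K] [Algebra k F] [Algebra F F'] (h : IsExistentiallyClosed k K)
    (φ : K ⊗[k] F →+* F') (hφ : Function.Injective φ)
    (hφF : ∀ x : F, φ (1 ⊗ₜ x) = algebraMap F F' x)
    (hφ' : ∀ y : F', ∃ a b : K ⊗[k] F, b ≠ 0 ∧ y * φ b = φ a) :
    IsExistentiallyClosed F F' := by
  classical
  intro T
  choose a b hb hab using hφ'
  let d : K ⊗[k] F := ∏ y ∈ T, b y
  have hd : d ≠ 0 := by
    have := h.isDomain_tensorProduct F
    exact Finset.prod_ne_zero_iff.mpr fun y _ => hb y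
  have hT : ∀ y ∈ T, ∃ c, y * φ d = φ c := by
    intro y hy
    refine ⟨a y * ∏ y ∈ T.erase y, b y, ?_⟩
    rw [map_mul, ← hab, mul_assoc, ← map_mul, Finset.mul_prod_erase T b hy]
  choose! c hc using hT
  obtain ⟨S0, h0⟩ := exists_finset_mem_range d
  obtain ⟨S1, h1⟩ := exists_finset_specialize_ne_zero hd
  choose S2 h2 using fun y => exists_finset_mem_range (c y)
  obtain ⟨D, hD, ⟨δ⟩⟩ := h.exists_algHom (S0 ∪ S1 ∪ T.biUnion S2)
  simp only [Finset.coe_union, Set.union_subset_iff, Finset.coe_biUnion, Set.iUnion_subset_iff] at hD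
  obtain ⟨d', hd'⟩ := h0 D hD.1.1
  have hδ : specialize (M := F) δ d' ≠ 0 := h1 D hD.1.2 δ d' hd'
  let ι : D ⊗[k] F →+* F' := φ.comp (Algebra.TensorProduct.map D.val (AlgHom.id k F)).toRingHom
  have hι : Function.Injective ι := hφ.comp (map_val_injective D)
  have hιF : ∀ x : F, ι (1 ⊗ₜ x) = algebraMap F F' x := fun x => by
    rw [← hφF]; simp [ι]
  have hιd : ι d' = φ d := congrArg φ hd'
  let P : Subring F' :=
    { carrier := {y | ∃ (n : ℕ) (e : D ⊗[k] F), y * ι d' ^ n = ι e}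
      zero_mem' := ⟨0, 0, by simp⟩
      one_mem' := ⟨0, 1, by simp⟩
      add_mem' := by
        rintro x y ⟨n, e, he⟩ ⟨m, f, hf⟩
        refine ⟨n + m, e * d' ^ m + f * d' ^ n, ?_⟩
        rw [map_add, map_mul, map_mul, ← he, ← hf, map_pow, map_pow]; ring
      mul_mem' := by
        rintro x y ⟨n, e, he⟩ ⟨m, f, hf⟩
        refine ⟨n + m, e * f, ?_⟩
        rw [map_mul, ← he, ← hf]; ring
      neg_mem' := by
        rintro x ⟨n, e, he⟩
        exact ⟨n, -e, by rw [map_neg, ← he]; ring⟩ }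
  have hP : ∀ y ∈ Algebra.adjoin F (T : Set F'), ∃ (n : ℕ) (e : D ⊗[k] F), y * ι d' ^ n = ι e := by
    intro y hy
    change y ∈ P
    induction hy using Algebra.adjoin_induction with
    | mem y hy =>
      obtain ⟨c', hc'⟩ := h2 y D (hD.2 y hy)
      exact ⟨1, c', by rw [pow_one, hιd, hc y hy]; exact congrArg φ hc'.symm⟩
    | algebraMap r => exact ⟨0, 1 ⊗ₜ r, by rw [hιF]; simp⟩
    | add x y _ _ h1 h2 => exact P.add_mem h1 h2
    | mul x y _ _ h1 h2 => exact P.mul_mem h1 h2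
  have hι0 : ι d' ≠ 0 := fun h => hδ (by rw [hι (h.trans (map_zero ι).symm), map_zero])
  choose! n e hne using hP
  have key : ∀ y ∈ Algebra.adjoin F (T : Set F'), ∀ m f, y * ι d' ^ m = ι f →
      specialize (M := F) δ (e y) / specialize (M := F) δ d' ^ n y =
        specialize (M := F) δ f / specialize (M := F) δ d' ^ m := by
    intro y hy m f hf
    rw [div_eq_div_iff (pow_ne_zero _ hδ) (pow_ne_zero _ hδ), ← map_pow, ← map_pow, ← map_mul,
      ← map_mul]
    congr 1
    apply hι
    rw [map_mul, map_mul, ← hne y hy, ← hf, map_pow, map_pow]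
    ring
  have hsp : ∀ x : F, specialize (M := F) δ (1 ⊗ₜ x) = x := fun x => by
    rw [specialize_tmul, map_one, one_smul]
  exact ⟨{
    toFun := fun y => specialize (M := F) δ (e y) / specialize (M := F) δ d' ^ n (y : F')
    map_one' := by
      exact (key _ (Subalgebra.one_mem _) 0 1 (by simp)).trans (by simp)
    map_zero' := by
      exact (key _ (Subalgebra.zero_mem _) 0 0 (by simp)).trans (by simp)
    map_add' := fun x y => by
      rw [key _ (x + y).2 (n x + n y) (e x * d' ^ n (y : F') + e y * d' ^ n (x : F')) (by
        rw [map_add, map_mul, map_mul, ← hne x x.2, ← hne y y.2, map_pow, map_pow,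
          Subalgebra.coe_add]
        ring)]
      have := pow_ne_zero (n (x : F')) hδ
      have := pow_ne_zero (n (y : F')) hδ
      simp only [map_add, map_mul, map_pow, pow_add]
      field_simp
    map_mul' := fun x y => by
      rw [key _ (x * y).2 (n x + n y) (e x * e y) (by
        rw [map_mul, ← hne x x.2, ← hne y y.2, Subalgebra.coe_mul]
        ring), map_mul, pow_add, mul_div_mul_comm]
    commutes' := fun r => by
      exact (key _ (Subalgebra.algebraMap_mem _ r) 0 (1 ⊗ₜ r) (by
        rw [hιF, pow_zero, mul_one])).trans (by rw [hsp, pow_zero, div_one]; rfl) }⟩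

/-! ### Lengths under surjections and flat base change -/

section Length

theorem lengthAt_comap {S R : Type*} [CommRing S] [CommRing R] [Algebra S R]
    (hSR : Function.Surjective (algebraMap S R)) (q : Ideal R) [q.IsPrime] (M : Type*)
    [AddCommGroup M] [Module R M] [Module S M] [IsScalarTower S R M] :
    lengthAt (q.comap (algebraMap S R)) M = lengthAt q M := by
  let p := q.comap (algebraMap S R)
  let O := Localization.AtPrime p
  let O' := Localization.AtPrime q
  let N := LocalizedModule q.primeCompl M
  let φ : O →+* O' := Localization.localRingHom p q (algebraMap S R) rfl
  have hφ : Function.Surjective φ := fun x => by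
    obtain ⟨r, s, rfl⟩ := IsLocalization.exists_mk'_eq q.primeCompl x
    obtain ⟨r, rfl⟩ := hSR r
    obtain ⟨s, hs⟩ := s
    obtain ⟨s, rfl⟩ := hSR s
    exact ⟨IsLocalization.mk' O r (⟨s, hs⟩ : p.primeCompl),
      Localization.localRingHom_mk' p q (algebraMap S R) rfl r (⟨s, hs⟩ : p.primeCompl)⟩
  let : Algebra O O' := φ.toAlgebra
  let : Module O N := Module.compHom N φ
  have : IsScalarTower O O' N := ⟨fun x y z => by
    rw [Algebra.smul_def, mul_smul]; rfl⟩
  have : IsScalarTower S O N := ⟨fun x y z => by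
    change φ (x • y) • z = x • φ y • z
    rw [Algebra.smul_def, map_mul, Localization.localRingHom_to_map, mul_smul,
      algebraMap_smul, algebraMap_smul]⟩
  let f : M →ₗ[S] N := (LocalizedModule.mkLinearMap q.primeCompl M).restrictScalars S
  have hu : ∀ x : p.primeCompl, algebraMap S R x ∈ q.primeCompl := fun x => x.2
  have : IsLocalizedModule p.primeCompl f := by
    refine ⟨fun x => ?_, fun y => ?_, fun {x y} hxy => ?_⟩
    · have := IsLocalizedModule.map_units (LocalizedModule.mkLinearMap q.primeCompl M)
        (⟨_, hu x⟩ : q.primeCompl)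
      rw [Module.End.isUnit_iff] at this ⊢
      convert this using 1
      ext z
      exact (algebraMap_smul R (x : S) z).symm
    · obtain ⟨⟨m, s, hs⟩, h⟩ := IsLocalizedModule.surj q.primeCompl
        (LocalizedModule.mkLinearMap q.primeCompl M) y
      obtain ⟨s, rfl⟩ := hSR s
      refine ⟨⟨m, s, hs⟩, ?_⟩
      refine Eq.trans ?_ h
      exact (algebraMap_smul R s y).symm
    · obtain ⟨⟨s, hs⟩, h⟩ := IsLocalizedModule.exists_of_eq (S := q.primeCompl)
        (f := LocalizedModule.mkLinearMap q.primeCompl M) hxy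
      obtain ⟨s, rfl⟩ := hSR s
      refine ⟨⟨s, hs⟩, ?_⟩
      have h' : algebraMap S R s • x = algebraMap S R s • y := h
      rw [algebraMap_smul, algebraMap_smul] at h'
      exact h'
  exact (length_eq_lengthAt p O f).symm.trans (Module.length_eq_of_surjective hφ)

theorem lengthAt_quotient_eq_top {R : Type*} [CommRing R] {q p : Ideal R} [q.IsPrime] [p.IsPrime]
    (h : q < p) : lengthAt p (R ⧸ q) = ⊤ := by
  by_contra hne
  let O := Localization.AtPrime p
  rw [← length_quotient_map_eq_lengthAt p O q, ← ne_eq, Module.length_ne_top_iff,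
    isFiniteLength_iff_isNoetherian_isArtinian] at hne
  have hd : Disjoint (p.primeCompl : Set R) q :=
    Set.disjoint_left.mpr fun x hx hq => hx (h.le hq)
  have hq : (q.map (algebraMap R O)).IsPrime :=
    IsLocalization.isPrime_of_isPrime_disjoint p.primeCompl O q ‹_› hd
  have := hne.2
  have : IsArtinianRing (O ⧸ q.map (algebraMap R O)) :=
    isArtinian_of_tower O this
  have hm : (q.map (algebraMap R O)).IsMaximal :=
    Ideal.Quotient.maximal_of_isField _ (IsArtinianRing.isField_of_isDomain _)
  have h1 := IsLocalRing.eq_maximalIdeal hm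
  have h2 := congrArg (Ideal.comap (algebraMap R O)) h1
  exact h.ne ((IsLocalization.under_map_of_isPrime_disjoint p.primeCompl O ‹_› hd).symm.trans
    (h2.trans (IsLocalization.AtPrime.under_maximalIdeal O p)))

theorem lengthAt_baseChange {A A' : Type u} [CommRing A] [CommRing A'] [IsNoetherianRing A]
    [Algebra A A'] [Module.Flat A A'] (p : Ideal A) [p.IsPrime]
    [hP : (p.map (algebraMap A A')).IsPrime]
    (hp : (p.map (algebraMap A A')).comap (algebraMap A A') = p)
    (M : Type u) [AddCommGroup M] [Module A M] [hM : Module.Finite A M] (h : lengthAt p M ≠ ⊤) :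
    lengthAt (p.map (algebraMap A A')) (A' ⊗[A] M) = lengthAt p M := by
  have hex : ∀ (N₁ N₂ N₃ : Type u) [AddCommGroup N₁] [Module A N₁] [AddCommGroup N₂] [Module A N₂]
      [AddCommGroup N₃] [Module A N₃] (f : N₁ →ₗ[A] N₂) (g : N₂ →ₗ[A] N₃),
      Function.Injective f → Function.Surjective g → Function.Exact f g →
      lengthAt (p.map (algebraMap A A')) (A' ⊗[A] N₂) =
        lengthAt (p.map (algebraMap A A')) (A' ⊗[A] N₁) +
          lengthAt (p.map (algebraMap A A')) (A' ⊗[A] N₃) := by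
    intro N₁ N₂ N₃ _ _ _ _ _ _ f g hf hg hfg
    exact lengthAt_eq_add_of_exact _ (f.baseChange A') (g.baseChange A')
      (Module.Flat.lTensor_preserves_injective_linearMap f hf) (LinearMap.lTensor_surjective A' hg)
      (lTensor_exact A' hfg hg)
  induction hM using IsNoetherianRing.induction_on_isQuotientEquivQuotientPrime with
  | subsingleton N =>
    rw [lengthAt_of_subsingleton, lengthAt_of_subsingleton]
  | quotient N q e =>
    have e' : A' ⊗[A] N ≃ₗ[A'] A' ⧸ q.asIdeal.map (algebraMap A A') :=
      (e.baseChange A A' _ _).trans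
        (Algebra.TensorProduct.quotIdealMapEquivTensorQuot A' q.asIdeal).symm.toLinearEquiv
    rw [lengthAt_congr _ e', lengthAt_congr p e]
    rw [lengthAt_congr p e] at h
    by_cases hq : q.asIdeal ≤ p
    · rcases eq_or_lt_of_le hq with hq | hq
      · have : q.asIdeal.map (algebraMap A A') = p.map (algebraMap A A') := by rw [hq]
        rw [lengthAt_congr _ (Submodule.quotEquivOfEq _ _ this), lengthAt_quotient_self,
          lengthAt_congr p (Submodule.quotEquivOfEq _ _ hq), lengthAt_quotient_self]
      · exact absurd (lengthAt_quotient_eq_top hq) h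
    · rw [lengthAt_quotient_eq_zero _ hq, lengthAt_quotient_eq_zero]
      rwa [Ideal.map_le_iff_le_comap, hp]
  | exact N₁ N₂ N₃ f g hf hg hfg h1 h3 =>
    have := lengthAt_eq_add_of_exact p f g hf hg hfg
    rw [this] at h ⊢
    rw [hex N₁ N₂ N₃ f g hf hg hfg, h1 fun h' => h (by rw [h', top_add]),
      h3 fun h' => h (by rw [h', add_top])]

theorem lengthAt_quotient_map {A A' : Type u} [CommRing A] [CommRing A'] [IsNoetherianRing A]
    [Algebra A A'] [Module.Flat A A'] (p : Ideal A) [p.IsPrime]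
    [hP : (p.map (algebraMap A A')).IsPrime]
    (hp : (p.map (algebraMap A A')).comap (algebraMap A A') = p) (J : Ideal A)
    (h : lengthAt p (A ⧸ J) ≠ ⊤) :
    lengthAt (p.map (algebraMap A A')) (A' ⧸ J.map (algebraMap A A')) = lengthAt p (A ⧸ J) := by
  rw [← lengthAt_baseChange p hp (A ⧸ J) h]
  exact lengthAt_congr _
    (Algebra.TensorProduct.quotIdealMapEquivTensorQuot A' J).toLinearEquiv

end Length

/-! ### Orders of vanishing on affine charts -/

section Order

variable {W : Scheme.{u}} {U : W.Opens} (hU : IsAffineOpen U) {w : W} (hw : w ∈ U)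

include hU in
theorem coheight_eq_height : (coheight w : ℕ∞) = (hU.primeIdealOf ⟨w, hw⟩).asIdeal.height := by
  let := W.presheaf.algebra_section_stalk ⟨w, hw⟩
  have := hU.isLocalization_stalk ⟨w, hw⟩
  have h1 := ringKrullDim_stalk_eq_coheight w
  rw [IsLocalization.AtPrime.ringKrullDim_eq_height (hU.primeIdealOf ⟨w, hw⟩).asIdeal] at h1
  exact_mod_cast h1.symm

include hU in
theorem isNoetherianRing_of_isAffineOpen [IsLocallyNoetherian W] : IsNoetherianRing Γ(W, U) :=
  IsLocallyNoetherian.component_noetherian ⟨U, hU⟩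

theorem length_stalk_eq_lengthAt (a : Γ(W, U)) :
    Ring.ord (W.presheaf.stalk w) (W.presheaf.germ U w hw a) =
      lengthAt (hU.primeIdealOf ⟨w, hw⟩).asIdeal (Γ(W, U) ⧸ Ideal.span {a}) := by
  let := W.presheaf.algebra_section_stalk ⟨w, hw⟩
  have := hU.isLocalization_stalk ⟨w, hw⟩
  rw [← length_quotient_map_eq_lengthAt _ (W.presheaf.stalk w), Ideal.map_span,
    Set.image_singleton]
  rfl

variable [AlgebraicGeometry.IsIntegral W] [IsLocallyNoetherian W]

theorem lengthAt_ne_top_of_coheight_le_one (h : coheight w ≤ 1) {a : Γ(W, U)} (ha : a ≠ 0) :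
    lengthAt (hU.primeIdealOf ⟨w, hw⟩).asIdeal (Γ(W, U) ⧸ Ideal.span {a}) ≠ ⊤ := by
  have : Ring.KrullDimLE 1 (W.presheaf.stalk w) := krullDimLE_of_coheight_le h
  rw [← length_stalk_eq_lengthAt hU hw]
  refine Ring.ord_ne_top (mem_nonZeroDivisors_of_ne_zero ?_)
  exact (map_ne_zero_iff _ (germ_injective_of_isIntegral W w hw)).mpr ha

theorem ord_germToFunctionField [Nonempty U] (h : coheight w = 1) {a : Γ(W, U)} (ha : a ≠ 0) :
    Scheme.ord (W.germToFunctionField U a) w =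
      (lengthAt (hU.primeIdealOf ⟨w, hw⟩).asIdeal (Γ(W, U) ⧸ Ideal.span {a})).toNat := by
  have : Ring.KrullDimLE 1 (W.presheaf.stalk w) := krullDimLE_of_coheight_le h.le
  have hne : W.presheaf.germ U w hw a ≠ 0 :=
    (map_ne_zero_iff _ (germ_injective_of_isIntegral W w hw)).mpr ha
  have hlen := lengthAt_ne_top_of_coheight_le_one hU hw h.le ha
  rw [Scheme.ord_eq_iff h ((map_ne_zero_iff _ (Scheme.germToFunctionField_injective W U)).mpr ha),
    ← Scheme.algebraMap_germ_eq_germToFunctionField W hw, Scheme.ordHom, Ring.ordFrac_eq_ord _ hne,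
    Ring.ordMonoidWithZeroHom_eq_coe _ (mem_nonZeroDivisors_of_ne_zero hne)]
  rw [length_stalk_eq_lengthAt hU hw, ENat.natCast_toNat hlen]

/-- The order of vanishing of a quotient `a / b` is the difference of the lengths of the local rings
modulo `a` and modulo `b`, if these are finite. -/
theorem ord_eq_sub_lengthAt [Nonempty U] {a b : Γ(W, U)} (ha : a ≠ 0) (hb : b ≠ 0)
    {f : W.functionField} (hf : f * W.germToFunctionField U b = W.germToFunctionField U a)
    (h1 : lengthAt (hU.primeIdealOf ⟨w, hw⟩).asIdeal (Γ(W, U) ⧸ Ideal.span {a}) ≠ ⊤)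
    (h2 : lengthAt (hU.primeIdealOf ⟨w, hw⟩).asIdeal (Γ(W, U) ⧸ Ideal.span {b}) ≠ ⊤) :
    Scheme.ord f w =
      (lengthAt (hU.primeIdealOf ⟨w, hw⟩).asIdeal (Γ(W, U) ⧸ Ideal.span {a})).toNat -
      (lengthAt (hU.primeIdealOf ⟨w, hw⟩).asIdeal (Γ(W, U) ⧸ Ideal.span {b})).toNat := by
  have hb' : W.germToFunctionField U b ≠ 0 :=
    (map_ne_zero_iff _ (Scheme.germToFunctionField_injective W U)).mpr hb
  have ha' : W.germToFunctionField U a ≠ 0 :=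
    (map_ne_zero_iff _ (Scheme.germToFunctionField_injective W U)).mpr ha
  have hf0 : f ≠ 0 := by
    rintro rfl
    rw [zero_mul] at hf
    exact ha' hf.symm
  by_cases h : coheight w = 1
  · rw [← ord_germToFunctionField hU hw h ha, ← ord_germToFunctionField hU hw h hb, ← hf,
      Scheme.ord_mul hf0 hb']
    ring
  · have key : ∀ c : Γ(W, U), c ≠ 0 →
        lengthAt (hU.primeIdealOf ⟨w, hw⟩).asIdeal (Γ(W, U) ⧸ Ideal.span {c}) ≠ ⊤ →
        lengthAt (hU.primeIdealOf ⟨w, hw⟩).asIdeal (Γ(W, U) ⧸ Ideal.span {c}) = 0 := by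
      intro c hc hfin
      have := isNoetherianRing_of_isAffineOpen hU
      by_cases hcp : c ∈ (hU.primeIdealOf ⟨w, hw⟩).asIdeal
      · refine absurd ?_ h
        have hmin : (hU.primeIdealOf ⟨w, hw⟩).asIdeal ∈ (Ideal.span {c}).minimalPrimes := by
          obtain ⟨q, hq, hqp⟩ := Ideal.exists_minimalPrimes_le
            ((Ideal.span_singleton_le_iff_mem _).mpr hcp)
          have := hq.1.1
          rcases eq_or_lt_of_le hqp with hqp | hqp
          · exact hqp ▸ hq
          · exact absurd (top_le_iff.mp ((lengthAt_quotient_eq_top hqp).ge.trans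
              (lengthAt_quotient_anti _ hq.1.2))) hfin
        rw [coheight_eq_height hU hw]
        refine le_antisymm (Ideal.height_le_one_of_isPrincipal_of_mem_minimalPrimes _ _ hmin) ?_
        rw [Order.one_le_iff_ne_zero]
        intro h0
        have h1 : (hU.primeIdealOf ⟨w, hw⟩).asIdeal.height ≤ (0 : ℕ) := h0.le
        refine absurd (Ideal.height_le_iff.mp h1 ⊥ inferInstance (bot_lt_iff_ne_bot.mpr ?_))
          (by simp)
        intro h2
        rw [h2] at hcp
        exact hc hcp
      · exact lengthAt_quotient_eq_zero _ (by rwa [Ideal.span_singleton_le_iff_mem])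
    rw [Scheme.ord_eq_zero_of_coheight_neq_one h, key a ha h1, key b hb h2]
    simp

end Order

/-! ### Base change of algebras along existentially closed extensions -/

section BaseChange

variable {F F' A A' : Type u} [Field F] [Field F'] [CommRing A] [CommRing A'] [Algebra F F']
  [Algebra F A] [Algebra A A'] (e : F' ⊗[F] A ≃+* A') (he : ∀ a : A, e (1 ⊗ₜ a) = algebraMap A A' a)

include he

theorem flat_of_tensorEquiv : Module.Flat A A' := by
  let e' : A ⊗[F] F' ≃ₗ[A] A' :=
    { (Algebra.TensorProduct.comm F A F').toRingEquiv.trans e with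
      map_smul' := fun a x => by
        simp only [RingEquiv.toEquiv_eq_coe]
        change e (Algebra.TensorProduct.comm F A F' (a • x)) =
          a • e (Algebra.TensorProduct.comm F A F' x)
        rw [Algebra.smul_def, Algebra.smul_def, map_mul, map_mul, ← he]
        simp }
  exact Module.Flat.of_linearEquiv e'.symm

/-- The quotient `A'/pA'` is `F' ⊗ A/p`. -/
theorem map_eq_ker (p : Ideal A) : p.map (algebraMap A A') =
    RingHom.ker ((Algebra.TensorProduct.map (AlgHom.id F F') (Ideal.Quotient.mkₐ F p)).toRingHom.comp
      e.symm.toRingHom) := by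
  have h1 := Algebra.TensorProduct.lTensor_ker (A := F') (Ideal.Quotient.mkₐ F p)
    Ideal.Quotient.mk_surjective
  have h2 : RingHom.ker ((Algebra.TensorProduct.map (AlgHom.id F F')
      (Ideal.Quotient.mkₐ F p)).toRingHom.comp e.symm.toRingHom) =
      (RingHom.ker (Algebra.TensorProduct.map (AlgHom.id F F')
        (Ideal.Quotient.mkₐ F p))).comap e.symm.toRingHom := rfl
  have h4 : RingHom.ker (Ideal.Quotient.mkₐ F p) = p :=
    Ideal.ext fun x => Ideal.Quotient.eq_zero_iff_mem
  rw [h2, h1, h4]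
  have h3 : algebraMap A A' = e.toRingHom.comp
      (Algebra.TensorProduct.includeRight : A →ₐ[F] F' ⊗[F] A).toRingHom :=
    RingHom.ext fun a => (he a).symm
  rw [h3, ← Ideal.map_map]
  exact Ideal.map_comap_of_equiv e

theorem isPrime_map (h : IsExistentiallyClosed F F') (p : Ideal A) [p.IsPrime] :
    (p.map (algebraMap A A')).IsPrime := by
  rw [map_eq_ker e he p]
  have := h.isDomain_tensorProduct (A ⧸ p)
  exact RingHom.ker_isPrime _

theorem comap_map_eq (p : Ideal A) :
    (p.map (algebraMap A A')).comap (algebraMap A A') = p := by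
  refine le_antisymm (fun a ha => ?_) Ideal.le_comap_map
  rw [Ideal.mem_comap, map_eq_ker e he p, RingHom.mem_ker, ← he] at ha
  have h1 : (1 : F') ⊗ₜ[F] (Ideal.Quotient.mk p a) = 0 := by simpa using ha
  rw [← Ideal.Quotient.eq_zero_iff_mem]
  refine Algebra.TensorProduct.includeRight_injective (R := F) (A := F')
    (algebraMap F F').injective ?_
  rw [map_zero]
  exact h1

omit [Algebra A A'] he in
include e in
theorem isNoetherianRing_of_tensorEquiv [Algebra.FiniteType F A] : IsNoetherianRing A' := by
  have : IsNoetherianRing (F' ⊗[F] A) := Algebra.FiniteType.isNoetherianRing F' _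
  exact isNoetherianRing_of_ringEquiv _ e

theorem height_eq_of_eq_map [Algebra.FiniteType F A] (p : Ideal A) [p.IsPrime]
    [hP : (p.map (algebraMap A A')).IsPrime] : (p.map (algebraMap A A')).height = p.height := by
  have := flat_of_tensorEquiv e he
  have := isNoetherianRing_of_tensorEquiv e
  have : (p.map (algebraMap A A')).LiesOver p := ⟨(comap_map_eq e he p).symm⟩
  have : IsNoetherianRing A := Algebra.FiniteType.isNoetherianRing F A
  rw [Ideal.height_eq_height_add_of_liesOver_of_hasGoingDown p, Ideal.map_quotient_self,
    Ideal.height_bot, add_zero]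

theorem height_lt_of_map_lt [Algebra.FiniteType F A] (p : Ideal A) [p.IsPrime]
    (hP : (p.map (algebraMap A A')).IsPrime) {P : Ideal A'} [P.IsPrime]
    (h : p.map (algebraMap A A') < P) : p.height + 1 ≤ P.height := by
  have := isNoetherianRing_of_tensorEquiv e
  rw [← height_eq_of_eq_map e he p]
  exact Ideal.height_add_one_le_of_lt_of_isPrime h

end BaseChange

/-! ### Affine charts of a base change -/

section Chart

variable {F F' : Type u} [Field F] [Field F'] [Algebra F F'] {Y Y' : Scheme.{u}}
  {s : Y ⟶ Spec (.of F)} {s' : Y' ⟶ Spec (.of F')} {g : Y' ⟶ Y}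
  (H : IsPullback g s' s (specExtension F F'))

include H in
theorem isAffineHom_of_isPullback : IsAffineHom g :=
  MorphismProperty.of_isPullback (P := @IsAffineHom) H.flip (by
    rw [specExtension]; infer_instance)

theorem le_preimage_top {T : Scheme.{u}} (s : Y ⟶ T) (U : Y.Opens) : U ≤ s ⁻¹ᵁ ⊤ :=
  le_top

theorem appLE_eq_ΓSpecIso_comp_scalars (s : Y ⟶ Spec (.of F)) (U : Y.Opens) :
    s.appLE ⊤ U (le_preimage_top s U) = (Scheme.ΓSpecIso (.of F)).hom ≫ CommRingCat.ofHom (scalars s U) := by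
  simp only [scalars, CommRingCat.ofHom_hom, Iso.hom_inv_id_assoc]
  rfl

include H in
theorem exists_tensorEquiv {U : Y.Opens} (hU : IsAffineOpen U) :
    letI := (scalars s U).toAlgebra
    ∃ e : F' ⊗[F] Γ(Y, U) ≃+* Γ(Y', g ⁻¹ᵁ U), (∀ a, e (1 ⊗ₜ a) = g.app U a) ∧
      ∀ c, e (c ⊗ₜ 1) = scalars s' (g ⁻¹ᵁ U) c := by
  let := (scalars s U).toAlgebra
  have h1 := isIso_pushoutSection_of_isAffineOpen H (US := ⊤) (UT := ⊤) (UX := U) (UY := g ⁻¹ᵁ U)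
    (by simp) (by simp) (by simp) (isAffineOpen_top _) (isAffineOpen_top _) hU
  replace h1 := (isIso_pushoutSection_iff ..).mp h1
  have h2 : IsPushout (CommRingCat.ofHom (algebraMap F F')) (CommRingCat.ofHom (scalars s U))
      (CommRingCat.ofHom (scalars s' (g ⁻¹ᵁ U))) (g.app U) := by
    refine h1.flip.of_iso (Scheme.ΓSpecIso _) (Scheme.ΓSpecIso _) (Iso.refl _) (Iso.refl _)
      ?_ ?_ ?_ ?_
    · rw [appLE_eq_ΓSpecIso_comp_scalars, Category.assoc, ← Iso.eq_inv_comp]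
      simp only [scalars, specExtension, CommRingCat.ofHom_hom, Category.assoc]
      have h4 : homOfLE (le_top : (⊤ : (Spec (CommRingCat.of F')).Opens) ≤ _) = 𝟙 _ := rfl
      erw [h4]
      rw [op_id, CategoryTheory.Functor.map_id]
      erw [Category.id_comp]
      erw [Scheme.ΓSpecIso_naturality]
    · exact (Category.comp_id _).trans (appLE_eq_ΓSpecIso_comp_scalars s U)
    · exact (Category.comp_id _).trans (appLE_eq_ΓSpecIso_comp_scalars s' _)
    · rw [Scheme.Hom.app_eq_appLE]
      exact (Category.comp_id _).trans (Category.id_comp _).symm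
  have h3 := CommRingCat.isPushout_tensorProduct F F' Γ(Y, U)
  let i := h3.isoIsPushout _ _ h2
  refine ⟨i.commRingCatIsoToRingEquiv, fun a => ?_, fun c => ?_⟩
  · have h4 := congrArg (fun φ : _ ⟶ _ => CommRingCat.Hom.hom φ a) (IsPushout.inr_isoIsPushout_hom _ _ h3 h2)
    exact h4
  · have h4 := congrArg (fun φ : _ ⟶ _ => CommRingCat.Hom.hom φ c) (IsPushout.inl_isoIsPushout_hom _ _ h3 h2)
    exact h4

end Chart

/-! ### Points of affine charts -/

section AffinePoints

variable {W : Scheme.{u}} {U : W.Opens} (hU : IsAffineOpen U)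

theorem fromSpec_mem (P : PrimeSpectrum Γ(W, U)) : hU.fromSpec P ∈ U := by
  have : hU.fromSpec P ∈ Set.range hU.fromSpec := ⟨P, rfl⟩
  rwa [hU.range_fromSpec] at this

theorem primeIdealOf_fromSpec (P : PrimeSpectrum Γ(W, U)) :
    hU.primeIdealOf ⟨hU.fromSpec P, fromSpec_mem hU P⟩ = P :=
  hU.fromSpec.isOpenEmbedding.injective (hU.fromSpec_primeIdealOf _)

theorem primeIdealOf_injective : Function.Injective hU.primeIdealOf := fun x y h =>
  Subtype.ext (by rw [← hU.fromSpec_primeIdealOf x, h, hU.fromSpec_primeIdealOf])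

theorem specializes_iff_primeIdealOf_le {v w : W} (hv : v ∈ U) (hw : w ∈ U) :
    v ⤳ w ↔ (hU.primeIdealOf ⟨v, hv⟩).asIdeal ≤ (hU.primeIdealOf ⟨w, hw⟩).asIdeal := by
  change _ ↔ hU.primeIdealOf ⟨v, hv⟩ ≤ hU.primeIdealOf ⟨w, hw⟩
  have h := hU.fromSpec.isOpenEmbedding.isInducing.specializes_iff (x := hU.primeIdealOf ⟨v, hv⟩)
    (y := hU.primeIdealOf ⟨w, hw⟩)
  rw [PrimeSpectrum.le_iff_specializes]
  rw [hU.fromSpec_primeIdealOf, hU.fromSpec_primeIdealOf] at h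
  exact h

theorem exists_eq_div [AlgebraicGeometry.IsIntegral W] [Nonempty U] (hU : IsAffineOpen U)
    (f : W.functionField) : ∃ a b : Γ(W, U), b ≠ 0 ∧
      f * W.germToFunctionField U b = W.germToFunctionField U a := by
  have := functionField_isFractionRing_of_isAffineOpen W U hU
  obtain ⟨⟨a, b⟩, h⟩ := IsLocalization.surj (nonZeroDivisors Γ(W, U)) f
  exact ⟨a, b, nonZeroDivisors.coe_ne_zero b, h⟩

theorem ne_zero_of_div [AlgebraicGeometry.IsIntegral W] [Nonempty U]
    {f : W.functionField} (hf0 : f ≠ 0) {a b : Γ(W, U)} (hb : b ≠ 0)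
    (hf : f * W.germToFunctionField U b = W.germToFunctionField U a) : a ≠ 0 := by
  rintro rfl
  rw [map_zero] at hf
  exact mul_ne_zero hf0 ((map_ne_zero_iff _ (Scheme.germToFunctionField_injective W U)).mpr hb) hf

variable [AlgebraicGeometry.IsIntegral W] [IsLocallyNoetherian W]

theorem ord_eq_zero_of_notMem {w : W} (hw : w ∈ U) [Nonempty U] {a b : Γ(W, U)}
    {f : W.functionField} (hf : f * W.germToFunctionField U b = W.germToFunctionField U a)
    (ha : a ∉ (hU.primeIdealOf ⟨w, hw⟩).asIdeal) (hb : b ∉ (hU.primeIdealOf ⟨w, hw⟩).asIdeal) :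
    Scheme.ord f w = 0 := by
  have h1 : ∀ c ∉ (hU.primeIdealOf ⟨w, hw⟩).asIdeal,
      lengthAt (hU.primeIdealOf ⟨w, hw⟩).asIdeal (Γ(W, U) ⧸ Ideal.span {c}) = 0 := fun c hc =>
    lengthAt_quotient_eq_zero _ (by rwa [Ideal.span_singleton_le_iff_mem])
  have ha0 : a ≠ 0 := fun h => ha (h ▸ zero_mem _)
  have hb0 : b ≠ 0 := fun h => hb (h ▸ zero_mem _)
  rw [ord_eq_sub_lengthAt hU hw ha0 hb0 hf (by rw [h1 a ha]; simp) (by rw [h1 b hb]; simp),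
    h1 a ha, h1 b hb]
  simp

theorem ord_eq_zero_or_mem_minimalPrimes {w : W} (hw : w ∈ U) [Nonempty U] {a b : Γ(W, U)}
    {f : W.functionField} (hf : f * W.germToFunctionField U b = W.germToFunctionField U a)
    (ha0 : a ≠ 0) (hb0 : b ≠ 0) (h : Scheme.ord f w ≠ 0) :
    (hU.primeIdealOf ⟨w, hw⟩).asIdeal ∈ (Ideal.span {a}).minimalPrimes ∪
      (Ideal.span {b}).minimalPrimes := by
  have hw1 : (hU.primeIdealOf ⟨w, hw⟩).asIdeal.height = 1 := by
    rw [← coheight_eq_height hU hw]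
    by_contra h1
    exact h (Scheme.ord_eq_zero_of_coheight_neq_one h1 f)
  have key : ∀ c ∈ (hU.primeIdealOf ⟨w, hw⟩).asIdeal, c ≠ 0 →
      (hU.primeIdealOf ⟨w, hw⟩).asIdeal ∈ (Ideal.span {c}).minimalPrimes := by
    intro c hc hc0
    obtain ⟨q, hq, hqp⟩ := Ideal.exists_minimalPrimes_le
      ((Ideal.span_singleton_le_iff_mem _).mpr hc)
    have := hq.1.1
    rcases eq_or_lt_of_le hqp with hqp | hqp
    · exact hqp ▸ hq
    · have h2 : (hU.primeIdealOf ⟨w, hw⟩).asIdeal.height ≤ (1 : ℕ) := hw1.le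
      have h3 := Ideal.height_le_iff.mp h2 q inferInstance hqp
      have h4 : q.height ≤ (0 : ℕ) := by simpa using h3
      have h5 : q = ⊥ := by
        by_contra hq0
        exact absurd (Ideal.height_le_iff.mp h4 ⊥ inferInstance (bot_lt_iff_ne_bot.mpr hq0))
          (by simp)
      have h6 := hq.1.2 (Ideal.mem_span_singleton_self c)
      rw [h5] at h6
      exact absurd h6 hc0
  by_contra hcon
  rw [Set.mem_union, not_or] at hcon
  exact h (ord_eq_zero_of_notMem hU hw hf (fun h' => hcon.1 (key a h' ha0))
    fun h' => hcon.2 (key b h' hb0))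

end AffinePoints

/-! ### Principal cycles -/

section Principal

variable {Y W : Scheme.{u}} [AlgebraicGeometry.IsIntegral W] [IsLocallyNoetherian W]

theorem finite_ord_ne_zero {U : W.Opens} (hU : IsAffineOpen U) {f : W.functionField} (hf : f ≠ 0) :
    {w : W | w ∈ U ∧ Scheme.ord f w ≠ 0}.Finite := by
  rcases isEmpty_or_nonempty U with hne | hne
  · refine Set.Finite.subset Set.finite_empty fun w hw => (hne.false ⟨w, hw.1⟩).elim
  obtain ⟨a, b, hb, hab⟩ := exists_eq_div hU f
  have := isNoetherianRing_of_isAffineOpen hU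
  have hfin : ((Ideal.span {a}).minimalPrimes ∪ (Ideal.span {b}).minimalPrimes).Finite :=
    (Ideal.finite_minimalPrimes_of_isNoetherianRing _ _).union
      (Ideal.finite_minimalPrimes_of_isNoetherianRing _ _)
  have h2 : Function.Injective fun w : U => (hU.primeIdealOf w).asIdeal := fun x y h =>
    primeIdealOf_injective hU (PrimeSpectrum.ext h)
  refine ((hfin.preimage h2.injOn).image Subtype.val).subset ?_
  rintro w ⟨hw, hw'⟩
  exact ⟨⟨w, hw⟩, ord_eq_zero_or_mem_minimalPrimes hU hw hab (ne_zero_of_div hf hb hab) hb hw', rfl⟩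

theorem exists_isPrincipalCycle (i : W ⟶ Y) [IsClosedImmersion i] {f : W.functionField}
    (hf : f ≠ 0) : ∃ z : AlgebraicCycle Y ℤ, IsPrincipalCycle Y z ∧
      (∀ w : W, z (i w) = Scheme.ord f w) ∧ ∀ y : Y, y ∉ Set.range i → z y = 0 := by
  classical
  let φ : Y → ℤ := fun y => if h : y ∈ Set.range i then Scheme.ord f h.choose else 0
  have h1 : ∀ w : W, φ (i w) = Scheme.ord f w := fun w => by
    have h : i w ∈ Set.range i := ⟨w, rfl⟩
    have h' : h.choose = w := i.isClosedEmbedding.injective h.choose_spec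
    simp only [φ, dif_pos h, h']
  have h2 : ∀ y : Y, y ∉ Set.range i → φ y = 0 := fun y hy => dif_neg hy
  have h3 : ∀ y ∈ (Set.univ : Set Y), ∃ t ∈ nhds y, (t ∩ Function.support φ).Finite := by
    intro y _
    obtain ⟨V, hV, hyV, -⟩ := exists_isAffineOpen_mem_and_subset (U := ⊤) (x := y) trivial
    refine ⟨V, V.isOpen.mem_nhds hyV, ((finite_ord_ne_zero (hV.preimage i) hf).image i).subset ?_⟩
    rintro x ⟨hxV, hx⟩
    by_cases hxi : x ∈ Set.range i
    · obtain ⟨w, rfl⟩ := hxi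
      exact ⟨w, ⟨hxV, by rwa [Function.mem_support, h1] at hx⟩, rfl⟩
    · exact absurd (h2 x hxi) hx
  refine ⟨⟨φ, Set.subset_univ _, h3⟩, ?_, h1, h2⟩
  exact ⟨W, ‹_›, ‹_›, i, ‹_›, f, hf, h1, h2⟩

end Principal

/-! ### Integrality of base changes -/

section IntegralBaseChange

variable {F F' : Type u} [Field F] [Field F'] [Algebra F F'] {Y Y' : Scheme.{u}}
  {s : Y ⟶ Spec (.of F)} {s' : Y' ⟶ Spec (.of F')} {g : Y' ⟶ Y}

theorem geometricallyIntegral_specExtension (h : IsExistentiallyClosed F F') :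
    GeometricallyIntegral (specExtension F F') := by
  refine ⟨fun L _ y Z fst snd hp => ?_⟩
  obtain ⟨φ, rfl⟩ := Spec.map_surjective y
  let : Algebra F L := φ.hom.toAlgebra
  have h1 := (CommRingCat.isPushout_tensorProduct F F' L).op.map Scheme.Spec
  have := h.isDomain_tensorProduct L
  have h2 : Z ≅ Spec (.of (F' ⊗[F] L)) := hp.isoIsPullback _ _ h1.flip
  have : Nonempty Z := ⟨h2.inv (Nonempty.some inferInstance)⟩
  exact isIntegral_of_isOpenImmersion h2.hom

theorem isIntegral_of_isPullback (h : IsExistentiallyClosed F F') (s : Y ⟶ Spec (.of F))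
    (H : IsPullback g s' s (specExtension F F')) [AlgebraicGeometry.IsIntegral Y]
    [IsLocallyNoetherian Y] : AlgebraicGeometry.IsIntegral Y' := by
  have := geometricallyIntegral_specExtension h
  have h1 : Flat (specExtension F F') := by rw [specExtension]; infer_instance
  have h2 : UniversallyOpen (specExtension F F') := by rw [specExtension]; infer_instance
  have h3 : GeometricallyIntegral g := MorphismProperty.of_isPullback H.flip this
  have h4 : Flat g := MorphismProperty.of_isPullback H.flip h1
  have h5 : UniversallyOpen g := MorphismProperty.of_isPullback H.flip h2
  exact GeometricallyIntegral.isIntegral_of_isLocallyNoetherian g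

theorem surjective_of_isPullback (H : IsPullback g s' s (specExtension F F')) :
    Function.Surjective g := by
  have h2 : Surjective (specExtension F F') := by rw [specExtension]; infer_instance
  have h5 : Surjective g := MorphismProperty.of_isPullback H.flip h2
  exact h5.surj

theorem isLocallyNoetherian_of_locallyOfFiniteType (s : Y ⟶ Spec (.of F)) [LocallyOfFiniteType s] :
    IsLocallyNoetherian Y :=
  LocallyOfFiniteType.isLocallyNoetherian s

theorem locallyOfFiniteType_of_isPullback (H : IsPullback g s' s (specExtension F F'))
    [LocallyOfFiniteType s] : LocallyOfFiniteType s' :=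
  MorphismProperty.of_isPullback H ‹_›

theorem finiteType_scalars (s : Y ⟶ Spec (.of F)) [LocallyOfFiniteType s] {U : Y.Opens}
    (hU : IsAffineOpen U) : (scalars s U).FiniteType := by
  have h1 := LocallyOfFiniteType.finiteType_appLE s (U := ⊤) (V := U) (isAffineOpen_top _) hU le_top
  rw [appLE_eq_ΓSpecIso_comp_scalars, CommRingCat.hom_comp, CommRingCat.hom_ofHom] at h1
  exact RingHom.FiniteType.of_comp_finiteType h1

end IntegralBaseChange

/-! ### Flat pullback of cycles along an existentially closed field extension -/

/-- `y` has no proper generizations in its fibre. -/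
def IsFiberMinimal {Y Y' : Scheme.{u}} (g : Y' ⟶ Y) (y : Y') : Prop :=
  ∀ y₁ : Y', y₁ ⤳ y → g y₁ = g y → y₁ = y

section FunctionField

variable {W W' : Scheme.{u}} [AlgebraicGeometry.IsIntegral W] [AlgebraicGeometry.IsIntegral W']
  {g : W' ⟶ W}

theorem map_genericPoint (hg : Function.Surjective g) : g (genericPoint W') = genericPoint W := by
  have h := (genericPoint_spec W').image g.continuous
  rw [Set.image_univ, hg.range_eq, closure_univ] at h
  exact h.eq (genericPoint_spec W)

/-- The map of function fields induced by a surjective morphism. -/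
def functionFieldMap (g : W' ⟶ W) (hg : Function.Surjective g) :
    W.functionField ⟶ W'.functionField :=
  W.presheaf.stalkSpecializes (specializes_of_eq (map_genericPoint hg)) ≫ g.stalkMap _

theorem functionFieldMap_germToFunctionField (hg : Function.Surjective g) (U : W.Opens)
    [Nonempty U] [Nonempty (g ⁻¹ᵁ U)] (a : Γ(W, U)) :
    functionFieldMap g hg (W.germToFunctionField U a) =
      W'.germToFunctionField (g ⁻¹ᵁ U) (g.app U a) := by
  have h : W.germToFunctionField U ≫ functionFieldMap g hg =
      g.app U ≫ W'.germToFunctionField (g ⁻¹ᵁ U) := by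
    rw [functionFieldMap, Scheme.germToFunctionField, TopCat.Presheaf.germ_stalkSpecializes_assoc,
      Scheme.Hom.germ_stalkMap]
  exact congrArg (fun φ : _ ⟶ _ => CommRingCat.Hom.hom φ a) h

end FunctionField

section Comparison

variable {F F' : Type u} [Field F] [Field F'] [Algebra F F'] {Y Y' : Scheme.{u}}
  {s : Y ⟶ Spec (.of F)} {s' : Y' ⟶ Spec (.of F')} {g : Y' ⟶ Y}
  (h : IsExistentiallyClosed F F') (H : IsPullback g s' s (specExtension F F'))

include h H in
theorem isPrime_map_primeIdealOf {U : Y.Opens} (hU : IsAffineOpen U) (p : Ideal Γ(Y, U))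
    [p.IsPrime] : (p.map (g.app U).hom).IsPrime ∧ (p.map (g.app U).hom).comap (g.app U).hom = p := by
  let := (scalars s U).toAlgebra
  let := (g.app U).hom.toAlgebra
  obtain ⟨e, he, -⟩ := exists_tensorEquiv H hU
  exact ⟨isPrime_map e he h p, comap_map_eq e he p⟩

include h H in
theorem isFiberMinimal_iff {U : Y.Opens} (hU : IsAffineOpen U) (hU' : IsAffineOpen (g ⁻¹ᵁ U))
    {y : Y'} (hy : g y ∈ U) : IsFiberMinimal g y ↔
      (hU.primeIdealOf ⟨g y, hy⟩).asIdeal.map (g.app U).hom =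
        (hU'.primeIdealOf ⟨y, hy⟩).asIdeal := by
  have hcomap : ∀ (y₁ : Y') (hy₁ : g y₁ ∈ U), (hU'.primeIdealOf ⟨y₁, hy₁⟩).asIdeal.comap
      (g.app U).hom = (hU.primeIdealOf ⟨g y₁, hy₁⟩).asIdeal := by
    intro y₁ hy₁
    have := IsAffineOpen.comap_primeIdealOf_appLE (f := g) U hU (g ⁻¹ᵁ U) hU' le_rfl hy₁
    rw [← Scheme.Hom.app_eq_appLE] at this
    exact congrArg PrimeSpectrum.asIdeal this
  obtain ⟨hp1, hp2⟩ := isPrime_map_primeIdealOf h H hU (hU.primeIdealOf ⟨g y, hy⟩).asIdeal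
  have hle : (hU.primeIdealOf ⟨g y, hy⟩).asIdeal.map (g.app U).hom ≤
      (hU'.primeIdealOf ⟨y, hy⟩).asIdeal := by
    rw [Ideal.map_le_iff_le_comap, hcomap]
  constructor
  · intro hmin
    let P : PrimeSpectrum Γ(Y', g ⁻¹ᵁ U) := ⟨_, hp1⟩
    have hP := primeIdealOf_fromSpec hU' P
    have hy₁ := fromSpec_mem hU' P
    have h1 : hU'.fromSpec P ⤳ y := by
      rw [specializes_iff_primeIdealOf_le hU' hy₁ hy, hP]
      exact hle
    have h2 : g (hU'.fromSpec P) = g y := by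
      have h3 := hcomap _ hy₁
      rw [hP, hp2] at h3
      exact congrArg Subtype.val (primeIdealOf_injective hU (PrimeSpectrum.ext h3)).symm
    have h3 := hmin _ h1 h2
    have h4 : hU'.primeIdealOf ⟨y, hy⟩ = P := by
      rw [← hP]
      congr 2
      exact h3.symm
    rw [h4]
  · intro heq y₁ hy₁ hgy
    have hy₁' : g y₁ ∈ U := hgy ▸ hy
    have h1 := (specializes_iff_primeIdealOf_le hU' hy₁' hy).mp hy₁
    have h2 : (hU'.primeIdealOf ⟨y, hy⟩).asIdeal ≤ (hU'.primeIdealOf ⟨y₁, hy₁'⟩).asIdeal := by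
      rw [← heq, Ideal.map_le_iff_le_comap, hcomap]
      have : (⟨g y₁, hy₁'⟩ : U) = ⟨g y, hy⟩ := Subtype.ext hgy
      rw [this]
    exact congrArg Subtype.val (primeIdealOf_injective hU' (PrimeSpectrum.ext (le_antisymm h1 h2)))

open Classical in
include h in
/-- Orders of vanishing are preserved by base change. -/
theorem ord_functionFieldMap [LocallyOfFiniteType s] [AlgebraicGeometry.IsIntegral Y]
    [IsLocallyNoetherian Y] [AlgebraicGeometry.IsIntegral Y'] [IsLocallyNoetherian Y']
    (H : IsPullback g s' s (specExtension F F')) {f : Y.functionField} (hf : f ≠ 0) (y : Y') :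
    Scheme.ord (functionFieldMap g (surjective_of_isPullback H) f) y =
      if IsFiberMinimal g y then Scheme.ord f (g y) else 0 := by
  have := isAffineHom_of_isPullback H
  obtain ⟨U, hU, hy, -⟩ := exists_isAffineOpen_mem_and_subset (U := ⊤) (x := g y) trivial
  have hU' : IsAffineOpen (g ⁻¹ᵁ U) := hU.preimage g
  have hy' : y ∈ g ⁻¹ᵁ U := hy
  have : Nonempty U := ⟨⟨_, hy⟩⟩
  have : Nonempty (g ⁻¹ᵁ U) := ⟨⟨y, hy⟩⟩
  obtain ⟨a, b, hb, hab⟩ := exists_eq_div hU f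
  have ha := ne_zero_of_div hf hb hab
  have hab' : functionFieldMap g (surjective_of_isPullback H) f *
      Y'.germToFunctionField (g ⁻¹ᵁ U) (g.app U b) =
        Y'.germToFunctionField (g ⁻¹ᵁ U) (g.app U a) := by
    rw [← functionFieldMap_germToFunctionField (surjective_of_isPullback H),
      ← functionFieldMap_germToFunctionField (surjective_of_isPullback H), ← map_mul, hab]
  have := isNoetherianRing_of_isAffineOpen hU
  have hft := finiteType_scalars s hU
  let := (scalars s U).toAlgebra
  have : Algebra.FiniteType F Γ(Y, U) := hft
  let := (g.app U).hom.toAlgebra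
  obtain ⟨e, he, -⟩ := exists_tensorEquiv H hU
  have hflat := flat_of_tensorEquiv e he
  have hinj : ∀ c : Γ(Y, U), c ≠ 0 → g.app U c ≠ 0 := by
    intro c hc h0
    have h1 := comap_map_eq e he ⊥
    have h2 : c ∈ (Ideal.map (algebraMap Γ(Y, U) Γ(Y', g ⁻¹ᵁ U)) ⊥).comap
        (algebraMap Γ(Y, U) Γ(Y', g ⁻¹ᵁ U)) := by
      rw [Ideal.mem_comap, Ideal.map_bot]
      exact h0
    rw [h1] at h2
    exact hc h2
  have hcomap : (hU'.primeIdealOf ⟨y, hy⟩).asIdeal.comap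
      (g.app U).hom = (hU.primeIdealOf ⟨g y, hy⟩).asIdeal := by
    have := IsAffineOpen.comap_primeIdealOf_appLE (f := g) U hU (g ⁻¹ᵁ U) hU' le_rfl hy'
    rw [← Scheme.Hom.app_eq_appLE] at this
    exact congrArg PrimeSpectrum.asIdeal this
  have hP := isPrime_map e he h (hU.primeIdealOf ⟨g y, hy⟩).asIdeal
  have hPc := comap_map_eq e he (hU.primeIdealOf ⟨g y, hy⟩).asIdeal
  split_ifs with hmin
  · have hmin' : (hU.primeIdealOf ⟨g y, hy⟩).asIdeal.map (algebraMap Γ(Y, U) Γ(Y', g ⁻¹ᵁ U)) =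
        (hU'.primeIdealOf ⟨y, hy⟩).asIdeal := (isFiberMinimal_iff h H hU hU' hy).mp hmin
    have hht := height_eq_of_eq_map e he (hU.primeIdealOf ⟨g y, hy⟩).asIdeal
    rw [hmin', ← coheight_eq_height hU hy, ← coheight_eq_height hU' hy'] at hht
    by_cases h1 : coheight (g y) = 1
    · have key : ∀ c : Γ(Y, U), c ≠ 0 →
          lengthAt (hU'.primeIdealOf ⟨y, hy⟩).asIdeal (Γ(Y', g ⁻¹ᵁ U) ⧸ Ideal.span {g.app U c}) =
          lengthAt (hU.primeIdealOf ⟨g y, hy⟩).asIdeal (Γ(Y, U) ⧸ Ideal.span {c}) := by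
        intro c hc
        have h2 := lengthAt_quotient_map (A' := Γ(Y', g ⁻¹ᵁ U)) _ hPc (Ideal.span {c})
          (lengthAt_ne_top_of_coheight_le_one hU hy h1.le hc)
        rw [← h2, Ideal.map_span, Set.image_singleton]
        congr 1
        exact hmin'.symm
      have hfa := lengthAt_ne_top_of_coheight_le_one hU hy h1.le ha
      have hfb := lengthAt_ne_top_of_coheight_le_one hU hy h1.le hb
      rw [ord_eq_sub_lengthAt hU hy ha hb hab hfa hfb,
        ord_eq_sub_lengthAt hU' hy' (hinj a ha) (hinj b hb) hab' (by rwa [key a ha])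
          (by rwa [key b hb]), key a ha, key b hb]
    · rw [Scheme.ord_eq_zero_of_coheight_neq_one h1,
        Scheme.ord_eq_zero_of_coheight_neq_one (by rwa [hht])]
  · have hlt : (hU.primeIdealOf ⟨g y, hy⟩).asIdeal.map (algebraMap Γ(Y, U) Γ(Y', g ⁻¹ᵁ U)) <
        (hU'.primeIdealOf ⟨y, hy⟩).asIdeal := by
      refine lt_of_le_of_ne ?_ fun h' => hmin ((isFiberMinimal_iff h H hU hU' hy).mpr h')
      rw [Ideal.map_le_iff_le_comap]
      exact hcomap.ge
    have hht := height_lt_of_map_lt e he _ hP hlt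
    rw [← coheight_eq_height hU hy, ← coheight_eq_height hU' hy'] at hht
    by_cases h1 : coheight (g y) = 0
    · have hbot : (hU.primeIdealOf ⟨g y, hy⟩).asIdeal = ⊥ := by
        rw [coheight_eq_height hU hy] at h1
        have h4 : (hU.primeIdealOf ⟨g y, hy⟩).asIdeal.height ≤ (0 : ℕ) := by simp [h1]
        by_contra hq0
        exact absurd (Ideal.height_le_iff.mp h4 ⊥ inferInstance (bot_lt_iff_ne_bot.mpr hq0))
          (by simp)
      have hnot : ∀ c : Γ(Y, U), c ≠ 0 → g.app U c ∉ (hU'.primeIdealOf ⟨y, hy⟩).asIdeal := by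
        intro c hc h2
        have h3 : c ∈ (hU'.primeIdealOf ⟨y, hy⟩).asIdeal.comap (g.app U).hom := h2
        rw [hcomap, hbot] at h3
        exact hc h3
      exact ord_eq_zero_of_notMem hU' hy' hab' (hnot a ha) (hnot b hb)
    · refine Scheme.ord_eq_zero_of_coheight_neq_one (fun h2 => ?_) _
      rw [h2] at hht
      have h3 : 1 ≤ coheight (g y) := Order.one_le_iff_ne_zero.mpr h1
      have h4 := (add_le_add_left h3 1).trans hht
      exact absurd h4 (by decide)

end Comparison

section Pullback

variable {F F' : Type u} [Field F] [Field F'] [Algebra F F'] {Y Y' : Scheme.{u}}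
  {s : Y ⟶ Spec (.of F)} {s' : Y' ⟶ Spec (.of F')} {g : Y' ⟶ Y}
  (h : IsExistentiallyClosed F F') (H : IsPullback g s' s (specExtension F F'))

theorem isFiberMinimal_snd_iff {W : Scheme.{u}} (i : W ⟶ Y) (g : Y' ⟶ Y) [IsClosedImmersion i]
    (w : (pullback i g : Scheme.{u})) :
    IsFiberMinimal g (pullback.snd i g w) ↔ IsFiberMinimal (pullback.fst i g) w := by
  have hcond : ∀ w : (pullback i g : Scheme.{u}),
      i (pullback.fst i g w) = g (pullback.snd i g w) := fun w => by
    rw [← Scheme.Hom.comp_apply, pullback.condition, Scheme.Hom.comp_apply]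
  constructor
  · intro hmin w₁ hw₁ hg
    refine (pullback.snd i g).isClosedEmbedding.injective (hmin _ ?_ ?_)
    · exact hw₁.map (pullback.snd i g).continuous
    · rw [← hcond, ← hcond, hg]
  · intro hmin y₁ hy₁ hg
    have h1 : y₁ ∈ Set.range (pullback.snd i g) := by
      rw [Scheme.Pullback.range_snd, Set.mem_preimage, hg, ← hcond]
      exact ⟨_, rfl⟩
    obtain ⟨w₁, rfl⟩ := h1
    rw [hmin w₁ ((pullback.snd i g).isClosedEmbedding.isInducing.specializes_iff.mp hy₁) ?_]
    apply i.isClosedEmbedding.injective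
    rw [hcond, hcond, hg]

open Classical in
include h H in
theorem exists_flatPullback_of_isPrincipalCycle [LocallyOfFiniteType s] {z : AlgebraicCycle Y ℤ}
    (hz : IsPrincipalCycle Y z) : ∃ z' : AlgebraicCycle Y' ℤ, IsPrincipalCycle Y' z' ∧
      ∀ y, z' y = if IsFiberMinimal g y then z (g y) else 0 := by
  obtain ⟨W, _, _, i, _, f, hf, hz1, hz2⟩ := hz
  have H' : IsPullback (pullback.fst i g) (pullback.snd i g ≫ s') (i ≫ s) (specExtension F F') :=
    (IsPullback.of_hasPullback i g).flip.paste_horiz H.flip |>.flip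
  have := isIntegral_of_isPullback h (i ≫ s) H'
  have : LocallyOfFiniteType (pullback.snd i g ≫ s') := locallyOfFiniteType_of_isPullback H'
  have : IsLocallyNoetherian (pullback i g : Scheme.{u}) :=
    isLocallyNoetherian_of_locallyOfFiniteType (pullback.snd i g ≫ s')
  have hf' : functionFieldMap (pullback.fst i g) (surjective_of_isPullback H') f ≠ 0 :=
    (map_ne_zero_iff _ (RingHom.injective _)).mpr hf
  obtain ⟨z', hz', h1, h2⟩ := exists_isPrincipalCycle (pullback.snd i g) hf'
  refine ⟨z', hz', fun y => ?_⟩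
  by_cases hy : y ∈ Set.range (pullback.snd i g)
  · obtain ⟨w, rfl⟩ := hy
    rw [h1, ord_functionFieldMap h H' hf]
    congr 1
    · exact propext (isFiberMinimal_snd_iff i g w).symm
    · rw [← hz1, ← Scheme.Hom.comp_apply, pullback.condition, Scheme.Hom.comp_apply]
  · rw [h2 y hy]
    rw [Scheme.Pullback.range_snd] at hy
    rw [hz2 (g y) hy, ite_self]

open Classical in
include h H in
/-- Flat pullback preserves rational equivalence. -/
theorem exists_flatPullback_mem_rationalEquivalence [LocallyOfFiniteType s]
    {z : AlgebraicCycle Y ℤ} (hz : z ∈ rationalEquivalence Y) :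
    ∃ z' ∈ rationalEquivalence Y', ∀ y, z' y = if IsFiberMinimal g y then z (g y) else 0 := by
  induction hz using AddSubgroup.closure_induction with
  | mem z hz =>
    obtain ⟨z', hz', h1⟩ := exists_flatPullback_of_isPrincipalCycle h H hz
    exact ⟨z', AddSubgroup.subset_closure hz', h1⟩
  | zero => exact ⟨0, zero_mem _, fun y => by simp⟩
  | add z₁ z₂ _ _ h₁ h₂ =>
    obtain ⟨z₁', hz₁, h₁⟩ := h₁
    obtain ⟨z₂', hz₂, h₂⟩ := h₂
    refine ⟨z₁' + z₂', add_mem hz₁ hz₂, fun y => ?_⟩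
    rw [Function.locallyFinsuppWithin.coe_add, Function.locallyFinsuppWithin.coe_add, Pi.add_apply,
      Pi.add_apply, h₁, h₂]
    split_ifs <;> simp
  | neg z _ h₁ =>
    obtain ⟨z₁', hz₁, h₁⟩ := h₁
    refine ⟨-z₁', neg_mem hz₁, fun y => ?_⟩
    rw [Function.locallyFinsuppWithin.coe_neg, Function.locallyFinsuppWithin.coe_neg, Pi.neg_apply,
      Pi.neg_apply, h₁]
    split_ifs <;> simp

end Pullback

/-! ### Points in the Chow group -/

open Classical in
theorem smul_pointClass_sub_eq_zero_iff {Y : Scheme.{u}} (n : ℕ) (p q : Y) :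
    n • (pointClass p - pointClass q) = 0 ↔ ∃ z ∈ rationalEquivalence Y, ∀ y, z y =
      n * ((if y = p then 1 else 0) - (if y = q then 1 else 0)) := by
  let z₀ : AlgebraicCycle Y ℤ := n • (Function.locallyFinsuppWithin.single p (1 : ℤ) -
    Function.locallyFinsuppWithin.single q (1 : ℤ))
  have h0 : ∀ y, z₀ y = n * ((if y = p then 1 else 0) - (if y = q then 1 else 0)) := fun y => by
    simp only [z₀, Function.locallyFinsuppWithin.coe_nsmul, Function.locallyFinsuppWithin.coe_sub,
      Pi.smul_apply, Pi.sub_apply, Function.locallyFinsuppWithin.single_apply, nsmul_eq_mul]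
  have h1 : n • (pointClass p - pointClass q) = (QuotientAddGroup.mk z₀ : ChowGroup Y) := rfl
  rw [h1, QuotientAddGroup.eq_zero_iff]
  refine ⟨fun hz => ⟨z₀, hz, h0⟩, ?_⟩
  rintro ⟨z, hz, h2⟩
  have h3 : z = z₀ := Function.locallyFinsuppWithin.ext fun y => (h2 y).trans (h0 y).symm
  exact h3 ▸ hz

open Classical in
theorem smul_pointClass_sub_eq_zero_of_isPullback {F F' : Type u} [Field F] [Field F']
    [Algebra F F'] {Y Y' : Scheme.{u}} {s : Y ⟶ Spec (.of F)} {s' : Y' ⟶ Spec (.of F')}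
    {g : Y' ⟶ Y} (h : IsExistentiallyClosed F F') (H : IsPullback g s' s (specExtension F F'))
    [LocallyOfFiniteType s] {p q : Y} {p' q' : Y'} (hp : ∀ y, g y = p ↔ y = p')
    (hq : ∀ y, g y = q ↔ y = q') {n : ℕ} (hn : n • (pointClass p - pointClass q) = 0) :
    n • (pointClass p' - pointClass q') = 0 := by
  rw [smul_pointClass_sub_eq_zero_iff] at hn ⊢
  obtain ⟨z, hz, h1⟩ := hn
  obtain ⟨z', hz', h2⟩ := exists_flatPullback_mem_rationalEquivalence h H hz
  refine ⟨z', hz', fun y => ?_⟩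
  rw [h2, h1]
  simp only [hp, hq]
  have hmin : ∀ (x : Y) (x' : Y'), (∀ y, g y = x ↔ y = x') → IsFiberMinimal g x' := by
    intro x x' hx y₁ _ hy₁
    rw [(hx x').mpr rfl] at hy₁
    exact (hx y₁).mp hy₁
  split_ifs with hm hyp hyq hyq hyp hyq hyq
  · rfl
  · rfl
  · rfl
  · rfl
  · exact absurd (hyp ▸ hmin p p' hp) hm
  · exact absurd (hyp ▸ hmin p p' hp) hm
  · exact absurd (hyq ▸ hmin q q' hq) hm
  · simp

/-! ### The reduced closure of a point -/

section Closure

variable {Y : Scheme.{u}}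

theorem exists_integral_closure (v : Y) : ∃ (W : Scheme.{u}) (_ : AlgebraicGeometry.IsIntegral W)
    (i : W ⟶ Y) (_ : IsClosedImmersion i), i (genericPoint W) = v := by
  let f := Y.fromSpecResidueField v
  have hqc : QuasiCompact f := ⟨fun U _ _ => (Set.toFinite _).isCompact⟩
  have hint : AlgebraicGeometry.IsIntegral f.image := by
    refine ⟨⟨f.toImage (Nonempty.some inferInstance)⟩, fun U hU => ?_⟩
    obtain ⟨⟨x, hx⟩⟩ := hU
    obtain ⟨y, hy⟩ := f.toImage.denseRange.exists_mem_open U.isOpen ⟨x, hx⟩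
    have : Nonempty (f.toImage ⁻¹ᵁ U) := ⟨⟨y, hy⟩⟩
    refine Function.Injective.isDomain (f.toImage.app U).hom ?_
    refine (injective_iff_map_eq_zero _).mpr fun t ht => ?_
    refine TopCat.Presheaf.section_ext f.image.sheaf U t 0 fun x hx => ?_
    obtain ⟨_, ⟨_, ⟨V, hV, rfl⟩, rfl⟩, hxV, hVU⟩ := (Y.isBasis_affineOpens.of_isInducing
      f.imageι.isEmbedding.isInducing).exists_subset_of_mem_open hx U.isOpen
    have h1 : f.image.presheaf.map (homOfLE (show f.imageι ⁻¹ᵁ V ≤ U from hVU)).op t = 0 := by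
      apply f.toImage_app_injective ⟨V, hV⟩
      rw [map_zero]
      have h2 := congrArg (fun φ : _ ⟶ _ => CommRingCat.Hom.hom φ t)
        (f.toImage.naturality (homOfLE (show f.imageι ⁻¹ᵁ V ≤ U from hVU)).op)
      refine h2.trans ?_
      change (Spec (Y.residueField v)).presheaf.map _ (f.toImage.app U t) = 0
      rw [show f.toImage.app U t = 0 from ht, map_zero]
    have h2 := f.image.presheaf.germ_res_apply (homOfLE (show f.imageι ⁻¹ᵁ V ≤ U from hVU)) x hxV t
    rw [h1, map_zero] at h2
    rw [map_zero]
    exact h2.symm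
  refine ⟨f.image, hint, f.imageι, inferInstance, ?_⟩
  let o : Spec (Y.residueField v) := IsLocalRing.closedPoint (Y.residueField v)
  have h1 : IsGenericPoint (f.toImage o) (⊤ : Set f.image) := by
    rw [IsGenericPoint]
    have h2 := f.toImage.denseRange.closure_range
    have h3 : Set.range f.toImage = {f.toImage o} := by
      ext w
      constructor
      · rintro ⟨t, rfl⟩
        rw [Subsingleton.elim t o]
        rfl
      · rintro rfl
        exact ⟨_, rfl⟩
    rw [h3] at h2
    exact h2
  rw [(genericPoint_spec f.image).eq h1, ← Scheme.Hom.comp_apply, Scheme.Hom.toImage_imageι]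
  exact Scheme.fromSpecResidueField_apply v _

end Closure

section PointDivisor

/-- The isomorphism `S/f⁻¹(J) ≅ R/J` for a surjective homomorphism `f : S → R`. -/
def quotientComapEquiv {S R : Type*} [CommRing S] [CommRing R] [Algebra S R]
    (hSR : Function.Surjective (algebraMap S R)) (J : Ideal R) :
    (S ⧸ J.comap (algebraMap S R)) ≃ₗ[S] (R ⧸ J) :=
  (Submodule.quotEquivOfEq _ _ (Ideal.ext fun x =>
    (Ideal.Quotient.eq_zero_iff_mem (I := J) (a := algebraMap S R x)).symm)).trans
    ((Algebra.linearMap S (R ⧸ J)).quotKerEquivOfSurjective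
      (Ideal.Quotient.mk_surjective.comp hSR))

theorem lengthAt_quotient_comap {S R : Type*} [CommRing S] [CommRing R] [Algebra S R]
    (hSR : Function.Surjective (algebraMap S R)) (q : Ideal R) [q.IsPrime] (J : Ideal R) :
    lengthAt (q.comap (algebraMap S R)) (S ⧸ J.comap (algebraMap S R)) = lengthAt q (R ⧸ J) := by
  rw [← lengthAt_comap hSR]
  exact lengthAt_congr _ (quotientComapEquiv hSR J)

theorem comap_span_singleton {S R : Type*} [CommRing S] [CommRing R] [Algebra S R]
    (hSR : Function.Surjective (algebraMap S R)) (c : S) :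
    (Ideal.span {algebraMap S R c}).comap (algebraMap S R) =
      RingHom.ker (algebraMap S R) ⊔ Ideal.span {c} := by
  have h := Ideal.comap_map_of_surjective (algebraMap S R) hSR (Ideal.span {c})
  rw [Ideal.map_span, Set.image_singleton] at h
  rw [h, sup_comm]
  rfl

variable {Y : Scheme.{u}} [IsLocallyNoetherian Y]

/-- The principal cycle of the rational function on the closure of `v` given by a unit `u` of the
local ring at `v`. -/
theorem exists_isPrincipalCycle_of_unit (v : Y) {u : Y.presheaf.stalk v} (hu : IsUnit u) :
    ∃ z : AlgebraicCycle Y ℤ, IsPrincipalCycle Y z ∧ (∀ y, ¬ v ⤳ y → z y = 0) ∧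
      ∀ (U : Y.Opens) (hU : IsAffineOpen U) (hv : v ∈ U) (y : Y) (hy : y ∈ U), v ⤳ y →
      ∀ a b : Γ(Y, U), a ∉ (hU.primeIdealOf ⟨v, hv⟩).asIdeal →
        b ∉ (hU.primeIdealOf ⟨v, hv⟩).asIdeal →
        u * Y.presheaf.germ U v hv b - Y.presheaf.germ U v hv a ∈
          IsLocalRing.maximalIdeal (Y.presheaf.stalk v) →
        lengthAt (hU.primeIdealOf ⟨y, hy⟩).asIdeal
          (Γ(Y, U) ⧸ ((hU.primeIdealOf ⟨v, hv⟩).asIdeal ⊔ Ideal.span {a})) ≠ ⊤ →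
        lengthAt (hU.primeIdealOf ⟨y, hy⟩).asIdeal
          (Γ(Y, U) ⧸ ((hU.primeIdealOf ⟨v, hv⟩).asIdeal ⊔ Ideal.span {b})) ≠ ⊤ →
        z y = (lengthAt (hU.primeIdealOf ⟨y, hy⟩).asIdeal
            (Γ(Y, U) ⧸ ((hU.primeIdealOf ⟨v, hv⟩).asIdeal ⊔ Ideal.span {a}))).toNat -
          (lengthAt (hU.primeIdealOf ⟨y, hy⟩).asIdeal
            (Γ(Y, U) ⧸ ((hU.primeIdealOf ⟨v, hv⟩).asIdeal ⊔ Ideal.span {b}))).toNat := by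
  obtain ⟨W, _, i, _, hiv⟩ := exists_integral_closure v
  subst hiv
  have hloc : IsLocallyNoetherian W := LocallyOfFiniteType.isLocallyNoetherian i
  have hf0 : i.stalkMap (genericPoint W) u ≠ 0 := (hu.map (i.stalkMap (genericPoint W)).hom).ne_zero
  obtain ⟨z, hz, hz1, hz2⟩ := exists_isPrincipalCycle i (f := i.stalkMap (genericPoint W) u) hf0
  have hrange : ∀ y, y ∈ Set.range i ↔ i (genericPoint W) ⤳ y := by
    intro y
    constructor
    · rintro ⟨w, rfl⟩
      exact (genericPoint_specializes w).map i.continuous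
    · intro h
      exact i.isClosedEmbedding.isClosed_range.stableUnderSpecialization h ⟨_, rfl⟩
  refine ⟨z, hz, fun y hy => hz2 y fun h => hy ((hrange y).mp h), ?_⟩
  intro U hU hv y hy hvy a b ha hb hab hla hlb
  obtain ⟨w, rfl⟩ := (hrange y).mpr hvy
  have hU' : IsAffineOpen (i ⁻¹ᵁ U) := hU.preimage i
  have hw : w ∈ i ⁻¹ᵁ U := hy
  have hgen : genericPoint W ∈ i ⁻¹ᵁ U := hv
  have : Nonempty (i ⁻¹ᵁ U) := ⟨⟨w, hw⟩⟩
  have hcomap : ∀ (w : W) (hw : i w ∈ U), (hU'.primeIdealOf ⟨w, hw⟩).asIdeal.comap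
      (i.app U).hom = (hU.primeIdealOf ⟨i w, hw⟩).asIdeal := by
    intro w hw
    have := IsAffineOpen.comap_primeIdealOf_appLE (f := i) U hU (i ⁻¹ᵁ U) hU' le_rfl hw
    rw [← Scheme.Hom.app_eq_appLE] at this
    exact congrArg PrimeSpectrum.asIdeal this
  have hbot : (hU'.primeIdealOf ⟨genericPoint W, hgen⟩).asIdeal = ⊥ := by
    rw [IsAffineOpen.primeIdealOf_genericPoint hU', genericPoint_eq_bot_of_affine]
    rfl
  have hker : RingHom.ker (i.app U).hom = (hU.primeIdealOf ⟨i (genericPoint W), hv⟩).asIdeal := by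
    rw [← hcomap _ hv, hbot]
    rfl
  have hne : ∀ c : Γ(Y, U), c ∉ (hU.primeIdealOf ⟨i (genericPoint W), hv⟩).asIdeal →
      i.app U c ≠ 0 := fun c hc h0 => hc (hker ▸ h0)
  have hab' : i.stalkMap (genericPoint W) u * W.germToFunctionField (i ⁻¹ᵁ U) (i.app U b) =
      W.germToFunctionField (i ⁻¹ᵁ U) (i.app U a) := by
    have h1 : i.stalkMap (genericPoint W) (u * Y.presheaf.germ U _ hv b -
        Y.presheaf.germ U _ hv a) = 0 := by
      by_contra hne
      exact hab (isUnit_of_map_unit (i.stalkMap (genericPoint W)).hom _ (IsUnit.mk0 _ hne))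
    rw [map_sub, map_mul, Scheme.Hom.germ_stalkMap_apply, Scheme.Hom.germ_stalkMap_apply,
      sub_eq_zero] at h1
    exact h1
  let := (i.app U).hom.toAlgebra
  have hsurj : Function.Surjective (algebraMap Γ(Y, U) Γ(W, i ⁻¹ᵁ U)) := i.app_surjective U hU
  have hlen : ∀ c : Γ(Y, U), lengthAt (hU'.primeIdealOf ⟨w, hw⟩).asIdeal
      (Γ(W, i ⁻¹ᵁ U) ⧸ Ideal.span {i.app U c}) = lengthAt (hU.primeIdealOf ⟨i w, hy⟩).asIdeal
      (Γ(Y, U) ⧸ ((hU.primeIdealOf ⟨i (genericPoint W), hv⟩).asIdeal ⊔ Ideal.span {c})) := by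
    intro c
    have h1 := lengthAt_quotient_comap hsurj (hU'.primeIdealOf ⟨w, hw⟩).asIdeal
      (Ideal.span {algebraMap Γ(Y, U) Γ(W, i ⁻¹ᵁ U) c})
    rw [comap_span_singleton hsurj] at h1
    refine h1.symm.trans ?_
    have h2 : (hU'.primeIdealOf ⟨w, hw⟩).asIdeal.comap (algebraMap Γ(Y, U) Γ(W, i ⁻¹ᵁ U)) =
      (hU.primeIdealOf ⟨i w, hy⟩).asIdeal := hcomap w hy
    have h3 : RingHom.ker (algebraMap Γ(Y, U) Γ(W, i ⁻¹ᵁ U)) =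
      (hU.primeIdealOf ⟨i (genericPoint W), hv⟩).asIdeal := hker
    simp only [h2]
    exact lengthAt_congr _ (Submodule.quotEquivOfEq _ _ (by rw [h3]))
  rw [hz1, ord_eq_sub_lengthAt hU' hw (hne a ha) (hne b hb) hab' (by rwa [hlen]) (by rwa [hlen]),
    hlen, hlen]

end PointDivisor

/-! ### Multiplicities of the components of a special fibre -/

section Multiplicity

variable {S : Type u} [CommRing S]

theorem isMaximal_of_finite_quotient (F : Type*) [Field F] [Algebra F S] {J y : Ideal S}
    [Module.Finite F (S ⧸ J)] [y.IsPrime] (h : J ≤ y) : y.IsMaximal := by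
  have : Module.Finite F (S ⧸ y) := Module.Finite.of_surjective
    ((Submodule.factor h).restrictScalars F) (Submodule.factor_surjective h)
  have : IsArtinianRing (S ⧸ y) := isArtinian_of_tower F inferInstance
  exact Ideal.Quotient.maximal_of_isField _ (IsArtinianRing.isField_of_isDomain _)

theorem lengthAt_quotient_ne_top (F : Type*) [Field F] [Algebra F S] (J : Ideal S)
    [Module.Finite F (S ⧸ J)] (y : PrimeSpectrum S) : lengthAt y.asIdeal (S ⧸ J) ≠ ⊤ := by
  by_cases hy : J ≤ y.asIdeal
  · obtain ⟨_, -, -, h1, -⟩ := exists_actionCharpoly_eq_prod F (T := S) _ (S ⧸ J) rfl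
    exact h1 y (isMaximal_of_finite_quotient F hy)
  · rw [lengthAt_quotient_eq_zero _ hy]
    exact ENat.zero_ne_top

theorem comap_sup_span_singleton {I : Ideal S} (v : Ideal (S ⧸ I)) (t : S) :
    (v ⊔ Ideal.span {Ideal.Quotient.mk I t}).comap (algebraMap S (S ⧸ I)) =
      v.comap (algebraMap S (S ⧸ I)) ⊔ Ideal.span {t} := by
  have hs : Function.Surjective (algebraMap S (S ⧸ I)) := Ideal.Quotient.mk_surjective
  have h := Ideal.comap_map_of_surjective _ hs (v.comap (algebraMap S (S ⧸ I)) ⊔ Ideal.span {t})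
  rw [Ideal.map_sup, Ideal.map_comap_of_surjective _ hs, Ideal.map_span, Set.image_singleton] at h
  exact h.trans (sup_eq_left.mpr (le_sup_of_le_left (Ideal.comap_mono bot_le)))

/-- The multiplicity formula for the divisor of a nonzerodivisor on a special fibre. -/
theorem lengthAt_quotient_sup_eq_sum [IsNoetherianRing S] (F : Type*) [Field F] [Algebra F S]
    {I : Ideal S} {t : S} (ht : ∀ x, t * x ∈ I → x ∈ I)
    [Module.Finite F (S ⧸ (I ⊔ Ideal.span {t}))] (y : PrimeSpectrum S)
    (V : Finset (PrimeSpectrum S)) (hV : ∀ v, v ∈ V ↔ v.asIdeal ∈ I.minimalPrimes) :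
    lengthAt y.asIdeal (S ⧸ (I ⊔ Ideal.span {t})) = ∑ v ∈ V, lengthAt v.asIdeal (S ⧸ I) *
      lengthAt y.asIdeal (S ⧸ (v.asIdeal ⊔ Ideal.span {t})) := by
  classical
  by_cases hy : I ⊔ Ideal.span {t} ≤ y.asIdeal
  swap
  · rw [lengthAt_quotient_eq_zero _ hy, Finset.sum_eq_zero fun v hv => ?_]
    rw [lengthAt_quotient_eq_zero y.asIdeal (fun h => hy ((sup_le_sup_right
      ((hV v).mp hv).1.2 _).trans h)), mul_zero]
  have hs : Function.Surjective (algebraMap S (S ⧸ I)) := Ideal.Quotient.mk_surjective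
  obtain ⟨y', rfl⟩ : ∃ y', PrimeSpectrum.comap (algebraMap S (S ⧸ I)) y' = y := by
    have : y ∈ Set.range (PrimeSpectrum.comap (algebraMap S (S ⧸ I))) := by
      rw [range_comap_of_surjective _ _ hs]
      change RingHom.ker (Ideal.Quotient.mk I) ≤ y.asIdeal
      rw [Ideal.mk_ker]
      exact le_sup_left.trans hy
    exact this
  let τ : S ⧸ I := Ideal.Quotient.mk I t
  have hnzd : ∀ x : S ⧸ I, τ * x = 0 → x = 0 := by
    intro x hx
    obtain ⟨x, rfl⟩ := Ideal.Quotient.mk_surjective x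
    rw [← map_mul, Ideal.Quotient.eq_zero_iff_mem] at hx
    exact Ideal.Quotient.eq_zero_iff_mem.mpr (ht x hx)
  have hty : τ ∈ y'.asIdeal := hy (Ideal.mem_sup_right (Ideal.mem_span_singleton_self t))
  have hmin : y'.asIdeal ∈ (Ideal.span {τ}).minimalPrimes := by
    refine ⟨⟨inferInstance, (Ideal.span_singleton_le_iff_mem _).mpr hty⟩, ?_⟩
    rintro q ⟨hq, hτq⟩ hqy
    have : (q.comap (algebraMap S (S ⧸ I))).IsMaximal := by
      refine isMaximal_of_finite_quotient F (J := I ⊔ Ideal.span {t}) (sup_le ?_ ?_)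
      · intro x hx
        rw [Ideal.mem_comap, Ideal.Quotient.algebraMap_eq, Ideal.Quotient.eq_zero_iff_mem.mpr hx]
        exact zero_mem _
      · rw [Ideal.span_singleton_le_iff_mem]
        exact hτq (Ideal.mem_span_singleton_self τ)
    have h1 := this.eq_of_le (y'.2.comap (algebraMap S (S ⧸ I))).ne_top (Ideal.comap_mono hqy)
    rw [← Ideal.map_comap_of_surjective _ hs y'.asIdeal, ← h1, Ideal.map_comap_of_surjective _ hs]
  have hht := Ideal.height_le_one_of_isPrincipal_of_mem_minimalPrimes _ _ hmin
  have hτ : ∀ v : PrimeSpectrum (S ⧸ I), v.asIdeal ∈ minimalPrimes (S ⧸ I) → τ ∉ v.asIdeal := by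
    intro v hv hτv
    refine notMem_nonZeroDivisors_of_mem_mem_minimalPrimes hτv hv
      (mem_nonZeroDivisors_iff_right.mpr fun x hx => ?_)
    rw [mul_comm] at hx
    exact hnzd x hx
  have hfin : {v : PrimeSpectrum (S ⧸ I) | v.asIdeal ∈ minimalPrimes (S ⧸ I)}.Finite :=
    (minimalPrimes.finite_of_isNoetherianRing (S ⧸ I)).preimage
      (Set.injOn_of_injective fun _ _ => PrimeSpectrum.ext)
  obtain ⟨hker, hcoker⟩ := cokerLengthAt_eq_sum y'.asIdeal τ (fun p hp hne => by
      by_contra hnot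
      obtain ⟨q, hq, hqp⟩ := Ideal.exists_minimalPrimes_le (bot_le : (⊥ : Ideal (S ⧸ I)) ≤ p.asIdeal)
      have := hq.1.1
      have hqp' : q < p.asIdeal := lt_of_le_of_ne hqp fun h => hnot (h ▸ hq)
      have h1 := Ideal.height_add_one_le_of_lt_of_isPrime hqp'
      have h2 := Ideal.height_add_one_le_of_lt_of_isPrime (lt_of_le_of_ne hp hne)
      have h3 : (1 : ℕ∞) + 1 ≤ 1 :=
        (add_le_add_left (le_add_self.trans h1) 1).trans (h2.trans hht)
      exact absurd h3 (by decide))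
    hfin.toFinset (fun v hv => hfin.mem_toFinset.mp hv) (fun v hv _ => hfin.mem_toFinset.mpr hv)
    (fun v hv _ => hτ v hv) (S ⧸ I)
  have hker0 : kerLengthAt y'.asIdeal τ (S ⧸ I) = 0 := by
    have : Subsingleton (LinearMap.ker (LinearMap.lsmul (S ⧸ I) (S ⧸ I) τ)) := by
      rw [Submodule.subsingleton_iff_eq_bot, LinearMap.ker_eq_bot']
      intro x hx
      exact hnzd x hx
    exact lengthAt_of_subsingleton _
  have hcoker' : cokerLengthAt y'.asIdeal τ (S ⧸ I) =
      lengthAt y'.asIdeal ((S ⧸ I) ⧸ (⊥ ⊔ Ideal.span {τ})) := by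
    refine lengthAt_congr _ (Submodule.quotEquivOfEq _ _ ?_)
    ext x
    rw [bot_sup_eq, Ideal.mem_span_singleton']
    constructor
    · rintro ⟨r, rfl⟩
      exact ⟨r, mul_comm _ _⟩
    · rintro ⟨r, rfl⟩
      exact ⟨r, mul_comm _ _⟩
  have hVimage : V = hfin.toFinset.image (PrimeSpectrum.comap (algebraMap S (S ⧸ I))) := by
    ext v
    rw [hV, Finset.mem_image, Ideal.minimalPrimes_eq_comap]
    constructor
    · rintro ⟨q, hq, hqv⟩
      exact ⟨⟨q, hq.1.1⟩, hfin.mem_toFinset.mpr hq, PrimeSpectrum.ext hqv⟩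
    · rintro ⟨q, hq, rfl⟩
      exact ⟨q.asIdeal, hfin.mem_toFinset.mp hq, rfl⟩
  have hLHS := lengthAt_quotient_comap hs y'.asIdeal (⊥ ⊔ Ideal.span {τ})
  rw [comap_sup_span_singleton] at hLHS
  have hbot : (⊥ : Ideal (S ⧸ I)).comap (algebraMap S (S ⧸ I)) = I := Ideal.mk_ker
  rw [hbot] at hLHS
  rw [hVimage, Finset.sum_image (Set.injOn_of_injective
    (PrimeSpectrum.comap_injective_of_surjective _ hs))]
  refine hLHS.trans ?_
  rw [← hcoker', hcoker, hker0, zero_add]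
  refine Finset.sum_congr rfl fun v _ => ?_
  rw [← lengthAt_comap hs v.asIdeal, ← lengthAt_quotient_comap hs y'.asIdeal,
    comap_sup_span_singleton]
  rfl

end Multiplicity

/-! ### Special fibres in terms of ring homomorphisms -/

section FiberIdeal

variable {F F' L : Type*} [Field F] [Field F'] [Field L] [Algebra F F'] [Algebra F' L]
  {B : Subalgebra F F'} (β : B →ₐ[F] F)

/-- The ideal of the special fibre in terms of the homomorphism `ψ : O → L`. -/
def fiberIdeal {O : Type*} [CommRing O] (ψ : O →+* L) : Ideal O :=
  letI := ψ.toAlgebra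
  specIdeal L β O

/-- Lifts to the special fibre in terms of the homomorphism `ψ : O → L`. -/
def IsFiberLift {O : Type*} [CommRing O] (ψ : O →+* L) (a : L) (x : O) : Prop :=
  letI := ψ.toAlgebra
  IsLift L β O a x

variable {β} {S O : Type*} [CommRing S] [CommRing O] {γ : S →+* O} {ψ : O →+* L} {ψ' : S →+* L}

theorem mem_fiberIdeal_of_map_eq_zero {x : O} (h : ψ x = 0) : x ∈ fiberIdeal β ψ := by
  let := ψ.toAlgebra
  have h1 : algebraMap O L x = 0 := h
  refine (mem_specIdeal β).mpr ?_
  rw [h1]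
  exact zero_mem _

theorem IsFiberLift.map (hψ : ψ.comp γ = ψ') {a : L} {x : S} (h : IsFiberLift β ψ' a x) :
    IsFiberLift β ψ a (γ x) := by
  let := γ.toAlgebra
  let := ψ.toAlgebra
  let := ψ'.toAlgebra
  have : IsScalarTower S O L := .of_algebraMap_eq' hψ.symm
  exact IsLift.map (L := L) (S := S) (O := O) h

theorem fiberIdeal_eq_map (hψ : ψ.comp γ = ψ') (W : Submonoid S)
    (hW : letI := γ.toAlgebra; IsLocalization W O) :
    fiberIdeal β ψ = (fiberIdeal β ψ').map γ := by
  let := γ.toAlgebra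
  let := ψ.toAlgebra
  let := ψ'.toAlgebra
  have : IsScalarTower S O L := .of_algebraMap_eq' hψ.symm
  exact specIdeal_eq_map L β S W

/-- Lifts of quotient representations of the same element agree on the special fibre. -/
theorem IsFiberLift.mul_sub_mul_mem {f a b a₀ b₀ : L} {x y x₀ y₀ : O} (hf : f * b = a)
    (hf₀ : f * b₀ = a₀) (hx : IsFiberLift β ψ a x) (hy : IsFiberLift β ψ b y)
    (hx₀ : IsFiberLift β ψ a₀ x₀) (hy₀ : IsFiberLift β ψ b₀ y₀) :
    x₀ * y - x * y₀ ∈ fiberIdeal β ψ := by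
  let := ψ.toAlgebra
  have h1 : IsLift L β O (a₀ * b) (x₀ * y) := IsLift.mul hx₀ hy
  have h2 : IsLift L β O (a * b₀) (x * y₀) := IsLift.mul hx hy₀
  have h3 : a₀ * b = a * b₀ := by rw [← hf, ← hf₀]; ring
  rw [h3] at h1
  exact h1.sub_mem_specIdeal h2

end FiberIdeal

/-! ### The specialization of a divisor -/

section Divisor

variable {F F' L : Type u} [Field F] [Field F'] [Field L] [Algebra F F'] [Algebra F' L]
  {B : Subalgebra F F'} (β : B →ₐ[F] F) {Y : Scheme.{u}} {ξ : Y} (φ : Y.presheaf.stalk ξ →+* L)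

/-- The homomorphism to `L` from the sections over a neighbourhood of `ξ`. -/
def sectionHom {U : Y.Opens} (hξ : ξ ∈ U) : Γ(Y, U) →+* L :=
  φ.comp (Y.presheaf.germ U ξ hξ).hom

/-- The homomorphism to `L` from the local ring at a specialization of `ξ`. -/
def stalkHom {v : Y} (h : ξ ⤳ v) : Y.presheaf.stalk v →+* L :=
  φ.comp (Y.presheaf.stalkSpecializes h).hom

theorem stalkHom_comp_germ {U : Y.Opens} {v : Y} (h : ξ ⤳ v) (hv : v ∈ U) :
    (stalkHom φ h).comp (Y.presheaf.germ U v hv).hom = sectionHom φ (h.mem_open U.isOpen hv) := by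
  rw [stalkHom, RingHom.comp_assoc, ← CommRingCat.hom_comp, TopCat.Presheaf.germ_stalkSpecializes]
  rfl

/-- The generic points of the special fibre. -/
def fiberComponents : Set Y :=
  {v | ∃ h : ξ ⤳ v, IsLocalRing.maximalIdeal (Y.presheaf.stalk v) ∈
    (fiberIdeal β (stalkHom φ h)).minimalPrimes}

theorem fiberIdeal_stalkHom {U : Y.Opens} (hU : IsAffineOpen U) {v : Y} (h : ξ ⤳ v) (hv : v ∈ U) :
    fiberIdeal β (stalkHom φ h) =
      (fiberIdeal β (sectionHom φ (h.mem_open U.isOpen hv))).map (Y.presheaf.germ U v hv).hom :=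
  fiberIdeal_eq_map (stalkHom_comp_germ φ h hv) _ (hU.isLocalization_stalk ⟨v, hv⟩)

theorem specializes_of_fiberIdeal_le [IsLocalHom φ] {U : Y.Opens} (hU : IsAffineOpen U)
    (hξ : ξ ∈ U) {v : Y} (hv : v ∈ U)
    (h : fiberIdeal β (sectionHom φ hξ) ≤ (hU.primeIdealOf ⟨v, hv⟩).asIdeal) : ξ ⤳ v := by
  rw [specializes_iff_primeIdealOf_le hU hξ hv]
  refine le_trans (fun x hx => ?_) h
  refine mem_fiberIdeal_of_map_eq_zero ?_
  by_contra hne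
  let := Y.presheaf.algebra_section_stalk ⟨ξ, hξ⟩
  have := hU.isLocalization_stalk ⟨ξ, hξ⟩
  have h1 : IsUnit (algebraMap Γ(Y, U) (Y.presheaf.stalk ξ) x) :=
    isUnit_of_map_unit φ _ (IsUnit.mk0 _ hne)
  exact (IsLocalization.AtPrime.isUnit_to_map_iff (Y.presheaf.stalk ξ)
    (hU.primeIdealOf ⟨ξ, hξ⟩).asIdeal x).mp h1 hx

theorem mem_fiberComponents_iff [IsLocalHom φ] {U : Y.Opens} (hU : IsAffineOpen U) (hξ : ξ ∈ U)
    {v : Y} (hv : v ∈ U) : v ∈ fiberComponents β φ ↔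
      (hU.primeIdealOf ⟨v, hv⟩).asIdeal ∈ (fiberIdeal β (sectionHom φ hξ)).minimalPrimes := by
  let := Y.presheaf.algebra_section_stalk ⟨v, hv⟩
  have := hU.isLocalization_stalk ⟨v, hv⟩
  have key : ∀ h : ξ ⤳ v, IsLocalRing.maximalIdeal (Y.presheaf.stalk v) ∈
      (fiberIdeal β (stalkHom φ h)).minimalPrimes ↔
      (hU.primeIdealOf ⟨v, hv⟩).asIdeal ∈ (fiberIdeal β (sectionHom φ hξ)).minimalPrimes := by
    intro h
    have h1 := IsLocalization.minimalPrimes_map (hU.primeIdealOf ⟨v, hv⟩).asIdeal.primeCompl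
      (Y.presheaf.stalk v) (fiberIdeal β (sectionHom φ hξ))
    have h2 := IsLocalization.AtPrime.under_maximalIdeal (Y.presheaf.stalk v)
      (hU.primeIdealOf ⟨v, hv⟩).asIdeal
    have h3 := fiberIdeal_stalkHom β φ hU h hv
    rw [h3]
    refine (Set.ext_iff.mp h1 _).trans ?_
    rw [Set.mem_preimage]
    exact iff_of_eq (congrArg (· ∈ _) h2)
  constructor
  · rintro ⟨h, hmin⟩
    exact (key h).mp hmin
  · intro hmin
    have h := specializes_of_fiberIdeal_le β φ hU hξ hv hmin.1.2
    exact ⟨h, (key h).mpr hmin⟩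

theorem notMem_of_mem_minimalPrimes {S : Type*} [CommRing S] {I v : Ideal S} {t : S}
    (ht : ∀ x, t * x ∈ I → x ∈ I) (hv : v ∈ I.minimalPrimes) : t ∉ v := by
  rw [Ideal.minimalPrimes_eq_comap] at hv
  obtain ⟨q, hq, rfl⟩ := hv
  intro h
  refine notMem_nonZeroDivisors_of_mem_mem_minimalPrimes (Ideal.mem_comap.mp h) hq
    (mem_nonZeroDivisors_iff_right.mpr fun x hx => ?_)
  obtain ⟨x, rfl⟩ := Ideal.Quotient.mk_surjective x
  rw [mul_comm, ← map_mul, Ideal.Quotient.eq_zero_iff_mem] at hx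
  exact Ideal.Quotient.eq_zero_iff_mem.mpr (ht x hx)

/-- `x` is an equation over `U`, on the special fibre, of the limit of the divisor of `a`. -/
structure IsFiberEquation (s : Y ⟶ Spec (.of F)) {U : Y.Opens} (hξ : ξ ∈ U) (a : L)
    (x : Γ(Y, U)) : Prop where
  isFiberLift : IsFiberLift β (sectionHom φ hξ) a x
  mem_of_mul_mem : ∀ t, x * t ∈ fiberIdeal β (sectionHom φ hξ) → t ∈ fiberIdeal β (sectionHom φ hξ)
  finite : letI := (scalars s U).toAlgebra
    Module.Finite F (Γ(Y, U) ⧸ (fiberIdeal β (sectionHom φ hξ) ⊔ Ideal.span {x}))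

variable {β φ} in
theorem IsFiberEquation.lengthAt_ne_top {s : Y ⟶ Spec (.of F)} {U : Y.Opens} {hξ : ξ ∈ U} {a : L}
    {x : Γ(Y, U)} (h : IsFiberEquation β φ s hξ a x) (y : PrimeSpectrum Γ(Y, U)) :
    lengthAt y.asIdeal (Γ(Y, U) ⧸ (fiberIdeal β (sectionHom φ hξ) ⊔ Ideal.span {x})) ≠ ⊤ := by
  let := (scalars s U).toAlgebra
  have := h.finite
  exact lengthAt_quotient_ne_top F _ y

variable [IsLocallyNoetherian Y] [IsLocalHom φ] {ι : Type*} {U : ι → Y.Opens}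
  (hU : ∀ j, IsAffineOpen (U j)) {s : Y ⟶ Spec (.of F)} {f : L} {a b : ι → L}
  {x x' : ∀ j, Γ(Y, U j)} (hf : ∀ j, f * b j = a j)
  (hx : ∀ j (hξ : ξ ∈ U j), IsFiberEquation β φ s hξ (a j) (x j))
  (hx' : ∀ j (hξ : ξ ∈ U j), IsFiberEquation β φ s hξ (b j) (x' j))

include hf hx hx' in
theorem exists_component_divisor (hcov : ∀ y, ∃ j, y ∈ U j) {v : Y} (hv : v ∈ fiberComponents β φ) :
    ∃ z ∈ rationalEquivalence Y, (∀ y, ¬ v ⤳ y → z y = 0) ∧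
      ∀ (j : ι) (hvU : v ∈ U j) (hξ : ξ ∈ U j) (y : Y) (hy : y ∈ U j),
      z y = (lengthAt ((hU j).primeIdealOf ⟨v, hvU⟩).asIdeal
          (Γ(Y, U j) ⧸ fiberIdeal β (sectionHom φ hξ))).toNat *
        ((lengthAt ((hU j).primeIdealOf ⟨y, hy⟩).asIdeal
          (Γ(Y, U j) ⧸ (((hU j).primeIdealOf ⟨v, hvU⟩).asIdeal ⊔ Ideal.span {x j}))).toNat -
        (lengthAt ((hU j).primeIdealOf ⟨y, hy⟩).asIdeal
          (Γ(Y, U j) ⧸ (((hU j).primeIdealOf ⟨v, hvU⟩).asIdeal ⊔ Ideal.span {x' j}))).toNat : ℤ) := by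
  obtain ⟨l, hvl⟩ := hcov v
  have hspec : ξ ⤳ v := hv.1
  have hξl : ξ ∈ U l := hspec.mem_open (U l).isOpen hvl
  have hnot : ∀ j (hvj : v ∈ U j) (hξ : ξ ∈ U j),
      x j ∉ ((hU j).primeIdealOf ⟨v, hvj⟩).asIdeal ∧
      x' j ∉ ((hU j).primeIdealOf ⟨v, hvj⟩).asIdeal := by
    intro j hvj hξ
    have hmin := (mem_fiberComponents_iff β φ (hU j) hξ hvj).mp hv
    exact ⟨notMem_of_mem_minimalPrimes (hx j hξ).mem_of_mul_mem hmin,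
      notMem_of_mem_minimalPrimes (hx' j hξ).mem_of_mul_mem hmin⟩
  have hunit : ∀ j (hvj : v ∈ U j) (c : Γ(Y, U j)),
      c ∉ ((hU j).primeIdealOf ⟨v, hvj⟩).asIdeal → IsUnit (Y.presheaf.germ (U j) v hvj c) := by
    intro j hvj c hc
    let := Y.presheaf.algebra_section_stalk ⟨v, hvj⟩
    have := (hU j).isLocalization_stalk ⟨v, hvj⟩
    exact (IsLocalization.AtPrime.isUnit_to_map_iff (Y.presheaf.stalk v)
      ((hU j).primeIdealOf ⟨v, hvj⟩).asIdeal c).mpr hc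
  obtain ⟨w, hw⟩ := hunit l hvl _ (hnot l hvl hξl).2
  have hu : IsUnit (Y.presheaf.germ (U l) v hvl (x l) * ↑w⁻¹) :=
    (hunit l hvl _ (hnot l hvl hξl).1).mul w⁻¹.isUnit
  obtain ⟨z, hz, hz0, hz1⟩ := exists_isPrincipalCycle_of_unit v hu
  have hz' : z ∈ rationalEquivalence Y := AddSubgroup.subset_closure hz
  let m := (Module.length (Y.presheaf.stalk v)
    (Y.presheaf.stalk v ⧸ fiberIdeal β (stalkHom φ hspec))).toNat
  refine ⟨m • z, nsmul_mem hz' m, fun y hy => ?_, ?_⟩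
  · rw [Function.locallyFinsuppWithin.coe_nsmul, Pi.smul_apply, hz0 y hy, smul_zero]
  intro j hvj hξ y hy
  have hm : m = (lengthAt ((hU j).primeIdealOf ⟨v, hvj⟩).asIdeal
      (Γ(Y, U j) ⧸ fiberIdeal β (sectionHom φ hξ))).toNat := by
    let := Y.presheaf.algebra_section_stalk ⟨v, hvj⟩
    have := (hU j).isLocalization_stalk ⟨v, hvj⟩
    rw [← length_quotient_map_eq_lengthAt _ (Y.presheaf.stalk v)]
    have h3 := fiberIdeal_stalkHom β φ (hU j) hspec hvj
    simp only [m]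
    rw [h3]
    rfl
  rw [Function.locallyFinsuppWithin.coe_nsmul, Pi.smul_apply, nsmul_eq_mul, hm]
  congr 1
  by_cases hvy : v ⤳ y
  · have hI := ((mem_fiberComponents_iff β φ (hU j) hξ hvj).mp hv).1.2
    refine hz1 (U j) (hU j) hvj y hy hvy (x j) (x' j) (hnot j hvj hξ).1 (hnot j hvj hξ).2 ?_ ?_ ?_
    · have h1 := IsFiberLift.mul_sub_mul_mem (hf j) (hf l)
        ((hx j hξ).isFiberLift.map (stalkHom_comp_germ φ hspec hvj))
        ((hx' j hξ).isFiberLift.map (stalkHom_comp_germ φ hspec hvj))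
        ((hx l hξl).isFiberLift.map (stalkHom_comp_germ φ hspec hvl))
        ((hx' l hξl).isFiberLift.map (stalkHom_comp_germ φ hspec hvl))
      have h2 := Ideal.mul_mem_left _ (↑w⁻¹ : Y.presheaf.stalk v) (hv.2.1.2 h1)
      convert h2 using 1
      have h3 : (↑w⁻¹ : Y.presheaf.stalk v) * Y.presheaf.germ (U l) v hvl (x' l) = 1 := by
        rw [← hw, Units.inv_mul]
      linear_combination (-Y.presheaf.germ (U j) v hvj (x j)) * (-h3)
    · exact ne_top_of_le_ne_top ((hx j hξ).lengthAt_ne_top _)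
        (lengthAt_quotient_anti _ (sup_le_sup_right hI _))
    · exact ne_top_of_le_ne_top ((hx' j hξ).lengthAt_ne_top _)
        (lengthAt_quotient_anti _ (sup_le_sup_right hI _))
  · have h0 : ∀ c, lengthAt ((hU j).primeIdealOf ⟨y, hy⟩).asIdeal
        (Γ(Y, U j) ⧸ (((hU j).primeIdealOf ⟨v, hvj⟩).asIdeal ⊔ Ideal.span {c})) = 0 := fun c =>
      lengthAt_quotient_eq_zero _ fun h => hvy
        ((specializes_iff_primeIdealOf_le (hU j) hvj hy).mpr (le_sup_left.trans h))
    rw [hz0 y hvy, h0, h0]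
    simp

include hU hf hx hx' in
/-- The limit of the divisor of `f` is a sum of principal cycles. -/
theorem exists_specialized_divisor [Finite ι] (hcov : ∀ y, ∃ j, y ∈ U j) :
    ∃ z ∈ rationalEquivalence Y, ∀ (j : ι) (y : Y) (hy : y ∈ U j),
      (ξ ∉ U j → z y = 0) ∧ ∀ hξ : ξ ∈ U j,
      z y = (lengthAt ((hU j).primeIdealOf ⟨y, hy⟩).asIdeal
          (Γ(Y, U j) ⧸ (fiberIdeal β (sectionHom φ hξ) ⊔ Ideal.span {x j}))).toNat -
        (lengthAt ((hU j).primeIdealOf ⟨y, hy⟩).asIdeal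
          (Γ(Y, U j) ⧸ (fiberIdeal β (sectionHom φ hξ) ⊔ Ideal.span {x' j}))).toNat := by
  classical
  have hmin : ∀ j (hξ : ξ ∈ U j), {P : PrimeSpectrum Γ(Y, U j) |
      P.asIdeal ∈ (fiberIdeal β (sectionHom φ hξ)).minimalPrimes}.Finite := by
    intro j hξ
    have := isNoetherianRing_of_isAffineOpen (hU j)
    exact (Ideal.finite_minimalPrimes_of_isNoetherianRing _ _).preimage
      (Set.injOn_of_injective fun _ _ => PrimeSpectrum.ext)
  have hVfin : (fiberComponents β φ).Finite := by
    refine Set.Finite.subset (s := ⋃ j, ⋃ hξ : ξ ∈ U j, (hU j).fromSpec '' {P |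
      P.asIdeal ∈ (fiberIdeal β (sectionHom φ hξ)).minimalPrimes})
      (Set.finite_iUnion fun j => Set.finite_iUnion fun hξ => (hmin j hξ).image _) ?_
    intro v hv
    obtain ⟨j, hvj⟩ := hcov v
    have hξ : ξ ∈ U j := hv.1.mem_open (U j).isOpen hvj
    exact Set.mem_iUnion₂.mpr ⟨j, hξ, (hU j).primeIdealOf ⟨v, hvj⟩,
      (mem_fiberComponents_iff β φ (hU j) hξ hvj).mp hv, (hU j).fromSpec_primeIdealOf _⟩
  choose D hD hD0 hD1 using fun v : fiberComponents β φ =>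
    exists_component_divisor β φ hU hf hx hx' hcov v.2
  let D' : Y → AlgebraicCycle Y ℤ := fun v => if h : v ∈ fiberComponents β φ then D ⟨v, h⟩ else 0
  have hD' : ∀ v (h : v ∈ fiberComponents β φ), D' v = D ⟨v, h⟩ := fun v h => dif_pos h
  refine ⟨∑ v ∈ hVfin.toFinset, D' v, sum_mem fun v hv => ?_, fun j y hy => ?_⟩
  · rw [hD' v (hVfin.mem_toFinset.mp hv)]
    exact hD _
  have hsum : (∑ v ∈ hVfin.toFinset, D' v) y = ∑ v ∈ hVfin.toFinset, D' v y := by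
    rw [Function.locallyFinsuppWithin.coe_sum, Finset.sum_apply]
  rw [hsum]
  constructor
  · intro hξ
    refine Finset.sum_eq_zero fun v hv => ?_
    have hv' := hVfin.mem_toFinset.mp hv
    rw [hD' v hv']
    exact hD0 ⟨v, hv'⟩ y fun h =>
      hξ (hv'.1.mem_open (U j).isOpen (h.mem_open (U j).isOpen hy))
  · intro hξ
    let := (scalars s (U j)).toAlgebra
    have := isNoetherianRing_of_isAffineOpen (hU j)
    have key : ∀ (c : L) (t : Γ(Y, U j)), IsFiberEquation β φ s hξ c t →
        ((lengthAt ((hU j).primeIdealOf ⟨y, hy⟩).asIdeal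
          (Γ(Y, U j) ⧸ (fiberIdeal β (sectionHom φ hξ) ⊔ Ideal.span {t}))).toNat : ℤ) =
        ∑ P ∈ (hmin j hξ).toFinset, ((lengthAt P.asIdeal
            (Γ(Y, U j) ⧸ fiberIdeal β (sectionHom φ hξ))).toNat : ℤ) *
          (lengthAt ((hU j).primeIdealOf ⟨y, hy⟩).asIdeal
            (Γ(Y, U j) ⧸ (P.asIdeal ⊔ Ideal.span {t}))).toNat := by
      intro c t ht
      have := ht.finite
      have h1 := lengthAt_quotient_sup_eq_sum F ht.mem_of_mul_mem
        ((hU j).primeIdealOf ⟨y, hy⟩) (hmin j hξ).toFinset (fun P => (hmin j hξ).mem_toFinset)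
      have h2 := ht.lengthAt_ne_top ((hU j).primeIdealOf ⟨y, hy⟩)
      rw [h1] at h2 ⊢
      rw [ENat.toNat_sum fun P hP => (WithTop.sum_ne_top.mp h2) P hP]
      simp only [ENat.toNat_mul, Nat.cast_sum, Nat.cast_mul]
    rw [key _ _ (hx j hξ), key _ _ (hx' j hξ), ← Finset.sum_sub_distrib]
    have hfilter : ∑ v ∈ hVfin.toFinset, D' v y =
        ∑ v ∈ hVfin.toFinset.filter (· ∈ U j), D' v y := by
      refine (Finset.sum_filter_of_ne fun v hv hne => ?_).symm
      by_contra hvU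
      have hv' := hVfin.mem_toFinset.mp hv
      rw [hD' v hv'] at hne
      exact hne (hD0 ⟨v, hv'⟩ y fun h => hvU (h.mem_open (U j).isOpen hy))
    rw [hfilter]
    symm
    refine Finset.sum_nbij (hU j).fromSpec (fun P hP => ?_) ?_ ?_ (fun P hP => ?_)
    · have hP' := (hmin j hξ).mem_toFinset.mp hP
      rw [Finset.mem_filter, hVfin.mem_toFinset]
      refine ⟨?_, fromSpec_mem (hU j) P⟩
      rw [mem_fiberComponents_iff β φ (hU j) hξ (fromSpec_mem (hU j) P), primeIdealOf_fromSpec]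
      exact hP'
    · exact Set.injOn_of_injective (hU j).fromSpec.isOpenEmbedding.injective
    · intro v hv
      rw [Finset.mem_coe, Finset.mem_filter, hVfin.mem_toFinset] at hv
      refine ⟨(hU j).primeIdealOf ⟨v, hv.2⟩, ?_, (hU j).fromSpec_primeIdealOf _⟩
      rw [Finset.mem_coe, (hmin j hξ).mem_toFinset]
      exact (mem_fiberComponents_iff β φ (hU j) hξ hv.2).mp hv.1
    · have hP' := (hmin j hξ).mem_toFinset.mp hP
      have hPU := fromSpec_mem (hU j) P
      have hPV : (hU j).fromSpec P ∈ fiberComponents β φ := by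
        rw [mem_fiberComponents_iff β φ (hU j) hξ hPU, primeIdealOf_fromSpec]
        exact hP'
      have h1 := hD1 ⟨_, hPV⟩ j hPU hξ y hy
      rw [primeIdealOf_fromSpec] at h1
      rw [hD' _ hPV, h1]
      ring

end Divisor

/-! ### Scalars -/

section Scalars

variable {F F' : Type u} [Field F] [Field F'] [Algebra F F'] {Y W : Scheme.{u}}

theorem ofHom_scalars (s : Y ⟶ Spec (.of F)) (U : Y.Opens) :
    CommRingCat.ofHom (scalars s U) = (Scheme.ΓSpecIso (.of F)).inv ≫ s.appLE ⊤ U (le_preimage_top s U) := by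
  rw [appLE_eq_ΓSpecIso_comp_scalars, Iso.inv_hom_id_assoc]

theorem app_scalars (h : W ⟶ Y) (s : Y ⟶ Spec (.of F)) (U : Y.Opens) (c : F) :
    h.app U (scalars s U c) = scalars (h ≫ s) (h ⁻¹ᵁ U) c := by
  have h1 : CommRingCat.ofHom (scalars s U) ≫ h.app U =
      CommRingCat.ofHom (scalars (h ≫ s) (h ⁻¹ᵁ U)) := by
    rw [ofHom_scalars, ofHom_scalars, Category.assoc, Scheme.Hom.app_eq_appLE,
      Scheme.Hom.appLE_comp_appLE]
  exact congrArg (fun φ : _ ⟶ _ => CommRingCat.Hom.hom φ c) h1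

theorem scalars_comp_specExtension (s : Y ⟶ Spec (.of F')) (U : Y.Opens) (c : F) :
    scalars (s ≫ specExtension F F') U c = scalars s U (algebraMap F F' c) := by
  have h1 : CommRingCat.ofHom (scalars (s ≫ specExtension F F') U) =
      CommRingCat.ofHom (algebraMap F F') ≫ CommRingCat.ofHom (scalars s U) := by
    rw [ofHom_scalars, ofHom_scalars, Scheme.ΓSpecIso_inv_naturality_assoc, Scheme.Hom.comp_appLE]
    rfl
  exact congrArg (fun φ : _ ⟶ _ => CommRingCat.Hom.hom φ c) h1

/-- The scalars in the function field. -/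
def functionFieldScalars [AlgebraicGeometry.IsIntegral W] (σ : W ⟶ Spec (.of F)) :
    F →+* W.functionField :=
  (W.presheaf.germ ⊤ (genericPoint W) trivial).hom.comp (scalars σ ⊤)

theorem germToFunctionField_scalars [AlgebraicGeometry.IsIntegral W] (σ : W ⟶ Spec (.of F))
    (U : W.Opens) [Nonempty U] (c : F) :
    W.germToFunctionField U (scalars σ U c) = functionFieldScalars σ c := by
  rw [← map_comp_scalars σ (le_top : U ≤ ⊤)]
  exact W.presheaf.germ_res_apply (homOfLE le_top) (genericPoint W) _ (scalars σ ⊤ c)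

theorem germToFunctionField_app [AlgebraicGeometry.IsIntegral W] (G : W ⟶ Y) (U : Y.Opens)
    (hξ : G (genericPoint W) ∈ U) [Nonempty (G ⁻¹ᵁ U)] (x : Γ(Y, U)) :
    W.germToFunctionField (G ⁻¹ᵁ U) (G.app U x) =
      sectionHom (G.stalkMap (genericPoint W)).hom hξ x :=
  (Scheme.Hom.germ_stalkMap_apply G U _ hξ x).symm

end Scalars

theorem actionCharpoly_quotient_comap (F : Type*) [Field F] {S R : Type*} [CommRing S] [CommRing R]
    [Algebra F S] [Algebra F R] [Algebra S R] [IsScalarTower F S R]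
    (hSR : Function.Surjective (algebraMap S R)) (J : Ideal R) (s : S) :
    actionCharpoly F s (S ⧸ J.comap (algebraMap S R)) =
      actionCharpoly F (algebraMap S R s) (R ⧸ J) := by
  rw [actionCharpoly_congr F s (quotientComapEquiv hSR J)]
  have h1 : Algebra.lsmul F F (R ⧸ J) s = Algebra.lsmul F F (R ⧸ J) (algebraMap S R s) :=
    LinearMap.ext fun x => (algebraMap_smul R s x).symm
  rw [actionCharpoly, actionCharpoly, h1]

section Curve

variable {F F' : Type u} [Field F] [Field F'] [Algebra F F'] {Y Y' W : Scheme.{u}}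
  {s : Y ⟶ Spec (.of F)} {s' : Y' ⟶ Spec (.of F')} {g : Y' ⟶ Y}
  (H : IsPullback g s' s (specExtension F F')) (i : W ⟶ Y') [IsClosedImmersion i]

include H in
theorem span_range_app_eq_top {U : Y.Opens} (hU : IsAffineOpen U) :
    letI := (scalars (i ≫ s') ((i ≫ g) ⁻¹ᵁ U)).toAlgebra
    Submodule.span F' (Set.range ((i ≫ g).app U)) = (⊤ : Submodule F' Γ(W, (i ≫ g) ⁻¹ᵁ U)) := by
  let := (scalars s U).toAlgebra
  let := (scalars (i ≫ s') ((i ≫ g) ⁻¹ᵁ U)).toAlgebra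
  have := isAffineHom_of_isPullback H
  obtain ⟨e, he, he'⟩ := exists_tensorEquiv H hU
  rw [eq_top_iff]
  rintro r -
  obtain ⟨r, rfl⟩ := i.app_surjective (g ⁻¹ᵁ U) (hU.preimage g) r
  obtain ⟨x, rfl⟩ := e.surjective r
  induction x using TensorProduct.induction_on with
  | zero => rw [map_zero, map_zero]; exact zero_mem _
  | add x y hx hy => rw [map_add, map_add]; exact add_mem hx hy
  | tmul c a =>
    have h1 : c ⊗ₜ[F] a = (c ⊗ₜ 1) * (1 ⊗ₜ a) := by
      rw [Algebra.TensorProduct.tmul_mul_tmul, mul_one, one_mul]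
    rw [h1, map_mul, map_mul, he, he', app_scalars]
    exact Submodule.smul_mem _ c (Submodule.subset_span ⟨a, by
      rw [Scheme.Hom.comp_app]; rfl⟩)

include H in
theorem exists_isFiberEquation [AlgebraicGeometry.IsIntegral W] [LocallyOfFiniteType s] {U : Y.Opens} (hU : IsAffineOpen U)
    (hξ : (i ≫ g) (genericPoint W) ∈ U)
    (htr : letI := (functionFieldScalars (i ≫ s')).toAlgebra
      Algebra.trdeg F' W.functionField ≤ 1) [Nonempty ((i ≫ g) ⁻¹ᵁ U)]
    {a : Γ(W, (i ≫ g) ⁻¹ᵁ U)} (ha : a ≠ 0) :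
    letI := (functionFieldScalars (i ≫ s')).toAlgebra
    letI := (scalars s U).toAlgebra
    letI := (scalars (i ≫ s') ((i ≫ g) ⁻¹ᵁ U)).toAlgebra
    Module.Finite F' (Γ(W, (i ≫ g) ⁻¹ᵁ U) ⧸ Ideal.span {a}) ∧
    ∃ T : Finset F', ∀ (B : Subalgebra F F') (β : B →ₐ[F] F), (T : Set F') ⊆ B →
      ∃ x : Γ(Y, U), IsFiberEquation β ((i ≫ g).stalkMap (genericPoint W)).hom s hξ
        (W.germToFunctionField ((i ≫ g) ⁻¹ᵁ U) a) x ∧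
      ∀ σ : Γ(Y, U), ∃ χ : Polynomial B,
        actionCharpoly F' ((i ≫ g).app U σ) (Γ(W, (i ≫ g) ⁻¹ᵁ U) ⧸ Ideal.span {a}) =
          χ.map (algebraMap B F') ∧
        actionCharpoly F σ (Γ(Y, U) ⧸ (fiberIdeal β
          (sectionHom ((i ≫ g).stalkMap (genericPoint W)).hom hξ) ⊔ Ideal.span {x})) =
            χ.map (β : B →+* F) := by
  let L := W.functionField
  let S := Γ(Y, U)
  let R := Γ(W, (i ≫ g) ⁻¹ᵁ U)
  let : Algebra F' L := (functionFieldScalars (i ≫ s')).toAlgebra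
  let : Algebra F S := (scalars s U).toAlgebra
  let : Algebra F' R := (scalars (i ≫ s') ((i ≫ g) ⁻¹ᵁ U)).toAlgebra
  let : Algebra S R := ((i ≫ g).app U).hom.toAlgebra
  let : Algebra R L := (W.germToFunctionField ((i ≫ g) ⁻¹ᵁ U)).hom.toAlgebra
  let : Algebra S L := (sectionHom ((i ≫ g).stalkMap (genericPoint W)).hom hξ).toAlgebra
  let : Algebra F L := ((algebraMap F' L).comp (algebraMap F F')).toAlgebra
  have : IsScalarTower F F' L := .of_algebraMap_eq' rfl
  have : IsScalarTower S R L := .of_algebraMap_eq fun x =>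
    (germToFunctionField_app (i ≫ g) U hξ x).symm
  have : IsScalarTower F' R L := .of_algebraMap_eq fun c =>
    (germToFunctionField_scalars (i ≫ s') _ c).symm
  have hcomm : (i ≫ g) ≫ s = (i ≫ s') ≫ specExtension F F' := by
    rw [Category.assoc, Category.assoc, H.w]
  have : IsScalarTower F S L := .of_algebraMap_eq fun c => by
    have h1 : algebraMap S L (algebraMap F S c) = algebraMap R L (algebraMap S R (algebraMap F S c)) :=
      IsScalarTower.algebraMap_apply S R L _
    have h2 : algebraMap S R (algebraMap F S c) = algebraMap F' R (algebraMap F F' c) := by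
      refine (app_scalars (i ≫ g) s U c).trans ?_
      rw [hcomm, scalars_comp_specExtension]
      rfl
    rw [h1, h2, ← IsScalarTower.algebraMap_apply F' R L]
    rfl
  have : IsAffineHom g := isAffineHom_of_isPullback H
  have hV : IsAffineOpen ((i ≫ g) ⁻¹ᵁ U) := hU.preimage (i ≫ g)
  have hfr : IsFractionRing R L := functionField_isFractionRing_of_isAffineOpen W _ hV
  have hinj : Function.Injective (algebraMap R L) := IsFractionRing.injective R L
  have : Algebra.FiniteType F S := finiteType_scalars s hU
  have := locallyOfFiniteType_of_isPullback H
  have : Algebra.FiniteType F' R := finiteType_scalars (i ≫ s') hV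
  have htr' : Algebra.trdeg F' R ≤ 1 := by
    refine le_trans (trdeg_le_of_injective (IsScalarTower.toAlgHom F' R L) hinj) htr
  have hfin : Module.Finite F' (R ⧸ Ideal.span {a}) := finite_quotient_of_trdeg_le_one F' htr' ha
  refine ⟨hfin, ?_⟩
  obtain ⟨m, n, T, hT⟩ := exists_isSpecializationBasis (F := F) L S (span_range_app_eq_top H i hU) a
    ((map_ne_zero_iff _ hinj).mpr ha)
  refine ⟨T, fun B β hB => ?_⟩
  have hb := hT B hB
  obtain ⟨x, hx⟩ := exists_isLift β hb.mem
  refine ⟨x, ⟨hx, fun t ht => hb.mem_specIdeal_of_mul_mem β hinj hx ht, hb.finite β hinj hx⟩, ?_⟩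
  intro σ
  obtain ⟨χ, h1, h2⟩ := hb.exists_actionCharpoly_eq β hinj σ
  exact ⟨χ, h1, h2 x hx⟩

end Curve

/-! ### Specialization of principal cycles -/

section SpecializePrincipal

variable {F F' : Type u} [Field F] [Field F'] [Algebra F F'] {Y Y' : Scheme.{u}}
  (s : Y ⟶ Spec (.of F)) (s' : Y' ⟶ Spec (.of F')) (g : Y' ⟶ Y) {B : Subalgebra F F'}
  (β : B →ₐ[F] F)

/-- The cycle of `I` is the specialization at `β` of the cycle of `J`, in terms of characteristic
polynomials. -/
structure SpecializesTo (U : Y.Opens) (J : Ideal Γ(Y', g ⁻¹ᵁ U)) (I : Ideal Γ(Y, U)) : Prop where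
  finite : letI := (scalars s U).toAlgebra; Module.Finite F (Γ(Y, U) ⧸ I)
  exists_charpoly : letI := (scalars s U).toAlgebra
    letI := (scalars s' (g ⁻¹ᵁ U)).toAlgebra
    ∀ σ : Γ(Y, U), ∃ χ : Polynomial B,
      actionCharpoly F' (g.app U σ) (Γ(Y', g ⁻¹ᵁ U) ⧸ J) = χ.map (algebraMap B F') ∧
      actionCharpoly F σ (Γ(Y, U) ⧸ I) = χ.map (β : B →+* F)

theorem specializesTo_top (U : Y.Opens) : SpecializesTo s s' g β U ⊤ ⊤ := by
  let := (scalars s U).toAlgebra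
  let := (scalars s' (g ⁻¹ᵁ U)).toAlgebra
  have h1 : Subsingleton (Γ(Y, U) ⧸ (⊤ : Ideal Γ(Y, U))) := Ideal.Quotient.subsingleton_iff.mpr rfl
  have h2 : Subsingleton (Γ(Y', g ⁻¹ᵁ U) ⧸ (⊤ : Ideal Γ(Y', g ⁻¹ᵁ U))) :=
    Ideal.Quotient.subsingleton_iff.mpr rfl
  refine ⟨inferInstance, fun σ => ⟨1, ?_, ?_⟩⟩
  · rw [actionCharpoly_of_subsingleton, Polynomial.map_one]
  · rw [actionCharpoly_of_subsingleton, Polynomial.map_one]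

/-- The length at `y` of the structure sheaf of a closed subscheme of `U`. -/
def chartLength {Y : Scheme.{u}} {U : Y.Opens} (hU : IsAffineOpen U) (J : Ideal Γ(Y, U)) (y : Y) :
    ℕ∞ :=
  open Classical in
  if hy : y ∈ U then lengthAt (hU.primeIdealOf ⟨y, hy⟩).asIdeal (Γ(Y, U) ⧸ J) else 0

theorem chartLength_eq {Y : Scheme.{u}} {U : Y.Opens} (hU : IsAffineOpen U) (J : Ideal Γ(Y, U))
    {y : Y} (hy : y ∈ U) :
    chartLength hU J y = lengthAt (hU.primeIdealOf ⟨y, hy⟩).asIdeal (Γ(Y, U) ⧸ J) :=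
  dif_pos hy

theorem chartLength_top {Y : Scheme.{u}} {U : Y.Opens} (hU : IsAffineOpen U) (y : Y) :
    chartLength hU ⊤ y = 0 := by
  rw [chartLength]
  split_ifs with hy
  · exact lengthAt_quotient_eq_zero _ fun h => (hU.primeIdealOf ⟨y, hy⟩).2.ne_top (top_le_iff.mp h)
  · rfl

variable {s s' g}

/-- The equations and cycles on a chart that contains the generic point. -/
theorem exists_chart_specialization {W : Scheme.{u}} [AlgebraicGeometry.IsIntegral W]
    [IsLocallyNoetherian W] (H : IsPullback g s' s (specExtension F F')) (i : W ⟶ Y')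
    [IsClosedImmersion i] [LocallyOfFiniteType s] {U : Y.Opens} (hU : IsAffineOpen U)
    (hU' : IsAffineOpen (g ⁻¹ᵁ U)) (hξ : (i ≫ g) (genericPoint W) ∈ U)
    (htr : letI := (functionFieldScalars (i ≫ s')).toAlgebra
      Algebra.trdeg F' W.functionField ≤ 1) {f : W.functionField} (hf : f ≠ 0)
    {z' : AlgebraicCycle Y' ℤ} (hz1 : ∀ w : W, z' (i w) = Scheme.ord f w)
    (hz2 : ∀ y : Y', y ∉ Set.range i → z' y = 0) :
    letI := (functionFieldScalars (i ≫ s')).toAlgebra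
    letI := (scalars s' (g ⁻¹ᵁ U)).toAlgebra
    ∃ (J J' : Ideal Γ(Y', g ⁻¹ᵁ U)) (a b : W.functionField) (T : Finset F'), f * b = a ∧
      Module.Finite F' (Γ(Y', g ⁻¹ᵁ U) ⧸ J) ∧ Module.Finite F' (Γ(Y', g ⁻¹ᵁ U) ⧸ J') ∧
      (∀ y, g y ∈ U → z' y = (chartLength hU' J y).toNat - (chartLength hU' J' y).toNat) ∧
      ∀ (B : Subalgebra F F') (β : B →ₐ[F] F), (T : Set F') ⊆ B → ∃ x x' : Γ(Y, U),
        IsFiberEquation β ((i ≫ g).stalkMap (genericPoint W)).hom s hξ a x ∧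
        IsFiberEquation β ((i ≫ g).stalkMap (genericPoint W)).hom s hξ b x' ∧
        SpecializesTo s s' g β U J (fiberIdeal β
          (sectionHom ((i ≫ g).stalkMap (genericPoint W)).hom hξ) ⊔ Ideal.span {x}) ∧
        SpecializesTo s s' g β U J' (fiberIdeal β
          (sectionHom ((i ≫ g).stalkMap (genericPoint W)).hom hξ) ⊔ Ideal.span {x'}) := by
  classical
  let : Algebra F' W.functionField := (functionFieldScalars (i ≫ s')).toAlgebra
  let : Algebra F' Γ(Y', g ⁻¹ᵁ U) := (scalars s' (g ⁻¹ᵁ U)).toAlgebra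
  let : Algebra F Γ(Y, U) := (scalars s U).toAlgebra
  let : Algebra F' Γ(W, (i ≫ g) ⁻¹ᵁ U) := (scalars (i ≫ s') ((i ≫ g) ⁻¹ᵁ U)).toAlgebra
  let : Algebra Γ(Y', g ⁻¹ᵁ U) Γ(W, (i ≫ g) ⁻¹ᵁ U) := (i.app (g ⁻¹ᵁ U)).hom.toAlgebra
  have : IsScalarTower F' Γ(Y', g ⁻¹ᵁ U) Γ(W, (i ≫ g) ⁻¹ᵁ U) := .of_algebraMap_eq fun c =>
    (app_scalars i s' (g ⁻¹ᵁ U) c).symm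
  have hsurj : Function.Surjective (algebraMap Γ(Y', g ⁻¹ᵁ U) Γ(W, (i ≫ g) ⁻¹ᵁ U)) :=
    i.app_surjective _ hU'
  have hne : Nonempty ((i ≫ g) ⁻¹ᵁ U) := ⟨⟨genericPoint W, hξ⟩⟩
  have hV : IsAffineOpen ((i ≫ g) ⁻¹ᵁ U) := hU'.preimage i
  obtain ⟨a, b, hb, hab⟩ := exists_eq_div hV f
  have ha := ne_zero_of_div hf hb hab
  obtain ⟨hfa, Ta, hTa⟩ := exists_isFiberEquation H i hU hξ htr ha
  obtain ⟨hfb, Tb, hTb⟩ := exists_isFiberEquation H i hU hξ htr hb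
  have hfin : ∀ c : Γ(W, (i ≫ g) ⁻¹ᵁ U), Module.Finite F' (Γ(W, (i ≫ g) ⁻¹ᵁ U) ⧸ Ideal.span {c}) →
      Module.Finite F' (Γ(Y', g ⁻¹ᵁ U) ⧸ (Ideal.span {c}).comap
        (algebraMap Γ(Y', g ⁻¹ᵁ U) Γ(W, (i ≫ g) ⁻¹ᵁ U))) := fun c _ =>
    Module.Finite.equiv ((quotientComapEquiv hsurj (Ideal.span {c})).symm.restrictScalars F')
  have happ : ∀ σ, (i ≫ g).app U σ =
      algebraMap Γ(Y', g ⁻¹ᵁ U) Γ(W, (i ≫ g) ⁻¹ᵁ U) (g.app U σ) := fun σ => by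
    rw [Scheme.Hom.comp_app]; rfl
  refine ⟨_, _, W.germToFunctionField _ a, W.germToFunctionField _ b, Ta ∪ Tb, hab, hfin a hfa,
    hfin b hfb, fun y hy => ?_, fun B β hB => ?_⟩
  · have hcomap : ∀ (w : W) (hw : w ∈ (i ≫ g) ⁻¹ᵁ U), (hU'.primeIdealOf ⟨i w, hw⟩).asIdeal =
        (hV.primeIdealOf ⟨w, hw⟩).asIdeal.comap
          (algebraMap Γ(Y', g ⁻¹ᵁ U) Γ(W, (i ≫ g) ⁻¹ᵁ U)) := by
      intro w hw
      have h1 := IsAffineOpen.comap_primeIdealOf_appLE (f := i) (g ⁻¹ᵁ U) hU' (i ⁻¹ᵁ g ⁻¹ᵁ U) hV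
        le_rfl hw
      rw [← Scheme.Hom.app_eq_appLE] at h1
      exact (congrArg PrimeSpectrum.asIdeal h1).symm
    rw [chartLength_eq hU' _ hy, chartLength_eq hU' _ hy]
    by_cases hyi : y ∈ Set.range i
    · obtain ⟨w, rfl⟩ := hyi
      have hw : w ∈ (i ≫ g) ⁻¹ᵁ U := hy
      have hlen : ∀ c : Γ(W, (i ≫ g) ⁻¹ᵁ U), lengthAt (hU'.primeIdealOf ⟨i w, hy⟩).asIdeal
          (Γ(Y', g ⁻¹ᵁ U) ⧸ (Ideal.span {c}).comap
            (algebraMap Γ(Y', g ⁻¹ᵁ U) Γ(W, (i ≫ g) ⁻¹ᵁ U))) =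
          lengthAt (hV.primeIdealOf ⟨w, hw⟩).asIdeal
            (Γ(W, (i ≫ g) ⁻¹ᵁ U) ⧸ Ideal.span {c}) := by
        intro c
        rw [← lengthAt_quotient_comap hsurj]
        simp only [hcomap w hw]
      rw [hz1, hlen, hlen]
      exact ord_eq_sub_lengthAt hV hw ha hb hab (lengthAt_quotient_ne_top F' _ _)
        (lengthAt_quotient_ne_top F' _ _)
    · have h0 : ∀ c : Γ(W, (i ≫ g) ⁻¹ᵁ U), lengthAt (hU'.primeIdealOf ⟨y, hy⟩).asIdeal
          (Γ(Y', g ⁻¹ᵁ U) ⧸ (Ideal.span {c}).comap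
            (algebraMap Γ(Y', g ⁻¹ᵁ U) Γ(W, (i ≫ g) ⁻¹ᵁ U))) = 0 := by
        intro c
        refine lengthAt_quotient_eq_zero _ fun hle => hyi ?_
        have hk : RingHom.ker (algebraMap Γ(Y', g ⁻¹ᵁ U) Γ(W, (i ≫ g) ⁻¹ᵁ U)) ≤
            (hU'.primeIdealOf ⟨y, hy⟩).asIdeal := (Ideal.comap_mono bot_le).trans hle
        have h1 : hU'.primeIdealOf ⟨y, hy⟩ ∈ Set.range (PrimeSpectrum.comap
            (algebraMap Γ(Y', g ⁻¹ᵁ U) Γ(W, (i ≫ g) ⁻¹ᵁ U))) := by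
          rw [range_comap_of_surjective _ _ hsurj]
          exact hk
        obtain ⟨q, hq⟩ := h1
        have h2 := hcomap (hV.fromSpec q) (fromSpec_mem hV q)
        rw [primeIdealOf_fromSpec] at h2
        exact ⟨hV.fromSpec q, congrArg Subtype.val (primeIdealOf_injective hU'
          (PrimeSpectrum.ext (h2.trans (congrArg PrimeSpectrum.asIdeal hq))))⟩
      rw [hz2 y hyi, h0, h0]
      simp
  · obtain ⟨x, hx, hχ⟩ := hTa B β (Finset.coe_subset.mpr Finset.subset_union_left |>.trans hB)
    obtain ⟨x', hx', hχ'⟩ := hTb B β (Finset.coe_subset.mpr Finset.subset_union_right |>.trans hB)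
    refine ⟨x, x', hx, hx', ⟨hx.finite, fun σ => ?_⟩, ⟨hx'.finite, fun σ => ?_⟩⟩
    · obtain ⟨χ, h1, h2⟩ := hχ σ
      refine ⟨χ, ?_, h2⟩
      rw [actionCharpoly_quotient_comap F' hsurj, ← happ]
      exact h1
    · obtain ⟨χ, h1, h2⟩ := hχ' σ
      refine ⟨χ, ?_, h2⟩
      rw [actionCharpoly_quotient_comap F' hsurj, ← happ]
      exact h1

end SpecializePrincipal

section SpecializeCharts

variable {F F' : Type u} [Field F] [Field F'] [Algebra F F'] {Y Y' : Scheme.{u}}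
  {s : Y ⟶ Spec (.of F)} {s' : Y' ⟶ Spec (.of F')} {g : Y' ⟶ Y}

theorem trdeg_functionField_le_one {W : Scheme.{u}} [AlgebraicGeometry.IsIntegral W]
    (σ : W ⟶ Spec (.of F)) [LocallyOfFiniteType σ] {V : W.Opens} (hV : IsAffineOpen V) {w : W}
    (hw : w ∈ V) (hmax : (hV.primeIdealOf ⟨w, hw⟩).asIdeal.IsMaximal) (h : coheight w ≤ 1) :
    letI := (functionFieldScalars σ).toAlgebra
    Algebra.trdeg F W.functionField ≤ 1 := by
  let L := W.functionField
  let R := Γ(W, V)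
  have : Nonempty V := ⟨⟨w, hw⟩⟩
  let : Algebra F L := (functionFieldScalars σ).toAlgebra
  let : Algebra F R := (scalars σ V).toAlgebra
  let : Algebra R L := (W.germToFunctionField V).hom.toAlgebra
  have : IsScalarTower F R L := .of_algebraMap_eq fun c => (germToFunctionField_scalars σ V c).symm
  have hfr : IsFractionRing R L := functionField_isFractionRing_of_isAffineOpen W V hV
  have : Algebra.FiniteType F R := finiteType_scalars σ hV
  rw [coheight_eq_height hV hw] at h
  have h1 := trdeg_le_one_of_height_le_one F (hV.primeIdealOf ⟨w, hw⟩).asIdeal h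
  have : Algebra.IsAlgebraic R L := IsLocalization.isAlgebraic (R := R) (S := L) (nonZeroDivisors R)
  have : FaithfulSMul R L := (faithfulSMul_iff_algebraMap_injective R L).mpr
    (IsFractionRing.injective R L)
  have h2 := trdeg_add_eq F R (A := L)
  rw [trdeg_eq_zero (R := R) (A := L), add_zero] at h2
  rw [← h2]
  exact h1

variable (H : IsPullback g s' s (specExtension F F')) [LocallyOfFiniteType s] {ι : Type} [Finite ι]
  {U : ι → Y.Opens} (hU : ∀ j, IsAffineOpen (U j)) (hU' : ∀ j, IsAffineOpen (g ⁻¹ᵁ U j))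
  (hcov : ∀ y, ∃ j, y ∈ U j)

include H hcov in
/-- The specialization of a principal cycle is rationally equivalent to zero. -/
theorem exists_specialization_of_isPrincipalCycle {z' : AlgebraicCycle Y' ℤ}
    (hz' : IsPrincipalCycle Y' z') :
    ∃ (J J' : ∀ j, Ideal Γ(Y', g ⁻¹ᵁ U j)) (T : Finset F'),
      (∀ j, letI := (scalars s' (g ⁻¹ᵁ U j)).toAlgebra
        Module.Finite F' (Γ(Y', g ⁻¹ᵁ U j) ⧸ J j) ∧ Module.Finite F' (Γ(Y', g ⁻¹ᵁ U j) ⧸ J' j)) ∧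
      (∀ j y (hy : y ∈ g ⁻¹ᵁ U j), ((hU' j).primeIdealOf ⟨y, hy⟩).asIdeal.IsMaximal →
        z' y = (chartLength (hU' j) (J j) y).toNat - (chartLength (hU' j) (J' j) y).toNat) ∧
      ∀ (B : Subalgebra F F') (β : B →ₐ[F] F), (T : Set F') ⊆ B →
        ∃ z ∈ rationalEquivalence Y, ∃ I I' : ∀ j, Ideal Γ(Y, U j),
          (∀ j, SpecializesTo s s' g β (U j) (J j) (I j) ∧
            SpecializesTo s s' g β (U j) (J' j) (I' j)) ∧
          ∀ j, ∀ y ∈ U j, z y =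
            (chartLength (hU j) (I j) y).toNat - (chartLength (hU j) (I' j) y).toNat := by
  classical
  obtain ⟨W, _, _, i, _, f, hf, hz1, hz2⟩ := hz'
  let : Algebra F' W.functionField := (functionFieldScalars (i ≫ s')).toAlgebra
  have htop : ∀ j, letI := (scalars s' (g ⁻¹ᵁ U j)).toAlgebra
      Module.Finite F' (Γ(Y', g ⁻¹ᵁ U j) ⧸ (⊤ : Ideal Γ(Y', g ⁻¹ᵁ U j))) := by
    intro j
    let := (scalars s' (g ⁻¹ᵁ U j)).toAlgebra
    have : Subsingleton (Γ(Y', g ⁻¹ᵁ U j) ⧸ (⊤ : Ideal Γ(Y', g ⁻¹ᵁ U j))) :=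
      Ideal.Quotient.subsingleton_iff.mpr rfl
    infer_instance
  by_cases htr : Algebra.trdeg F' W.functionField ≤ 1
  swap
  · refine ⟨fun j => ⊤, fun j => ⊤, ∅, fun j => ⟨htop j, htop j⟩, fun j y hy hmax => ?_,
      fun B β _ => ⟨0, zero_mem _, fun j => ⊤, fun j => ⊤, fun j =>
        ⟨specializesTo_top s s' g β _, specializesTo_top s s' g β _⟩, fun j y _ => ?_⟩⟩
    · simp only [chartLength_top, ENat.toNat_zero, Nat.cast_zero, sub_self]
      by_cases hyi : y ∈ Set.range i
      · obtain ⟨w, rfl⟩ := hyi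
        rw [hz1]
        refine Scheme.ord_eq_zero_of_coheight_neq_one (fun hco => htr ?_) f
        have hV : IsAffineOpen (i ⁻¹ᵁ g ⁻¹ᵁ U j) := (hU' j).preimage i
        have := locallyOfFiniteType_of_isPullback H
        refine trdeg_functionField_le_one (i ≫ s') hV (w := w) hy ?_ hco.le
        have h1 := IsAffineOpen.comap_primeIdealOf_appLE (f := i) _ (hU' j) (i ⁻¹ᵁ g ⁻¹ᵁ U j) hV
          le_rfl hy
        rw [← Scheme.Hom.app_eq_appLE] at h1
        have h2 := congrArg PrimeSpectrum.asIdeal h1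
        rw [← h2] at hmax
        have hsurj : Function.Surjective (i.app (g ⁻¹ᵁ U j)).hom := i.app_surjective _ (hU' j)
        have h3 := Ideal.map_eq_top_or_isMaximal_of_surjective (i.app (g ⁻¹ᵁ U j)).hom hsurj hmax
        rw [PrimeSpectrum.comap_asIdeal, Ideal.map_comap_of_surjective _ hsurj] at h3
        exact h3.resolve_left (hV.primeIdealOf ⟨w, hy⟩).2.ne_top
      · exact hz2 y hyi
    · simp only [chartLength_top, ENat.toNat_zero, Nat.cast_zero, sub_self]
      rfl
  have := isLocallyNoetherian_of_locallyOfFiniteType s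
  let φ := ((i ≫ g).stalkMap (genericPoint W)).hom
  have key : ∀ j, letI := (scalars s' (g ⁻¹ᵁ U j)).toAlgebra
      ∃ (J J' : Ideal Γ(Y', g ⁻¹ᵁ U j)) (a b : W.functionField) (T : Finset F'), f * b = a ∧
      Module.Finite F' (Γ(Y', g ⁻¹ᵁ U j) ⧸ J) ∧ Module.Finite F' (Γ(Y', g ⁻¹ᵁ U j) ⧸ J') ∧
      (∀ y, g y ∈ U j →
        z' y = (chartLength (hU' j) J y).toNat - (chartLength (hU' j) J' y).toNat) ∧
      ∀ (B : Subalgebra F F') (β : B →ₐ[F] F), (T : Set F') ⊆ B →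
        ∃ (x x' : Γ(Y, U j)) (I I' : Ideal Γ(Y, U j)),
          SpecializesTo s s' g β (U j) J I ∧ SpecializesTo s s' g β (U j) J' I' ∧
          (∀ hξ : (i ≫ g) (genericPoint W) ∈ U j, IsFiberEquation β φ s hξ a x ∧
            IsFiberEquation β φ s hξ b x' ∧
            I = fiberIdeal β (sectionHom φ hξ) ⊔ Ideal.span {x} ∧
            I' = fiberIdeal β (sectionHom φ hξ) ⊔ Ideal.span {x'}) ∧
          ((i ≫ g) (genericPoint W) ∉ U j → I = ⊤ ∧ I' = ⊤) := by
    intro j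
    by_cases hξ : (i ≫ g) (genericPoint W) ∈ U j
    · obtain ⟨J, J', a, b, T, hab, h1, h2, h3, h4⟩ :=
        exists_chart_specialization H i (hU j) (hU' j) hξ htr hf hz1 hz2
      refine ⟨J, J', a, b, T, hab, h1, h2, h3, fun B β hB => ?_⟩
      obtain ⟨x, x', hx, hx', h5, h6⟩ := h4 B β hB
      exact ⟨x, x', _, _, h5, h6, fun _ => ⟨hx, hx', rfl, rfl⟩, fun h => absurd hξ h⟩
    · refine ⟨⊤, ⊤, f * 1, 1, ∅, rfl, htop j, htop j, fun y hy => ?_, fun B β _ =>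
        ⟨0, 0, ⊤, ⊤, specializesTo_top s s' g β _, specializesTo_top s s' g β _,
          fun h => absurd h hξ, fun _ => ⟨rfl, rfl⟩⟩⟩
      simp only [chartLength_top, ENat.toNat_zero, Nat.cast_zero, sub_self]
      refine hz2 y ?_
      rintro ⟨w, rfl⟩
      refine hξ (((genericPoint_specializes w).map (i ≫ g).continuous).mem_open (U j).isOpen ?_)
      rw [Scheme.Hom.comp_apply]
      exact hy
  choose J J' a b T hab h1 h2 h3 h4 using key
  have := Fintype.ofFinite ι
  refine ⟨J, J', Finset.univ.biUnion T, fun j => ⟨h1 j, h2 j⟩, fun j y hy _ => h3 j y hy,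
    fun B β hB => ?_⟩
  choose x x' I I' h5 h6 h7 h8 using fun j => h4 j B β ((Finset.coe_subset.mpr
    (Finset.subset_biUnion_of_mem T (Finset.mem_univ j))).trans hB)
  obtain ⟨z, hz, hz3⟩ := exists_specialized_divisor β φ hU hab
    (fun j hξ => (h7 j hξ).1) (fun j hξ => (h7 j hξ).2.1) hcov
  refine ⟨z, hz, I, I', fun j => ⟨h5 j, h6 j⟩, fun j y hy => ?_⟩
  by_cases hξ : (i ≫ g) (genericPoint W) ∈ U j
  · rw [(hz3 j y hy).2 hξ, chartLength_eq _ _ hy, chartLength_eq _ _ hy, (h7 j hξ).2.2.1,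
      (h7 j hξ).2.2.2]
  · rw [(hz3 j y hy).1 hξ, (h8 j hξ).1, (h8 j hξ).2]
    simp only [chartLength_top, ENat.toNat_zero, Nat.cast_zero, sub_self]

end SpecializeCharts

/-! ### Rational points and specialization -/

section RationalIdeal

variable (F : Type*) [Field F] {T : Type*} [CommRing T] [Algebra F T] {M : Ideal T}

theorem finrank_quotient_of_forall_exists (hM : M ≠ ⊤)
    (h : ∀ σ : T, ∃ c : F, σ - algebraMap F T c ∈ M) :
    Module.finrank F (T ⧸ M) = 1 := by
  have : Nontrivial (T ⧸ M) := Ideal.Quotient.nontrivial_iff.mpr hM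
  refine finrank_eq_one (1 : T ⧸ M) one_ne_zero fun w => ?_
  obtain ⟨σ, rfl⟩ := Ideal.Quotient.mk_surjective w
  obtain ⟨c, hc⟩ := h σ
  refine ⟨c, ?_⟩
  rw [Algebra.smul_def, mul_one]
  exact (Ideal.Quotient.eq.mpr hc).symm

theorem finite_quotient_of_forall_exists (hM : M ≠ ⊤)
    (h : ∀ σ : T, ∃ c : F, σ - algebraMap F T c ∈ M) : Module.Finite F (T ⧸ M) :=
  Module.finite_of_finrank_pos (by rw [finrank_quotient_of_forall_exists F hM h]; exact one_pos)

theorem actionCharpoly_quotient_of_sub_mem (hM : M ≠ ⊤)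
    (h : ∀ σ : T, ∃ c : F, σ - algebraMap F T c ∈ M) {σ : T} {c : F}
    (hc : σ - algebraMap F T c ∈ M) :
    actionCharpoly F σ (T ⧸ M) = Polynomial.X - Polynomial.C c := by
  have := finite_quotient_of_forall_exists F hM h
  have h1 : Algebra.lsmul F F (T ⧸ M) σ = 0 - (-c) • (1 : Module.End F (T ⧸ M)) := by
    refine LinearMap.ext fun x => ?_
    obtain ⟨x, rfl⟩ := Ideal.Quotient.mk_surjective x
    change Ideal.Quotient.mk M (σ * x) = 0 - (-c) • Ideal.Quotient.mk M x
    rw [neg_smul, sub_neg_eq_add, zero_add, Algebra.smul_def, map_mul]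
    congr 1
    exact Ideal.Quotient.eq.mpr hc
  rw [actionCharpoly_eq, h1, LinearMap.charpoly_sub_smul, LinearMap.charpoly_zero,
    finrank_quotient_of_forall_exists F hM h, pow_one, Polynomial.X_comp, Polynomial.C_neg,
    sub_eq_add_neg]

end RationalIdeal

section RationalPoint

variable {F : Type u} [Field F] {Y : Scheme.{u}} {s : Y ⟶ Spec (.of F)} {U : Y.Opens}

theorem exists_sub_scalars_mem_primeIdealOf (a : Spec (.of F) ⟶ Y) (ha : a ≫ s = 𝟙 _)
    (hU : IsAffineOpen U) {x : Spec (.of F)} (hx : a x ∈ U) (σ : Γ(Y, U)) :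
    ∃ c : F, σ - scalars s U c ∈ (hU.primeIdealOf ⟨a x, hx⟩).asIdeal := by
  have hV : a ⁻¹ᵁ U = ⊤ := by
    refine top_le_iff.mp fun y _ => ?_
    have : y = x := Subsingleton.elim (α := PrimeSpectrum F) _ _
    rw [this]; exact hx
  have hVa : IsAffineOpen (a ⁻¹ᵁ U) := hV ▸ isAffineOpen_top _
  have h1 := IsAffineOpen.comap_primeIdealOf_appLE (f := a) _ hU (a ⁻¹ᵁ U) hVa le_rfl hx
  rw [← Scheme.Hom.app_eq_appLE] at h1
  rw [← h1]
  have hsurj : Function.Surjective (scalars (𝟙 (Spec (.of F))) (a ⁻¹ᵁ U)) := by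
    have e : IsIso ((Spec (.of F)).presheaf.map (homOfLE (le_top : a ⁻¹ᵁ U ≤ ⊤)).op) := by
      have : homOfLE (le_top : a ⁻¹ᵁ U ≤ ⊤) = eqToHom hV := rfl
      rw [this]
      infer_instance
    have e' : IsIso (Scheme.Hom.appTop (𝟙 (Spec (.of F)))) := by
      rw [Scheme.Hom.id_appTop]
      infer_instance
    have e'' : IsIso ((Scheme.ΓSpecIso (.of F)).inv ≫ Scheme.Hom.appTop (𝟙 (Spec (.of F))) ≫
        (Spec (.of F)).presheaf.map (homOfLE (le_top : a ⁻¹ᵁ U ≤ ⊤)).op) :=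
      IsIso.comp_isIso' inferInstance (IsIso.comp_isIso' e' e)
    exact (ConcreteCategory.bijective_of_isIso _).2
  obtain ⟨c, hc⟩ := hsurj (a.app U σ)
  refine ⟨c, ?_⟩
  rw [PrimeSpectrum.comap_asIdeal, Ideal.mem_comap, map_sub]
  have h2 := app_scalars a s U c
  rw [ha] at h2
  have h3 : (CommRingCat.Hom.hom (a.app U)) (scalars s U c) = a.app U σ := h2.trans hc
  rw [h3]
  exact (congrArg (· ∈ _) (sub_self _)).mpr (zero_mem _)

open Classical in
/-- The ideal of a point on a chart. -/
def pointIdeal (hU : IsAffineOpen U) (p : Y) : Ideal Γ(Y, U) :=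
  if hp : p ∈ U then (hU.primeIdealOf ⟨p, hp⟩).asIdeal else ⊤

theorem isMaximal_primeIdealOf_of_rational (a : Spec (.of F) ⟶ Y) (ha : a ≫ s = 𝟙 _)
    (hU : IsAffineOpen U) {x : Spec (.of F)} (hx : a x ∈ U) :
    (hU.primeIdealOf ⟨a x, hx⟩).asIdeal.IsMaximal := by
  let := (scalars s U).toAlgebra
  have := finite_quotient_of_forall_exists F (hU.primeIdealOf ⟨a x, hx⟩).2.ne_top
    (exists_sub_scalars_mem_primeIdealOf a ha hU hx)
  exact isMaximal_of_finite_quotient F (J := (hU.primeIdealOf ⟨a x, hx⟩).asIdeal) le_rfl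

theorem finite_quotient_pointIdeal (a : Spec (.of F) ⟶ Y) (ha : a ≫ s = 𝟙 _)
    (hU : IsAffineOpen U) (x : Spec (.of F)) :
    letI := (scalars s U).toAlgebra; Module.Finite F (Γ(Y, U) ⧸ pointIdeal hU (a x)) := by
  let := (scalars s U).toAlgebra
  by_cases hx : a x ∈ U
  · rw [pointIdeal, dif_pos hx]
    exact finite_quotient_of_forall_exists F (hU.primeIdealOf ⟨a x, hx⟩).2.ne_top
      (exists_sub_scalars_mem_primeIdealOf a ha hU hx)
  · rw [pointIdeal, dif_neg hx]
    have : Subsingleton (Γ(Y, U) ⧸ (⊤ : Ideal Γ(Y, U))) := Ideal.Quotient.subsingleton_iff.mpr rfl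
    infer_instance

open Classical in
theorem chartLength_pointIdeal (a : Spec (.of F) ⟶ Y) (ha : a ≫ s = 𝟙 _)
    (hU : IsAffineOpen U) (x : Spec (.of F)) {y : Y} (hy : y ∈ U) :
    chartLength hU (pointIdeal hU (a x)) y = ((if y = a x then 1 else 0 : ℕ) : ℕ∞) := by
  by_cases hx : a x ∈ U
  · rw [chartLength_eq _ _ hy, pointIdeal, dif_pos hx]
    have h := lengthAt_quotient_of_isMaximal (n := hU.primeIdealOf ⟨y, hy⟩)
      (isMaximal_primeIdealOf_of_rational a ha hU hx)
    split_ifs with hxy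
    · subst hxy
      rw [h.1 rfl, Nat.cast_one]
    · rw [h.2 fun h' => hxy (congrArg Subtype.val (primeIdealOf_injective hU h')), Nat.cast_zero]
  · rw [pointIdeal, dif_neg hx, chartLength_top, if_neg, Nat.cast_zero]
    rintro rfl
    exact hx hy

variable {F' : Type u} [Field F'] [Algebra F F'] {Y' : Scheme.{u}} {s' : Y' ⟶ Spec (.of F')}
  {g : Y' ⟶ Y}

theorem specializesTo_pointIdeal (hg : g ≫ s = s' ≫ specExtension F F') {B : Subalgebra F F'}
    (β : B →ₐ[F] F)
    {a : Spec (.of F) ⟶ Y} (ha : a ≫ s = 𝟙 _) {a' : Spec (.of F') ⟶ Y'} (ha' : a' ≫ s' = 𝟙 _)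
    {x : Spec (.of F)} {x' : Spec (.of F')} (hx : g (a' x') = a x) (hU : IsAffineOpen U)
    (hU' : IsAffineOpen (g ⁻¹ᵁ U)) :
    SpecializesTo s s' g β U (pointIdeal hU' (a' x')) (pointIdeal hU (a x)) := by
  let := (scalars s U).toAlgebra
  let := (scalars s' (g ⁻¹ᵁ U)).toAlgebra
  by_cases hxU : a x ∈ U
  · refine ⟨finite_quotient_pointIdeal a ha hU x, fun σ => ?_⟩
    have hxU' : a' x' ∈ g ⁻¹ᵁ U := by
      change g (a' x') ∈ U
      rwa [hx]
    obtain ⟨c, hc⟩ := exists_sub_scalars_mem_primeIdealOf a ha hU hxU σ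
    refine ⟨Polynomial.X - Polynomial.C (algebraMap F B c), ?_, ?_⟩
    · rw [pointIdeal, dif_pos hxU', actionCharpoly_quotient_of_sub_mem F'
        (hU'.primeIdealOf ⟨a' x', hxU'⟩).2.ne_top
        (exists_sub_scalars_mem_primeIdealOf a' ha' hU' hxU') (c := algebraMap F F' c),
        Polynomial.map_sub, Polynomial.map_X, Polynomial.map_C, ← IsScalarTower.algebraMap_apply]
      have h1 := IsAffineOpen.comap_primeIdealOf_appLE (f := g) _ hU (g ⁻¹ᵁ U) hU' le_rfl hxU'
      rw [← Scheme.Hom.app_eq_appLE] at h1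
      have h2 : hU.primeIdealOf ⟨g (a' x'), hxU'⟩ = hU.primeIdealOf ⟨a x, hxU⟩ :=
        congrArg hU.primeIdealOf (Subtype.ext hx)
      have h3 : hU.primeIdealOf ⟨a x, hxU⟩ = _ := h2.symm.trans h1.symm
      rw [h3, PrimeSpectrum.comap_asIdeal, Ideal.mem_comap, map_sub] at hc
      have h4 := app_scalars g s U c
      rw [hg, scalars_comp_specExtension] at h4
      have h5 : (CommRingCat.Hom.hom (g.app U)) (scalars s U c) =
        algebraMap F' Γ(Y', g ⁻¹ᵁ U) (algebraMap F F' c) := h4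
      rw [h5] at hc
      exact hc
    · rw [pointIdeal, dif_pos hxU, actionCharpoly_quotient_of_sub_mem F
        (hU.primeIdealOf ⟨a x, hxU⟩).2.ne_top
        (exists_sub_scalars_mem_primeIdealOf a ha hU hxU) hc,
        Polynomial.map_sub, Polynomial.map_X, Polynomial.map_C]
      congr 2
      exact (β.commutes c).symm
  · have hxU' : a' x' ∉ g ⁻¹ᵁ U := by
      change g (a' x') ∉ U
      rwa [hx]
    rw [pointIdeal, dif_neg hxU', pointIdeal, dif_neg hxU]
    exact specializesTo_top s s' g β U

/-- Specialization preserves equality of cycles. -/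
theorem sum_chartLength_eq_of_specializesTo [LocallyOfFiniteType s] {B : Subalgebra F F'}
    (β : B →ₐ[F] F) (hU : IsAffineOpen U) (hU' : IsAffineOpen (g ⁻¹ᵁ U)) {ι : Type} [Fintype ι]
    {J J' : ι → Ideal Γ(Y', g ⁻¹ᵁ U)} {I I' : ι → Ideal Γ(Y, U)}
    (hJ : letI := (scalars s' (g ⁻¹ᵁ U)).toAlgebra
      ∀ i, Module.Finite F' (Γ(Y', g ⁻¹ᵁ U) ⧸ J i))
    (hJ' : letI := (scalars s' (g ⁻¹ᵁ U)).toAlgebra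
      ∀ i, Module.Finite F' (Γ(Y', g ⁻¹ᵁ U) ⧸ J' i))
    (h : ∀ i, SpecializesTo s s' g β U (J i) (I i))
    (h' : ∀ i, SpecializesTo s s' g β U (J' i) (I' i))
    (heq : ∀ y (hy : y ∈ g ⁻¹ᵁ U), (hU'.primeIdealOf ⟨y, hy⟩).asIdeal.IsMaximal →
      ∑ i, chartLength hU' (J i) y = ∑ i, chartLength hU' (J' i) y) {y : Y} (hy : y ∈ U) :
    ∑ i, chartLength hU (I i) y = ∑ i, chartLength hU (I' i) y := by
  let : Algebra F Γ(Y, U) := (scalars s U).toAlgebra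
  let : Algebra F' Γ(Y', g ⁻¹ᵁ U) := (scalars s' (g ⁻¹ᵁ U)).toAlgebra
  have hI : ∀ i, Module.Finite F (Γ(Y, U) ⧸ I i) := fun i => (h i).finite
  have hI' : ∀ i, Module.Finite F (Γ(Y, U) ⧸ I' i) := fun i => (h' i).finite
  simp only [chartLength_eq _ _ hy]
  by_cases hmax : (hU.primeIdealOf ⟨y, hy⟩).asIdeal.IsMaximal
  swap
  · have h0 : ∀ I : Ideal Γ(Y, U), Module.Finite F (Γ(Y, U) ⧸ I) →
        lengthAt (hU.primeIdealOf ⟨y, hy⟩).asIdeal (Γ(Y, U) ⧸ I) = 0 := fun I _ =>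
      lengthAt_quotient_eq_zero _ fun hle => hmax (isMaximal_of_finite_quotient F hle)
    rw [Finset.sum_congr rfl fun i _ => h0 (I i) (hI i),
      Finset.sum_congr rfl fun i _ => h0 (I' i) (hI' i)]
  have : Algebra.FiniteType F Γ(Y, U) := finiteType_scalars s hU
  have : Module.Finite F (Γ(Y, U) ⧸ (hU.primeIdealOf ⟨y, hy⟩).asIdeal) := by
    let := Ideal.Quotient.field (hU.primeIdealOf ⟨y, hy⟩).asIdeal
    exact finite_of_finite_type_of_isJacobsonRing F _
  refine sum_lengthAt_eq_of_actionCharpoly F I I' (fun σ => ?_) _ hmax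
  choose χ hχ hχI using fun i => (h i).exists_charpoly σ
  choose χ' hχ' hχI' using fun i => (h' i).exists_charpoly σ
  rw [Finset.prod_congr rfl fun i _ => hχI i, Finset.prod_congr rfl fun i _ => hχI' i,
    ← Polynomial.map_prod, ← Polynomial.map_prod]
  congr 1
  refine Polynomial.map_injective (algebraMap B F') (FaithfulSMul.algebraMap_injective B F') ?_
  rw [Polynomial.map_prod, Polynomial.map_prod, ← Finset.prod_congr rfl fun i _ => hχ i,
    ← Finset.prod_congr rfl fun i _ => hχ' i]
  refine prod_actionCharpoly_eq F' J J' (fun m hm => ?_) _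
  have h1 := heq (hU'.fromSpec m) (fromSpec_mem hU' m)
  simp only [chartLength_eq _ _ (fromSpec_mem hU' m), primeIdealOf_fromSpec hU' m] at h1
  exact h1 hm

end RationalPoint

section Specialization

theorem chartLength_ne_top {F : Type u} [Field F] {Y : Scheme.{u}} {s : Y ⟶ Spec (.of F)}
    {V : Y.Opens} (hV : IsAffineOpen V) (I : Ideal Γ(Y, V))
    (hI : letI := (scalars s V).toAlgebra; Module.Finite F (Γ(Y, V) ⧸ I)) (y : Y) :
    chartLength hV I y ≠ ⊤ := by
  let := (scalars s V).toAlgebra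
  rw [chartLength]
  split_ifs
  · exact lengthAt_quotient_ne_top F I _
  · exact ENat.zero_ne_top

theorem sum_add_sum_eq_iff_toNat {κ : Type*} [Fintype κ] {a b : κ → ℕ∞} (ha : ∀ i, a i ≠ ⊤)
    (hb : ∀ i, b i ≠ ⊤) (n p q : ℕ) :
    ∑ i, a i + ∑ _ : Fin n, (q : ℕ∞) = ∑ i, b i + ∑ _ : Fin n, (p : ℕ∞) ↔
      ∑ i, ((a i).toNat : ℤ) - ∑ i, ((b i).toNat : ℤ) = n * (p - q) := by
  lift a to κ → ℕ using ha
  lift b to κ → ℕ using hb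
  simp only [ENat.toNat_natCast, Finset.sum_const, Finset.card_univ, Fintype.card_fin,
    nsmul_eq_mul]
  have h1 : ((∑ i, (a i : ℕ∞)) + n * q = (∑ i, (b i : ℕ∞)) + n * p) ↔
      ∑ i, (a i : ℤ) + n * q = ∑ i, (b i : ℤ) + n * p := by norm_cast
  rw [h1]
  constructor <;> intro h <;> linear_combination h


variable {F F' : Type u} [Field F] [Field F'] [Algebra F F'] {Y Y' : Scheme.{u}}
  {s : Y ⟶ Spec (.of F)} {s' : Y' ⟶ Spec (.of F')} {g : Y' ⟶ Y}
  (H : IsPullback g s' s (specExtension F F')) [LocallyOfFiniteType s] {ι : Type} [Finite ι]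
  {U : ι → Y.Opens} (hU : ∀ j, IsAffineOpen (U j)) (hU' : ∀ j, IsAffineOpen (g ⁻¹ᵁ U j))
  (hcov : ∀ y, ∃ j, y ∈ U j)

include H hcov in
/-- The specialization of a cycle rationally equivalent to zero is rationally equivalent to
zero. -/
theorem exists_specialization_of_mem_rationalEquivalence {z' : AlgebraicCycle Y' ℤ}
    (hz' : z' ∈ rationalEquivalence Y') :
    ∃ (κ : Type) (_ : Fintype κ) (J J' : κ → ∀ j, Ideal Γ(Y', g ⁻¹ᵁ U j)) (T : Finset F'),
      (∀ i j, letI := (scalars s' (g ⁻¹ᵁ U j)).toAlgebra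
        Module.Finite F' (Γ(Y', g ⁻¹ᵁ U j) ⧸ J i j) ∧
          Module.Finite F' (Γ(Y', g ⁻¹ᵁ U j) ⧸ J' i j)) ∧
      (∀ j y (hy : y ∈ g ⁻¹ᵁ U j), ((hU' j).primeIdealOf ⟨y, hy⟩).asIdeal.IsMaximal →
        z' y = ∑ i, ((chartLength (hU' j) (J i j) y).toNat : ℤ) -
          ∑ i, ((chartLength (hU' j) (J' i j) y).toNat : ℤ)) ∧
      ∀ (B : Subalgebra F F') (β : B →ₐ[F] F), (T : Set F') ⊆ B →
        ∃ z ∈ rationalEquivalence Y, ∃ I I' : κ → ∀ j, Ideal Γ(Y, U j),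
          (∀ i j, SpecializesTo s s' g β (U j) (J i j) (I i j) ∧
            SpecializesTo s s' g β (U j) (J' i j) (I' i j)) ∧
          ∀ j, ∀ y ∈ U j, z y = ∑ i, ((chartLength (hU j) (I i j) y).toNat : ℤ) -
            ∑ i, ((chartLength (hU j) (I' i j) y).toNat : ℤ) := by
  classical
  induction hz' using AddSubgroup.closure_induction with
  | mem z' hz' =>
    obtain ⟨J, J', T, h1, h2, h3⟩ := exists_specialization_of_isPrincipalCycle H hU hU' hcov hz'
    refine ⟨Unit, inferInstance, fun _ => J, fun _ => J', T, fun _ => h1, fun j y hy hm => ?_,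
      fun B β hB => ?_⟩
    · simp only [Finset.univ_unique, Finset.sum_singleton]
      exact h2 j y hy hm
    · obtain ⟨z, hz, I, I', h4, h5⟩ := h3 B β hB
      refine ⟨z, hz, fun _ => I, fun _ => I', fun _ => h4, fun j y hy => ?_⟩
      simp only [Finset.univ_unique, Finset.sum_singleton]
      exact h5 j y hy
  | zero =>
    refine ⟨Empty, inferInstance, Empty.elim, Empty.elim, ∅, nofun, fun j y _ _ => ?_,
      fun B β _ => ⟨0, zero_mem _, Empty.elim, Empty.elim, nofun, fun j y _ => ?_⟩⟩
    · simp
    · simp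
  | add z₁ z₂ _ _ h₁ h₂ =>
    obtain ⟨κ, _, J, J', T, h1, h2, h3⟩ := h₁
    obtain ⟨κ₂, _, J₂, J₂', T₂, h1', h2', h3'⟩ := h₂
    refine ⟨κ ⊕ κ₂, inferInstance, Sum.elim J J₂, Sum.elim J' J₂', T ∪ T₂, ?_,
      fun j y hy hm => ?_, fun B β hB => ?_⟩
    · rintro (i | i)
      · exact h1 i
      · exact h1' i
    · rw [Function.locallyFinsuppWithin.coe_add, Pi.add_apply, h2 j y hy hm, h2' j y hy hm]
      simp only [Fintype.sum_sum_type, Sum.elim_inl, Sum.elim_inr]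
      ring
    · rw [Finset.coe_union, Set.union_subset_iff] at hB
      obtain ⟨z, hz, I, I', h4, h5⟩ := h3 B β hB.1
      obtain ⟨z₂, hz₂, I₂, I₂', h4', h5'⟩ := h3' B β hB.2
      refine ⟨z + z₂, add_mem hz hz₂, Sum.elim I I₂, Sum.elim I' I₂', ?_, fun j y hy => ?_⟩
      · rintro (i | i)
        · exact h4 i
        · exact h4' i
      · rw [Function.locallyFinsuppWithin.coe_add, Pi.add_apply, h5 j y hy, h5' j y hy]
        simp only [Fintype.sum_sum_type, Sum.elim_inl, Sum.elim_inr]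
        ring
  | neg z₁ _ h₁ =>
    obtain ⟨κ, _, J, J', T, h1, h2, h3⟩ := h₁
    refine ⟨κ, inferInstance, J', J, T, fun i j => (h1 i j).symm, fun j y hy hm => ?_,
      fun B β hB => ?_⟩
    · rw [Function.locallyFinsuppWithin.coe_neg, Pi.neg_apply, h2 j y hy hm, neg_sub]
    · obtain ⟨z, hz, I, I', h4, h5⟩ := h3 B β hB
      refine ⟨-z, neg_mem hz, I', I, fun i j => (h4 i j).symm, fun j y hy => ?_⟩
      rw [Function.locallyFinsuppWithin.coe_neg, Pi.neg_apply, h5 j y hy, neg_sub]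

include H in
/-- Relations between rational points descend along existentially closed extensions. -/
theorem smul_pointClass_sub_eq_zero_of_extension [CompactSpace Y]
    (h : IsExistentiallyClosed F F') {a b : Spec (.of F) ⟶ Y} (ha : a ≫ s = 𝟙 _)
    (hb : b ≫ s = 𝟙 _) {a' b' : Spec (.of F') ⟶ Y'} (ha' : a' ≫ s' = 𝟙 _) (hb' : b' ≫ s' = 𝟙 _)
    {x y : Spec (.of F)} {x' y' : Spec (.of F')} (hx : g (a' x') = a x) (hy : g (b' y') = b y)
    {n : ℕ} (hn : n • (pointClass (a' x') - pointClass (b' y')) = 0) :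
    n • (pointClass (a x) - pointClass (b y)) = 0 := by
  classical
  rw [smul_pointClass_sub_eq_zero_iff] at hn ⊢
  obtain ⟨z', hz', h0⟩ := hn
  have := isAffineHom_of_isPullback H
  let 𝒰 := Y.affineCover.finiteSubcover
  let U : Fin (Nat.card 𝒰.I₀) → Y.Opens := fun j => (𝒰.f ((Finite.equivFin _).symm j)).opensRange
  have hU : ∀ j, IsAffineOpen (U j) := fun j => isAffineOpen_opensRange _
  have hU' : ∀ j, IsAffineOpen (g ⁻¹ᵁ U j) := fun j => (hU j).preimage g
  have hcov : ∀ y, ∃ j, y ∈ U j := fun y => ⟨Finite.equivFin _ (𝒰.idx y), by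
    have := 𝒰.covers y
    change y ∈ (𝒰.f _).opensRange
    rw [Equiv.symm_apply_apply]
    exact this⟩
  obtain ⟨κ, _, J, J', T, h1, h2, h3⟩ :=
    exists_specialization_of_mem_rationalEquivalence H hU hU' hcov hz'
  obtain ⟨B, hB, ⟨β⟩⟩ := h.exists_algHom T
  obtain ⟨z, hz, I, I', h4, h5⟩ := h3 B β hB
  refine ⟨z, hz, fun w => ?_⟩
  obtain ⟨j, hw⟩ := hcov w
  have key := sum_chartLength_eq_of_specializesTo (s := s) (s' := s') β (hU j) (hU' j)
    (ι := κ ⊕ Fin n)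
    (J := Sum.elim (fun i => J i j) fun _ => pointIdeal (hU' j) (b' y'))
    (J' := Sum.elim (fun i => J' i j) fun _ => pointIdeal (hU' j) (a' x'))
    (I := Sum.elim (fun i => I i j) fun _ => pointIdeal (hU j) (b y))
    (I' := Sum.elim (fun i => I' i j) fun _ => pointIdeal (hU j) (a x))
    (by
      rintro (i | i)
      · exact (h1 i j).1
      · exact finite_quotient_pointIdeal b' hb' (hU' j) y')
    (by
      rintro (i | i)
      · exact (h1 i j).2
      · exact finite_quotient_pointIdeal a' ha' (hU' j) x')
    (by
      rintro (i | i)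
      · exact (h4 i j).1
      · exact specializesTo_pointIdeal H.w β hb hb' hy (hU j) (hU' j))
    (by
      rintro (i | i)
      · exact (h4 i j).2
      · exact specializesTo_pointIdeal H.w β ha ha' hx (hU j) (hU' j))
    (fun w' hw' hm => by
      simp only [Fintype.sum_sum_type, Sum.elim_inl, Sum.elim_inr,
        chartLength_pointIdeal b' hb' (hU' j) y' hw', chartLength_pointIdeal a' ha' (hU' j) x' hw']
      rw [sum_add_sum_eq_iff_toNat (fun i => chartLength_ne_top (hU' j) _ (h1 i j).1 w')
        (fun i => chartLength_ne_top (hU' j) _ (h1 i j).2 w'), ← h2 j w' hw' hm, h0 w']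
      push_cast
      rfl) hw
  simp only [Fintype.sum_sum_type, Sum.elim_inl, Sum.elim_inr,
    chartLength_pointIdeal b hb (hU j) y hw, chartLength_pointIdeal a ha (hU j) x hw] at key
  rw [sum_add_sum_eq_iff_toNat (fun i => chartLength_ne_top (hU j) _ (h4 i j).1.finite w)
    (fun i => chartLength_ne_top (hU j) _ (h4 i j).2.finite w), ← h5 j w hw] at key
  rw [key]
  push_cast
  rfl

end Specialization

/-! ### Residue fields -/

section ResidueField

variable {Y : Scheme.{u}} {U : Y.Opens} (hU : IsAffineOpen U)

theorem evaluation_eq_zero_iff_mem_primeIdealOf {y : Y} (hy : y ∈ U) (a : Γ(Y, U)) :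
    (Y.evaluation U y hy).hom a = 0 ↔ a ∈ (hU.primeIdealOf ⟨y, hy⟩).asIdeal := by
  let := (Y.presheaf.germ U y hy).hom.toAlgebra
  have : IsLocalization.AtPrime (Y.presheaf.stalk y) (hU.primeIdealOf ⟨y, hy⟩).asIdeal :=
    hU.isLocalization_stalk ⟨y, hy⟩
  rw [← IsLocalization.AtPrime.to_map_mem_maximal_iff (Y.presheaf.stalk y)
    (hU.primeIdealOf ⟨y, hy⟩).asIdeal a]
  exact Ideal.Quotient.eq_zero_iff_mem

include hU in
theorem exists_mul_evaluation_eq {y : Y} (hy : y ∈ U) (t : Y.residueField y) :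
    ∃ a b : Γ(Y, U), (Y.evaluation U y hy).hom b ≠ 0 ∧
      t * (Y.evaluation U y hy).hom b = (Y.evaluation U y hy).hom a := by
  let := (Y.presheaf.germ U y hy).hom.toAlgebra
  have : IsLocalization.AtPrime (Y.presheaf.stalk y) (hU.primeIdealOf ⟨y, hy⟩).asIdeal :=
    hU.isLocalization_stalk ⟨y, hy⟩
  obtain ⟨t, rfl⟩ := Y.residue_surjective y t
  obtain ⟨⟨a, b⟩, hab⟩ := IsLocalization.surj (hU.primeIdealOf ⟨y, hy⟩).asIdeal.primeCompl t
  refine ⟨a, b, fun h => b.2 ((evaluation_eq_zero_iff_mem_primeIdealOf hU hy _).mp h), ?_⟩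
  have h1 := congrArg (Y.residue y).hom hab
  rw [map_mul] at h1
  exact h1

variable {k K : Type u} [Field k] [Field K] [Algebra k K] {Y' : Scheme.{u}}
  {s : Y ⟶ Spec (.of k)} {s' : Y' ⟶ Spec (.of K)} {g : Y' ⟶ Y}

/-- The residue field extension at a generic point of a fibre of a base change. -/
theorem isExistentiallyClosed_residueField (h : IsExistentiallyClosed k K)
    (H : IsPullback g s' s (specExtension k K)) {y : Y'} (hy : IsFiberMinimal g y) :
    letI := (g.residueFieldMap y).hom.toAlgebra
    IsExistentiallyClosed (Y.residueField (g y)) (Y'.residueField y) := by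
  obtain ⟨U, hU, hyU, -⟩ := exists_isAffineOpen_mem_and_subset (x := g y) (U := ⊤) trivial
  have := isAffineHom_of_isPullback H
  have hU' : IsAffineOpen (g ⁻¹ᵁ U) := hU.preimage g
  let A : Type u := Γ(Y, U)
  let A' : Type u := Γ(Y', g ⁻¹ᵁ U)
  let F : Type u := Y.residueField (g y)
  let F' : Type u := Y'.residueField y
  let ev : A →+* F := (Y.evaluation U (g y) hyU).hom
  let ev' : A' →+* F' := (Y'.evaluation (g ⁻¹ᵁ U) y hyU).hom
  let : Field F := inferInstanceAs (Field (Y.residueField (g y)))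
  let : Field F' := inferInstanceAs (Field (Y'.residueField y))
  let : Algebra F F' := (g.residueFieldMap y).hom.toAlgebra
  let : Algebra k A := (scalars s U).toAlgebra
  let : Algebra k F := (ev.comp (scalars s U)).toAlgebra
  let : Algebra K F' := (ev'.comp (scalars s' (g ⁻¹ᵁ U))).toAlgebra
  let : Algebra k F' := ((algebraMap K F').comp (algebraMap k K)).toAlgebra
  have : IsScalarTower k K F' := .of_algebraMap_eq fun _ => rfl
  have hnat : ∀ a : A, algebraMap F F' (ev a) = ev' (g.app U a) := fun a =>
    Scheme.evaluation_naturality_apply g y hyU a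
  have : IsScalarTower k F F' := .of_algebraMap_eq fun c => by
    have h1 := app_scalars g s U c
    rw [H.w, scalars_comp_specExtension] at h1
    have h2 := (hnat (scalars s U c)).trans (congrArg ev' h1)
    exact h2.symm
  obtain ⟨e, he, he'⟩ := exists_tensorEquiv H hU
  let φ : K ⊗[k] F →ₐ[k] F' := Algebra.TensorProduct.productMap
    (IsScalarTower.toAlgHom k K F') (IsScalarTower.toAlgHom k F F')
  let evₐ : A →ₐ[k] F := { ev with commutes' := fun _ => rfl }
  let ψ : K ⊗[k] A →ₐ[k] K ⊗[k] F := Algebra.TensorProduct.map (AlgHom.id k K) evₐ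
  have hφψ : ∀ u : K ⊗[k] A, φ (ψ u) = ev' (e u) := by
    intro u
    induction u with
    | zero => simp
    | add u v hu hv => rw [map_add, map_add, hu, hv, map_add, map_add]
    | tmul c a =>
      have h1 : c ⊗ₜ[k] a = c ⊗ₜ[k] (1 : A) * (1 : K) ⊗ₜ[k] a := by
        rw [Algebra.TensorProduct.tmul_mul_tmul, mul_one, one_mul]
      have h2 : e (c ⊗ₜ[k] a) = scalars s' (g ⁻¹ᵁ U) c * g.app U a := by
        rw [h1, map_mul, he, he']
      rw [h2, map_mul, ← hnat a]
      exact Algebra.TensorProduct.productMap_apply_tmul _ _ _ _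
  have hp := (isFiberMinimal_iff h H hU hU' hyU).mp hy
  have hker : ∀ u : K ⊗[k] A, ev' (e u) = 0 → ψ u = 0 := by
    intro u hu
    have h1 : e u ∈ (hU'.primeIdealOf ⟨y, hyU⟩).asIdeal :=
      (evaluation_eq_zero_iff_mem_primeIdealOf hU' hyU _).mp hu
    rw [← hp] at h1
    have h2 : (hU.primeIdealOf ⟨g y, hyU⟩).asIdeal.map (g.app U).hom ≤
        RingHom.ker ((ψ : K ⊗[k] A →+* K ⊗[k] F).comp (e.symm : A' →+* K ⊗[k] A)) := by
      rw [Ideal.map_le_iff_le_comap]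
      intro a ha
      rw [Ideal.mem_comap, RingHom.mem_ker]
      have h3 : e.symm (g.app U a) = 1 ⊗ₜ a := by rw [← he, RingEquiv.symm_apply_apply]
      change ψ (e.symm (g.app U a)) = 0
      rw [h3]
      have h4 : ev a = 0 := (evaluation_eq_zero_iff_mem_primeIdealOf hU hyU _).mpr ha
      change (1 : K) ⊗ₜ[k] (ev a) = 0
      rw [h4, TensorProduct.tmul_zero]
    have h3 := h2 h1
    rw [RingHom.mem_ker] at h3
    change ψ (e.symm (e u)) = 0 at h3
    rwa [RingEquiv.symm_apply_apply] at h3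
  have hden : ∀ t : K ⊗[k] F, ∃ (a : A) (u : K ⊗[k] A), ev a ≠ 0 ∧ t * (1 ⊗ₜ ev a) = ψ u := by
    intro t
    induction t with
    | zero => exact ⟨1, 0, by simp, by simp⟩
    | tmul c x =>
      obtain ⟨a, b, hb, hab⟩ := exists_mul_evaluation_eq hU hyU x
      refine ⟨b, c ⊗ₜ a, hb, ?_⟩
      rw [Algebra.TensorProduct.tmul_mul_tmul, mul_one]
      exact congrArg (c ⊗ₜ[k] ·) hab
    | add t₁ t₂ h₁ h₂ =>
      obtain ⟨a₁, u₁, ha₁, h₁⟩ := h₁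
      obtain ⟨a₂, u₂, ha₂, h₂⟩ := h₂
      have hψ : ∀ a : A, ψ (1 ⊗ₜ a) = 1 ⊗ₜ ev a := fun a => rfl
      refine ⟨a₁ * a₂, u₁ * (1 ⊗ₜ a₂) + u₂ * (1 ⊗ₜ a₁), ?_, ?_⟩
      · rw [map_mul]; exact mul_ne_zero ha₁ ha₂
      · have h3 : (1 : K) ⊗ₜ[k] ev (a₁ * a₂) = (1 ⊗ₜ ev a₁) * (1 ⊗ₜ ev a₂) := by
          rw [Algebra.TensorProduct.tmul_mul_tmul, mul_one, map_mul]
        rw [h3, map_add, map_mul ψ, map_mul ψ, ← h₁, ← h₂, hψ, hψ]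
        ring
  refine h.of_isFractionRing (F := F) (F' := F') (φ : K ⊗[k] F →+* F') ?_ (fun x => ?_)
    fun t => ?_
  · rw [injective_iff_map_eq_zero]
    intro t ht
    obtain ⟨a, u, ha, hu⟩ := hden t
    have h1 : ψ u = 0 := by
      refine hker u ?_
      rw [← hφψ, ← hu, map_mul]
      exact (congrArg (· * _) ht).trans (zero_mul _)
    rw [h1] at hu
    have h2 : IsUnit ((1 : K) ⊗ₜ[k] ev a) :=
      .of_mul_eq_one ((1 : K) ⊗ₜ[k] (ev a)⁻¹) (by
        rw [Algebra.TensorProduct.tmul_mul_tmul, mul_one, mul_inv_cancel₀ ha]; rfl)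
    exact (h2.mul_left_eq_zero).mp hu
  · exact (Algebra.TensorProduct.productMap_apply_tmul _ _ _ _).trans (by simp)
  · obtain ⟨a, b, hb, hab⟩ := exists_mul_evaluation_eq hU' hyU t
    refine ⟨ψ (e.symm a), ψ (e.symm b), fun h0 => hb ?_, ?_⟩
    · have h1 := hφψ (e.symm b)
      rw [h0, map_zero, RingEquiv.apply_symm_apply] at h1
      exact h1.symm
    · have h1 := hφψ (e.symm b)
      have h2 := hφψ (e.symm a)
      rw [RingEquiv.apply_symm_apply] at h1 h2
      exact (congrArg (t * ·) h1).trans (hab.trans h2.symm)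

end ResidueField

/-! ### Generic points of base changes -/

section GenericPoints

theorem mem_componentGenericPoints_iff {C : Scheme.{u}} {η : C} :
    η ∈ componentGenericPoints C ↔ ∀ ζ : C, ζ ⤳ η → ζ = η := by
  constructor
  · intro h ζ hζ
    have h1 : closure {η} ⊆ closure {ζ} := hζ.closure_subset
    have h2 : closure {ζ} ⊆ closure {η} := h.2 isIrreducible_singleton.closure h1
    exact (hζ.antisymm (specializes_iff_closure_subset.mpr h2)).eq
  · intro h
    refine ⟨isIrreducible_singleton.closure, fun Z hZ hle => ?_⟩
    obtain ⟨ζ, hζ⟩ := QuasiSober.sober hZ.closure isClosed_closure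
    have h1 : ζ ⤳ η := by
      rw [specializes_iff_mem_closure, hζ.def]
      exact subset_closure (hle (subset_closure rfl))
    rw [h ζ h1] at hζ
    rw [hζ.def]
    exact subset_closure

variable {k K : Type u} [Field k] [Field K] [Algebra k K] {Y Y' : Scheme.{u}}
  {s : Y ⟶ Spec (.of k)} {s' : Y' ⟶ Spec (.of K)} {g : Y' ⟶ Y}
  (H : IsPullback g s' s (specExtension k K))

include H in
theorem map_mem_componentGenericPoints {η : Y'} (hη : η ∈ componentGenericPoints Y') :
    g η ∈ componentGenericPoints Y := by
  have h1 : Flat (specExtension k K) := by rw [specExtension]; infer_instance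
  have h4 : Flat g := MorphismProperty.of_isPullback H.flip h1
  rw [mem_componentGenericPoints_iff] at hη ⊢
  intro ζ hζ
  obtain ⟨ζ', h2, rfl⟩ := Flat.generalizingMap g hζ
  rw [hη ζ' h2]

include H in
theorem exists_mem_componentGenericPoints {η : Y} (hη : η ∈ componentGenericPoints Y) :
    ∃ η' ∈ componentGenericPoints Y', g η' = η := by
  obtain ⟨y, rfl⟩ := surjective_of_isPullback H η
  obtain ⟨η', h⟩ := QuasiSober.sober (isIrreducible_irreducibleComponent (x := y))
    isClosed_irreducibleComponent
  refine ⟨η', ?_, mem_componentGenericPoints_iff.mp hη _ (Specializes.map ?_ g.continuous)⟩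
  · change closure {η'} ∈ irreducibleComponents Y'
    rw [h.def]
    exact irreducibleComponent_mem_irreducibleComponents y
  · rw [specializes_iff_mem_closure, h.def]
    exact mem_irreducibleComponent

end GenericPoints

/-! ### Rational points and rational curves under base change -/

section RationalPoints

variable {F F' : Type u} [Field F] [Field F'] [Algebra F F'] {Y Y' : Scheme.{u}}
  {s : Y ⟶ Spec (.of F)} {s' : Y' ⟶ Spec (.of F')} {g : Y' ⟶ Y}
  (H : IsPullback g s' s (specExtension F F'))

include H in
/-- A rational point has a unique preimage under base change. -/
theorem map_eq_section_iff {a : Spec (.of F) ⟶ Y} (ha : a ≫ s = 𝟙 _)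
    {a' : Spec (.of F') ⟶ Y'} (ha' : a' ≫ s' = 𝟙 _) (w : a' ≫ g = specExtension F F' ≫ a)
    (x : Spec (.of F)) (x' : Spec (.of F')) (y : Y') : g y = a x ↔ y = a' x' := by
  have h1 : IsPullback (a' ≫ s') (specExtension F F') (specExtension F F') (a ≫ s) := by
    rw [ha, ha']
    exact IsPullback.of_horiz_isIso ⟨by rw [Category.id_comp, Category.comp_id]⟩
  have h2 : IsPullback a' (specExtension F F') g a := IsPullback.of_right h1 w H.flip
  constructor
  · intro h
    obtain ⟨p, hp, -⟩ := Scheme.exists_preimage_of_isPullback h2 y x h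
    have : p = x' := Subsingleton.elim (α := PrimeSpectrum F') _ _
    rw [← this]
    exact hp.symm
  · rintro rfl
    have h3 : g (a' x') = (specExtension F F' ≫ a) x' := by rw [← w, Scheme.Hom.comp_apply]
    rw [h3, Scheme.Hom.comp_apply]
    exact congrArg a (Subsingleton.elim (α := PrimeSpectrum F) _ _)

include H in
theorem pointClass_eq_of_extension [LocallyOfFiniteType s] (h : IsExistentiallyClosed F F')
    {a b : Spec (.of F) ⟶ Y} (ha : a ≫ s = 𝟙 _)
    (hb : b ≫ s = 𝟙 _) {a' b' : Spec (.of F') ⟶ Y'} (ha' : a' ≫ s' = 𝟙 _) (hb' : b' ≫ s' = 𝟙 _)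
    (wa : a' ≫ g = specExtension F F' ≫ a) (wb : b' ≫ g = specExtension F F' ≫ b)
    {x y : Spec (.of F)} {x' y' : Spec (.of F')} (hn : pointClass (a x) = pointClass (b y)) :
    pointClass (a' x') = pointClass (b' y') := by
  have h1 := smul_pointClass_sub_eq_zero_of_isPullback h H (n := 1)
    (map_eq_section_iff H ha ha' wa x x') (map_eq_section_iff H hb hb' wb y y')
    (by rw [one_smul, hn, sub_self])
  rwa [one_smul, sub_eq_zero] at h1

include H in
theorem addOrderOf_pointClass_sub_of_extension [LocallyOfFiniteType s] [CompactSpace Y]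
    (h : IsExistentiallyClosed F F') {a b : Spec (.of F) ⟶ Y} (ha : a ≫ s = 𝟙 _)
    (hb : b ≫ s = 𝟙 _) {a' b' : Spec (.of F') ⟶ Y'} (ha' : a' ≫ s' = 𝟙 _) (hb' : b' ≫ s' = 𝟙 _)
    (wa : a' ≫ g = specExtension F F' ≫ a) (wb : b' ≫ g = specExtension F F' ≫ b)
    (x y : Spec (.of F)) (x' y' : Spec (.of F')) :
    addOrderOf (pointClass (a x) - pointClass (b y)) =
      addOrderOf (pointClass (a' x') - pointClass (b' y')) := by
  have h1 := map_eq_section_iff H ha ha' wa x x'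
  have h2 := map_eq_section_iff H hb hb' wb y y'
  refine Nat.dvd_antisymm ?_ ?_
  · rw [addOrderOf_dvd_iff_nsmul_eq_zero]
    exact smul_pointClass_sub_eq_zero_of_extension H h ha hb ha' hb' ((h1 _).mpr rfl)
      ((h2 _).mpr rfl) (addOrderOf_nsmul_eq_zero _)
  · rw [addOrderOf_dvd_iff_nsmul_eq_zero]
    exact smul_pointClass_sub_eq_zero_of_isPullback h H h1 h2 (addOrderOf_nsmul_eq_zero _)

end RationalPoints

section Birational

variable {S S' X X' Y Y' : Scheme.{u}} {sX : X ⟶ S} {sY : Y ⟶ S} {sX' : X' ⟶ S'} {sY' : Y' ⟶ S'}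
  {gX : X' ⟶ X} {gY : Y' ⟶ Y} {r : S' ⟶ S}

theorem birationalOver_of_isPullback [Surjective r] [IrreducibleSpace X'] [IrreducibleSpace Y']
    (hX : IsPullback gX sX' sX r) (hY : IsPullback gY sY' sY r)
    (h : Scheme.BirationalOver sX sY) : Scheme.BirationalOver sX' sY' := by
  obtain ⟨e, he⟩ := h
  have hXs : Surjective gX := MorphismProperty.of_isPullback hX.flip ‹Surjective r›
  obtain ⟨x₀⟩ : Nonempty X' := inferInstance
  have : Nonempty X := ⟨gX x₀⟩
  let u : e.source.toScheme ⟶ X := e.source.ι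
  let v : e.source.toScheme ⟶ Y := e.iso.hom ≫ e.target.ι
  have hv : v ≫ sY = u ≫ sX := by rw [Category.assoc]; exact he
  let U' := pullback (u ≫ sX) r
  let u' : U' ⟶ X' := hX.lift (pullback.fst _ _ ≫ u) (pullback.snd _ _) (by
    rw [Category.assoc, pullback.condition])
  let v' : U' ⟶ Y' := hY.lift (pullback.fst _ _ ≫ v) (pullback.snd _ _) (by
    rw [Category.assoc, hv, pullback.condition])
  have hu : u' ≫ sX' = pullback.snd (u ≫ sX) r := hX.lift_snd _ _ _
  have hv' : v' ≫ sY' = pullback.snd (u ≫ sX) r := hY.lift_snd _ _ _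
  have hpu : IsPullback (pullback.fst (u ≫ sX) r) u' u gX :=
    IsPullback.of_bot (by rw [hu]; exact IsPullback.of_hasPullback _ _)
      (hX.lift_fst _ _ _).symm hX
  have hpv : IsPullback (pullback.fst (u ≫ sX) r) v' v gY :=
    IsPullback.of_bot (by rw [hv', hv]; exact IsPullback.of_hasPullback _ _)
      (hY.lift_fst _ _ _).symm hY
  have hu_open : IsOpenImmersion u' := MorphismProperty.of_isPullback hpu inferInstance
  have hv_open : IsOpenImmersion v' := MorphismProperty.of_isPullback hpv inferInstance
  obtain ⟨x₁, hx₁⟩ := e.dense_source.nonempty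
  obtain ⟨p, -⟩ := (inferInstance : Surjective (pullback.fst (u ≫ sX) r)).surj ⟨x₁, hx₁⟩
  have hdu : IsDominant u' := ⟨u'.isOpenEmbedding.isOpen_range.dense ⟨_, ⟨p, rfl⟩⟩⟩
  have hdv : IsDominant v' := ⟨v'.isOpenEmbedding.isOpen_range.dense ⟨_, ⟨p, rfl⟩⟩⟩
  exact (u'.birationalOver sX' _ hu).symm.trans (v'.birationalOver sY' _ hv')

end Birational

section K3

variable {k : Type u} [Field k] {X : Scheme.{u}}

theorem IsProjectiveOver.quasiCompact {f : X ⟶ Spec (.of k)} (h : IsProjectiveOver f) :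
    QuasiCompact f := by
  obtain ⟨n, j, _, rfl⟩ := h
  let : GradedAlgebra (MvPolynomial.homogeneousSubmodule (Fin (n + 1)) k) :=
    MvPolynomial.gradedAlgebra
  have : IsScalarTower k (MvPolynomial.homogeneousSubmodule (Fin (n + 1)) k 0)
      (MvPolynomial (Fin (n + 1)) k) := ⟨fun a b c => smul_mul_assoc a (b : MvPolynomial (Fin (n + 1)) k) c⟩
  have : Algebra.FiniteType (MvPolynomial.homogeneousSubmodule (Fin (n + 1)) k 0)
      (MvPolynomial (Fin (n + 1)) k) := .of_restrictScalars_finiteType k _ _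
  infer_instance

theorem IsProjectiveK3Surface.locallyOfFiniteType {f : X ⟶ Spec (.of k)}
    (h : IsProjectiveK3Surface f) : LocallyOfFiniteType f := by
  have := h.smooth
  have := SmoothOfRelativeDimension.smooth 2 f
  infer_instance

variable {K : Type u} [Field K] [Algebra k K] (f : X ⟶ Spec (.of k))

/-- The base change `x ×ₖ K` of a rational point. -/
def baseChangePoint (K : Type u) [Field K] [Algebra k K] (x : Spec (.of k) ⟶ X)
    (hx : x ≫ f = 𝟙 _) : Spec (.of K) ⟶ pullback f (specExtension k K) :=
  pullback.lift (specExtension k K ≫ x) (𝟙 _) (by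
    rw [Category.assoc, hx, Category.comp_id, Category.id_comp])

theorem baseChangePoint_fst (x : Spec (.of k) ⟶ X) (hx : x ≫ f = 𝟙 _) :
    baseChangePoint f K x hx ≫ pullback.fst _ _ = specExtension k K ≫ x :=
  pullback.lift_fst _ _ _

theorem baseChangePoint_snd (x : Spec (.of k) ⟶ X) (hx : x ≫ f = 𝟙 _) :
    baseChangePoint f K x hx ≫ pullback.snd _ _ = 𝟙 _ :=
  pullback.lift_snd _ _ _

theorem baseChange_fst {C : Scheme.{u}} (i : C ⟶ X) :
    baseChange f i K ≫ pullback.fst _ _ = pullback.fst _ _ ≫ i :=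
  pullback.lift_fst _ _ _

theorem baseChange_snd {C : Scheme.{u}} (i : C ⟶ X) :
    baseChange f i K ≫ pullback.snd _ _ = pullback.snd _ _ :=
  (pullback.lift_snd _ _ _).trans (Category.comp_id _)

theorem isPullback_baseChange {C : Scheme.{u}} (i : C ⟶ X) :
    IsPullback (pullback.fst (i ≫ f) (specExtension k K)) (baseChange f i K) i
      (pullback.fst f (specExtension k K)) :=
  IsPullback.of_bot (by rw [baseChange_snd]; exact IsPullback.of_hasPullback _ _)
    (baseChange_fst f i).symm (IsPullback.of_hasPullback f (specExtension k K))

/-- The base change of the Beauville–Voisin class is the Beauville–Voisin class. -/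
theorem pointClass_baseChangePoint [IsAlgClosed k] [IsAlgClosed K] [LocallyOfFiniteType f]
    (x₀ : Spec (.of k) ⟶ X) (hx₀ : x₀ ≫ f = 𝟙 _)
    (hx₀_bv : IsBeauvilleVoisinClass f (rationalPointClass x₀)) {c : ChowGroup _}
    (hc : IsBeauvilleVoisinClass (pullback.snd f (specExtension k K)) c) :
    rationalPointClass (baseChangePoint f K x₀ hx₀) = c := by
  have hec := isExistentiallyClosed_of_isAlgClosed k K
  obtain ⟨⟨x, hxr⟩, h2⟩ := hx₀_bv
  have hxc := h2 x hxr
  obtain ⟨hx, R, _, j, _, hR, hxR⟩ := hxr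
  let a := pointOfClosedPoint f x hx
  have ha : a ≫ f = 𝟙 _ := pointOfClosedPoint_comp f x hx
  have hax : ∀ t, a t = x := pointOfClosedPoint_apply f x hx
  let t : Spec (.of k) := IsLocalRing.closedPoint k
  let t' : Spec (.of K) := IsLocalRing.closedPoint K
  let x' := baseChangePoint f K a ha t'
  have hxx : pullback.fst f (specExtension k K) x' = x := by
    simp only [x']
    rw [← Scheme.Hom.comp_apply, baseChangePoint_fst, Scheme.Hom.comp_apply, hax]
  have H := IsPullback.of_hasPullback f (specExtension k K)
  have h3 : pointClass x' = rationalPointClass (baseChangePoint f K x₀ hx₀) :=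
    pointClass_eq_of_extension H hec ha hx₀ (baseChangePoint_snd f a ha)
      (baseChangePoint_snd f x₀ hx₀) (baseChangePoint_fst f a ha) (baseChangePoint_fst f x₀ hx₀)
      (x := t) (y := t) (by rw [hax]; exact hxc)
  rw [← h3]
  refine hc.2 x' ⟨?_, ?_⟩
  · exact (pointEquivClosedPoint (pullback.snd f (specExtension k K))
      ⟨_, baseChangePoint_snd f a ha⟩).2
  have : IsLocallyNoetherian R := isLocallyNoetherian_of_locallyOfFiniteType (j ≫ f)
  have HR := IsPullback.of_hasPullback (j ≫ f) (specExtension k K)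
  have hRint := isIntegral_of_isPullback hec (j ≫ f) HR
  have hsurj : Surjective (specExtension k K) := by rw [specExtension]; infer_instance
  refine ⟨_, hRint, baseChange f j K,
    MorphismProperty.of_isPullback (isPullback_baseChange f j) ‹IsClosedImmersion j›, ?_, ?_⟩
  · rw [baseChange_snd]
    exact birationalOver_of_isPullback HR (AffineSpace.isPullback_map (specExtension k K)) hR
  · obtain ⟨r, hr⟩ := hxR
    obtain ⟨r', -, hr'⟩ := Scheme.exists_preimage_of_isPullback (isPullback_baseChange f j) r x'
      (hr.trans hxx.symm)
    exact ⟨r', hr'⟩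

end K3

/-! ### The class `κ` under base change -/

section Kappa

variable {k : Type u} [Field k] {X : Scheme.{u}} (f : X ⟶ Spec (.of k)) [LocallyOfFiniteType f]

theorem pointClass_rationalPoint_eq [IsAlgClosed k] {L : Type u} [Field L]
    (q : Spec (.of L) ⟶ Spec (.of k)) {x y : Spec (.of k) ⟶ X} (hx : x ≫ f = 𝟙 _)
    (hy : y ≫ f = 𝟙 _) (h : rationalPointClass x = rationalPointClass y) :
    pointClass (rationalPoint f q (q ≫ x) (by rw [Category.assoc, hx, Category.comp_id])) =
      pointClass (rationalPoint f q (q ≫ y) (by rw [Category.assoc, hy, Category.comp_id])) := by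
  obtain ⟨φ, rfl⟩ := Spec.map_surjective q
  let : Algebra k L := φ.hom.toAlgebra
  have H : IsPullback (pullback.fst f (Spec.map φ)) (pullback.snd f (Spec.map φ)) f
    (specExtension k L) := IsPullback.of_hasPullback f (Spec.map φ)
  exact pointClass_eq_of_extension H (isExistentiallyClosed_of_isAlgClosed k L) hx hy
    (pullback.lift_snd _ _ _) (pullback.lift_snd _ _ _) (pullback.lift_fst _ _ _)
    (pullback.lift_fst _ _ _) h

theorem kappa_eq_kappa [IsAlgClosed k] {C : Scheme.{u}} (i : C ⟶ X) {x y : Spec (.of k) ⟶ X}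
    (hx : x ≫ f = 𝟙 _) (hy : y ≫ f = 𝟙 _) (h : rationalPointClass x = rationalPointClass y)
    (η : C) : kappa f i x hx η = kappa f i y hy η := by
  rw [kappa, kappa]
  congr 1
  exact pointClass_rationalPoint_eq f (L := C.residueField η) _ hx hy h

variable {K : Type u} [Field K] [Algebra k K] [QuasiCompact f]

theorem addOrderOf_kappa_baseChange (h : IsExistentiallyClosed k K) {C : Scheme.{u}} (i : C ⟶ X)
    (x : Spec (.of k) ⟶ X) (hx : x ≫ f = 𝟙 _)
    {η : (pullback (i ≫ f) (specExtension k K) : Scheme.{u})}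
    (hη : IsFiberMinimal (pullback.fst (i ≫ f) (specExtension k K)) η) :
    addOrderOf (kappa f i x hx (pullback.fst (i ≫ f) (specExtension k K) η)) =
      addOrderOf (kappa (pullback.snd f (specExtension k K)) (baseChange f i K)
        (baseChangePoint f K x hx) (baseChangePoint_snd f x hx) η) := by
  let π := pullback.fst (i ≫ f) (specExtension k K)
  let F : Type u := C.residueField (π η)
  let F' : Type u := (pullback (i ≫ f) (specExtension k K)).residueField η
  let : Field F := inferInstanceAs (Field (C.residueField (π η)))
  let : Field F' :=
    inferInstanceAs (Field ((pullback (i ≫ f) (specExtension k K)).residueField η))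
  let : Algebra F F' := (π.residueFieldMap η).hom.toAlgebra
  have hec : IsExistentiallyClosed F F' :=
    isExistentiallyClosed_residueField h (IsPullback.of_hasPullback (i ≫ f) (specExtension k K)) hη
  let r : Spec (.of F) ⟶ C := C.fromSpecResidueField (π η)
  let r' : Spec (.of F') ⟶ pullback (i ≫ f) (specExtension k K) :=
    (pullback (i ≫ f) (specExtension k K)).fromSpecResidueField η
  have hr : r' ≫ π = specExtension F F' ≫ r :=
    (Scheme.Hom.SpecMap_residueFieldMap_fromSpecResidueField π η).symm
  let q := r ≫ i ≫ f
  let fK := pullback.snd f (specExtension k K)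
  let q' := r' ≫ baseChange f i K ≫ fK
  have hq : q' ≫ specExtension k K = specExtension F F' ≫ q := by
    simp only [q', q, fK]
    rw [baseChange_snd, Category.assoc, ← pullback.condition, ← Category.assoc, hr, Category.assoc]
  let s := pullback.snd f q
  let s' := pullback.snd fK q'
  have w : (pullback.fst fK q' ≫ pullback.fst f (specExtension k K)) ≫ f =
      (s' ≫ specExtension F F') ≫ q := by
    rw [Category.assoc, pullback.condition, ← Category.assoc, pullback.condition, Category.assoc,
      hq, Category.assoc]
  let g : pullback fK q' ⟶ pullback f q := pullback.lift _ _ w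
  have hg1 : g ≫ pullback.fst f q = pullback.fst fK q' ≫ pullback.fst f (specExtension k K) :=
    pullback.lift_fst _ _ _
  have hg2 : g ≫ s = s' ≫ specExtension F F' := pullback.lift_snd _ _ _
  have H : IsPullback g s' s (specExtension F F') := by
    refine IsPullback.of_right (h₁₂ := pullback.fst f q) (v₁₃ := f) (h₂₂ := q) ?_ hg2
      (IsPullback.of_hasPullback f q)
    rw [hg1, ← hq]
    exact (IsPullback.of_hasPullback fK q').paste_horiz (IsPullback.of_hasPullback f _)
  have : CompactSpace (pullback f q : Scheme.{u}) := QuasiCompact.compactSpace_of_compactSpace s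
  let a : Spec (.of F) ⟶ pullback f q := pullback.lift (r ≫ i) (𝟙 _) (by
    rw [Category.assoc, Category.id_comp])
  let b : Spec (.of F) ⟶ pullback f q := pullback.lift (q ≫ x) (𝟙 _) (by
    rw [Category.assoc, hx, Category.comp_id, Category.id_comp])
  let a' : Spec (.of F') ⟶ pullback fK q' := pullback.lift (r' ≫ baseChange f i K) (𝟙 _) (by
    rw [Category.assoc, Category.id_comp])
  let b' : Spec (.of F') ⟶ pullback fK q' :=
    pullback.lift (q' ≫ baseChangePoint f K x hx) (𝟙 _) (by
      rw [Category.assoc, baseChangePoint_snd, Category.comp_id, Category.id_comp])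
  have ha : a ≫ s = 𝟙 _ := pullback.lift_snd _ _ _
  have hb : b ≫ s = 𝟙 _ := pullback.lift_snd _ _ _
  have ha' : a' ≫ s' = 𝟙 _ := pullback.lift_snd _ _ _
  have hb' : b' ≫ s' = 𝟙 _ := pullback.lift_snd _ _ _
  have wa : a' ≫ g = specExtension F F' ≫ a := by
    refine pullback.hom_ext ?_ ?_
    · have h1 : a' ≫ pullback.fst fK q' = r' ≫ baseChange f i K := pullback.lift_fst _ _ _
      have h2 : a ≫ pullback.fst f q = r ≫ i := pullback.lift_fst _ _ _
      rw [Category.assoc, hg1, ← Category.assoc, h1, Category.assoc, baseChange_fst,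
        Category.assoc, h2, ← Category.assoc, hr, Category.assoc]
    · rw [Category.assoc, Category.assoc]
      change a' ≫ g ≫ s = specExtension F F' ≫ a ≫ s
      rw [ha, hg2, ← Category.assoc, ha', Category.comp_id, Category.id_comp]
  have wb : b' ≫ g = specExtension F F' ≫ b := by
    refine pullback.hom_ext ?_ ?_
    · have h1 : b' ≫ pullback.fst fK q' = q' ≫ baseChangePoint f K x hx := pullback.lift_fst _ _ _
      have h2 : b ≫ pullback.fst f q = q ≫ x := pullback.lift_fst _ _ _
      have h3 : q' ≫ specExtension k K ≫ x = specExtension F F' ≫ q ≫ x := by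
        rw [← Category.assoc, hq, Category.assoc]
      rw [Category.assoc, hg1, ← Category.assoc, h1, Category.assoc q', baseChangePoint_fst, h3,
        Category.assoc _ b, h2]
    · rw [Category.assoc, Category.assoc]
      change b' ≫ g ≫ s = specExtension F F' ≫ b ≫ s
      rw [hb, hg2, ← Category.assoc, hb', Category.comp_id, Category.id_comp]
  exact addOrderOf_pointClass_sub_of_extension H hec ha hb ha' hb' wa wb _ _ _ _

end Kappa

end K3Curves

end

/-- Let `X` be a projective K3 surface over an algebraically closed field `k`, `C ⊂ X` a curve and
`K/k` an algebraically closed extension. Let `x₀` and `y₀` be closed points of `X` and `X_K` that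
represent the Beauville–Voisin classes of `X` and `X_K`. Then `C` is a constant cycle curve of
order `n` if and only if `C_K ⊂ X_K` is one. -/
theorem ccc_order_invariant_under_base_change {k K : Type u} [Field k] [IsAlgClosed k] [Field K]
    [IsAlgClosed K] [Algebra k K] {X C : Scheme.{u}} (f : X ⟶ Spec (.of k))
    (hX : K3Curves.IsProjectiveK3Surface f) (i : C ⟶ X) (hC : K3Curves.IsCurve i)
    (x₀ : Spec (.of k) ⟶ X) (hx₀ : x₀ ≫ f = 𝟙 (Spec (.of k)))
    (hx₀_bv : K3Curves.IsBeauvilleVoisinClass f (K3Curves.rationalPointClass x₀))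
    (y₀ : Spec (.of K) ⟶ pullback f (K3Curves.specExtension k K))
    (hy₀ : y₀ ≫ pullback.snd f (K3Curves.specExtension k K) = 𝟙 (Spec (.of K)))
    (hy₀_bv : K3Curves.IsBeauvilleVoisinClass (pullback.snd f (K3Curves.specExtension k K))
      (K3Curves.rationalPointClass y₀)) (n : ℕ) :
    K3Curves.IsConstantCycleCurveOfOrder f i x₀ hx₀ n ↔
      K3Curves.IsConstantCycleCurveOfOrder (pullback.snd f (K3Curves.specExtension k K))
        (K3Curves.baseChange f i K) y₀ hy₀ n := by
  have := hX.locallyOfFiniteType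
  have := hX.projective.quasiCompact
  have hec := K3Curves.isExistentiallyClosed_of_isAlgClosed k K
  have H := IsPullback.of_hasPullback (i ≫ f) (K3Curves.specExtension k K)
  have hclass : K3Curves.rationalPointClass (K3Curves.baseChangePoint f K x₀ hx₀) =
      K3Curves.rationalPointClass y₀ :=
    K3Curves.pointClass_baseChangePoint f x₀ hx₀ hx₀_bv hy₀_bv
  have horder : ∀ η ∈ K3Curves.componentGenericPoints
      (pullback (i ≫ f) (K3Curves.specExtension k K)),
      addOrderOf (K3Curves.kappa f i x₀ hx₀ (pullback.fst (i ≫ f) _ η)) =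
        addOrderOf (K3Curves.kappa (pullback.snd f (K3Curves.specExtension k K))
          (K3Curves.baseChange f i K) y₀ hy₀ η) := fun η hη => by
    rw [← K3Curves.kappa_eq_kappa _ _ (K3Curves.baseChangePoint_snd f x₀ hx₀) hy₀ hclass η]
    exact K3Curves.addOrderOf_kappa_baseChange f hec i x₀ hx₀ fun ζ hζ _ =>
      K3Curves.mem_componentGenericPoints_iff.mp hη ζ hζ
  have himage : (fun η => addOrderOf (K3Curves.kappa f i x₀ hx₀ η)) ''
      K3Curves.componentGenericPoints C =
      (fun η => addOrderOf (K3Curves.kappa (pullback.snd f (K3Curves.specExtension k K))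
        (K3Curves.baseChange f i K) y₀ hy₀ η)) '' K3Curves.componentGenericPoints _ := by
    ext m
    constructor
    · rintro ⟨η, hη, rfl⟩
      obtain ⟨η', hη', rfl⟩ := K3Curves.exists_mem_componentGenericPoints H hη
      exact ⟨η', hη', (horder η' hη').symm⟩
    · rintro ⟨η', hη', rfl⟩
      exact ⟨_, K3Curves.map_mem_componentGenericPoints H hη', horder η' hη'⟩
  rw [K3Curves.IsConstantCycleCurveOfOrder, K3Curves.IsConstantCycleCurveOfOrder, himage]
  refine and_congr_left fun _ => ⟨fun h η' hη' => ?_, fun h η hη => ?_⟩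
  · rw [← addOrderOf_pos_iff, ← horder η' hη', addOrderOf_pos_iff]
    exact h _ (K3Curves.map_mem_componentGenericPoints H hη')
  · obtain ⟨η', hη', rfl⟩ := K3Curves.exists_mem_componentGenericPoints H hη
    rw [← addOrderOf_pos_iff, horder η' hη', addOrderOf_pos_iff]
    exact h η' hη'
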